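/- Let n ≥ 2 and let μ be a non-negative Borel measure on S^{n−1} ⊂ ℝ^n with ∫_{S^{n−1}} X dμ(X) = 0 and support not contained in any great subsphere of S^{n−1}. If Ω and Ω' are open bounded convex subsets of ℝ^n with μ_{τ,Ω} = μ = μ_{τ,Ω'}, then Ω' is a translate of Ω, i.e., Ω' = Ω + {v} for some v ∈ ℝ^n. -/

import Mathlib

open MeasureTheory Metric Set Filter Bornology
open scoped Topology Pointwise RealInnerProductSpace ENNReal NNReal BigOperators Classical

noncomputable section

/-- Euclidean `n`-space. -/
abbrev Euc (n : ℕ) : Type := EuclideanSpace ℝ (Fin n)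

variable {n : ℕ}

/-- The Laplacian of `u`, as the sum of the pure second derivatives in the coordinate
directions. -/
def lapl (u : Euc n → ℝ) (x : Euc n) : ℝ :=
  ∑ i : Fin n, iteratedFDeriv ℝ 2 u x (fun _ => EuclideanSpace.single i (1 : ℝ))

/-- `u` is the torsion function of `Ω`: the solution of `Δu = -2` in `Ω`, `u = 0` on `∂Ω`,
continuous up to the boundary and smooth inside. -/
structure IsTorsionFunction (Ω : Set (Euc n)) (u : Euc n → ℝ) : Prop where
  continuousOn : ContinuousOn u (closure Ω)
  smooth : ContDiffOn ℝ (⊤ : ℕ∞) u Ω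
  lapl_eq : ∀ x ∈ Ω, lapl u x = -2
  boundary_zero : ∀ x ∈ frontier Ω, u x = 0

/-- The torsional rigidity `τ(Ω) = ∫_Ω ‖∇u‖²` where `u` is the torsion function of `Ω`. -/
def torsionRigidity (Ω : Set (Euc n)) : ℝ :=
  if h : ∃ u, IsTorsionFunction Ω u then ∫ x in Ω, ‖gradient h.choose x‖ ^ 2 else 0

/-- The nontangential cone `Γ_α(x̄) = {x ∈ Ω : |x - x̄| ≤ (1+α) dist(x, ∂Ω)}`. -/
def ntCone (Ω : Set (Euc n)) (x : Euc n) (α : ℝ) : Set (Euc n) :=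
  {y ∈ Ω | dist y x ≤ (1 + α) * infDist y (frontier Ω)}

/-- `w` has nontangential limit `L` at the boundary point `x`. -/
def HasNTLimitAt {F : Type*} [TopologicalSpace F] (Ω : Set (Euc n)) (w : Euc n → F)
    (x : Euc n) (L : F) : Prop :=
  ∀ α > 0, Tendsto w (𝓝[ntCone Ω x α] x) (𝓝 L)

/-- The nontangential boundary values of `∇u` (junk value `0` where they do not exist). -/
def ntGradient (Ω : Set (Euc n)) (u : Euc n → ℝ) (x : Euc n) : Euc n :=
  if h : ∃ L, HasNTLimitAt Ω (gradient u) x L then h.choose else 0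

/-- `X` is an outer unit normal to `K` at `x`. -/
def IsOuterNormalAt (K : Set (Euc n)) (x X : Euc n) : Prop :=
  ‖X‖ = 1 ∧ ∀ y ∈ K, ⟪y, X⟫ ≤ ⟪x, X⟫

/-- The Gauss map of `K`: the outer unit normal at the points of `∂K` where it is unique
(i.e. where `∂K` is differentiable), junk value `0` elsewhere. -/
def gaussMap (K : Set (Euc n)) (x : Euc n) : Euc n :=
  if h : ∃! X, IsOuterNormalAt K x X then h.choose else 0

/-- The support function of a set: `h_K(X) = sup_{y ∈ K} ⟨y, X⟩`. -/
def suppFn (K : Set (Euc n)) (X : Euc n) : ℝ :=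
  sSup ((fun y => ⟪y, X⟫) '' K)

/-- The measure `μ_{τ,Ω}(η) = ∫_{ν⁻¹(η)} |∇u|² dH^{n-1}` (as a set function on Borel sets
`η ⊆ S^{n-1}`), where `ν` is the Gauss map and `∇u` is taken in the sense of nontangential
limits. -/
def torsionMeasure (Ω : Set (Euc n)) (u : Euc n → ℝ) (η : Set (Euc n)) : ℝ≥0∞ :=
  ∫⁻ x in frontier Ω ∩ gaussMap (closure Ω) ⁻¹' η,
    ENNReal.ofReal (‖ntGradient Ω u x‖ ^ 2) ∂μH[(n : ℝ) - 1]

/-- The mixed torsional rigidity `τ₁(Ω, Ω') = ∫_{∂Ω} h_{Ω'}(ν(x)) ‖∇u(x)‖² dH^{n-1}(x)`. -/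
def mixedTorsion (Ω Ω' : Set (Euc n)) : ℝ :=
  if h : ∃ u, IsTorsionFunction Ω u then
    ∫ x in frontier Ω,
      suppFn (closure Ω') (gaussMap (closure Ω) x) * ‖ntGradient Ω h.choose x‖ ^ 2
        ∂μH[(n : ℝ) - 1]
  else 0

/-- The Alexandrov body `B[g] = {x : ⟨x, X⟩ ≤ g(X) for all X ∈ S^{n-1}}` of a positive
continuous function `g` on the sphere. -/
def alexandrovBody (g : Euc n → ℝ) : Set (Euc n) :=
  {x | ∀ X ∈ sphere (0 : Euc n) 1, ⟪x, X⟫ ≤ g X}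

section

/-- The second derivative of `f` at `x` in the direction `w`. -/
def hess {E : Type*} [NormedAddCommGroup E] [NormedSpace ℝ E] (f : E → ℝ) (x w : E) : ℝ :=
  fderiv ℝ (fderiv ℝ f) x w w

/-- The standard basis vectors of `Euc n`. -/
abbrev stdv (i : Fin n) : Euc n := EuclideanSpace.single i (1 : ℝ)

lemma lapl_eq_sum_hess (u : Euc n → ℝ) (x : Euc n) : lapl u x = ∑ i, hess u x (stdv i) := by
  simp [lapl, hess, iteratedFDeriv_two_apply]

section Hess

variable {E : Type*} [NormedAddCommGroup E] [NormedSpace ℝ E] {f g : E → ℝ} {x w : E}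

lemma hasFDerivAt_fderiv_apply (hf : ContDiffAt ℝ 2 f x) (w : E) :
    HasFDerivAt (fun z => fderiv ℝ f z w) ((fderiv ℝ (fderiv ℝ f) x).flip w) x := by
  have h1 : DifferentiableAt ℝ (fderiv ℝ f) x :=
    (hf.fderiv_right (m := 1) (by norm_num)).differentiableAt (by norm_num)
  exact (ContinuousLinearMap.apply ℝ ℝ w).hasFDerivAt.comp x h1.hasFDerivAt

lemma hess_eq (hf : ContDiffAt ℝ 2 f x) (w : E) :
    hess f x w = fderiv ℝ (fun z => fderiv ℝ f z w) x w := by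
  rw [(hasFDerivAt_fderiv_apply hf w).fderiv]; rfl

lemma eventually_differentiableAt (hf : ContDiffAt ℝ 2 f x) :
    ∀ᶠ z in 𝓝 x, DifferentiableAt ℝ f z :=
  (hf.eventually (by simp)).mono fun _ h => h.differentiableAt (by norm_num)

lemma hess_congr (h : f =ᶠ[𝓝 x] g) : hess f x w = hess g x w := by
  unfold hess; rw [h.fderiv.fderiv_eq]

lemma hess_add (hf : ContDiffAt ℝ 2 f x) (hg : ContDiffAt ℝ 2 g x) :
    hess (fun z => f z + g z) x w = hess f x w + hess g x w := by
  rw [hess_eq (hf.add hg), hess_eq hf, hess_eq hg]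
  have : (fun z => fderiv ℝ (fun z => f z + g z) z w) =ᶠ[𝓝 x]
      (fun z => fderiv ℝ f z w) + fun z => fderiv ℝ g z w := by
    filter_upwards [eventually_differentiableAt hf, eventually_differentiableAt hg] with z h1 h2
    simp [fderiv_fun_add h1 h2]
  rw [this.fderiv_eq, fderiv_add (hasFDerivAt_fderiv_apply hf w).differentiableAt
    (hasFDerivAt_fderiv_apply hg w).differentiableAt]
  rfl

lemma hess_mul (hf : ContDiffAt ℝ 2 f x) (hg : ContDiffAt ℝ 2 g x) :
    hess (fun z => f z * g z) x w =
      hess f x w * g x + 2 * (fderiv ℝ f x w * fderiv ℝ g x w) + f x * hess g x w := by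
  rw [hess_eq (hf.mul hg), hess_eq hf, hess_eq hg]
  have : (fun z => fderiv ℝ (fun z => f z * g z) z w) =ᶠ[𝓝 x]
      fun z => f z * fderiv ℝ g z w + g z * fderiv ℝ f z w := by
    filter_upwards [eventually_differentiableAt hf, eventually_differentiableAt hg] with z h1 h2
    simp [fderiv_fun_mul h1 h2]
  have d1 := (hf.differentiableAt (by norm_num)).hasFDerivAt
  have d2 := (hg.differentiableAt (by norm_num)).hasFDerivAt
  have d3 := (hasFDerivAt_fderiv_apply hf w)
  have d4 := (hasFDerivAt_fderiv_apply hg w)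
  rw [this.fderiv_eq, ((d1.fun_mul d4).fun_add (d2.fun_mul d3)).fderiv, d3.fderiv, d4.fderiv]
  simp
  ring

lemma hess_const (c : ℝ) : hess (fun _ : E => c) x w = 0 := by
  simp [hess]

lemma hess_clm (l : E →L[ℝ] ℝ) : hess (fun z => l z) x w = 0 := by
  have : fderiv ℝ (fun z => l z) = fun _ => l := by ext1 z; exact l.fderiv
  simp [hess, this]

lemma hess_const_mul (c : ℝ) (hf : ContDiffAt ℝ 2 f x) :
    hess (fun z => c * f z) x w = c * hess f x w := by
  rw [hess_mul contDiffAt_const hf, hess_const]; simp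

lemma hess_neg : hess (fun z => - f z) x w = - hess f x w := by
  have : fderiv ℝ (fun z => - f z) = fun z => - fderiv ℝ f z := by ext1 z; exact fderiv_fun_neg
  simp [hess, this]

lemma hess_sub (hf : ContDiffAt ℝ 2 f x) (hg : ContDiffAt ℝ 2 g x) :
    hess (fun z => f z - g z) x w = hess f x w - hess g x w := by
  simp_rw [sub_eq_add_neg]
  rw [hess_add hf hg.neg, hess_neg]

lemma hess_sum {ι : Type*} (s : Finset ι) {F : ι → E → ℝ} (hF : ∀ i ∈ s, ContDiffAt ℝ 2 (F i) x) :
    hess (fun z => ∑ i ∈ s, F i z) x w = ∑ i ∈ s, hess (F i) x w := by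
  induction s using Finset.induction_on with
  | empty => simp [hess_const]
  | insert a s ha ih =>
    simp_rw [Finset.sum_insert ha]
    rw [hess_add (hF a (by simp)) (ContDiffAt.sum fun i hi => hF i (by simp [hi])), ih]
    intro i hi; exact hF i (by simp [hi])

lemma hess_comp_affine (b : ℝ) (p : E) (x : E) (hf : ContDiffAt ℝ 2 f (p + b • x)) :
    hess (fun z => f (p + b • z)) x w = b ^ 2 * hess f (p + b • x) w := by
  have ha : ∀ z, HasFDerivAt (fun z : E => p + b • z) (b • ContinuousLinearMap.id ℝ E) z := by
    intro z; exact ((hasFDerivAt_id z).const_smul b).const_add p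
  have hc : ContDiffAt ℝ 2 (fun z : E => p + b • z) x := by fun_prop
  have hF : ContDiffAt ℝ 2 (fun z => f (p + b • z)) x := ContDiffAt.comp x hf hc
  rw [hess_eq hF]
  have : (fun z => fderiv ℝ (fun z => f (p + b • z)) z w) =ᶠ[𝓝 x]
      fun z => b * fderiv ℝ f (p + b • z) w := by
    have := hc.continuousAt.eventually (eventually_differentiableAt hf)
    filter_upwards [this] with z h1
    have h3 : HasFDerivAt (fun z => f (p + b • z)) _ z := h1.hasFDerivAt.comp z (ha z)
    rw [h3.fderiv]
    simp
  have h2 : HasFDerivAt (fun z => fderiv ℝ f (p + b • z) w) _ x :=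
    HasFDerivAt.comp (g := fun z => fderiv ℝ f z w) x (hasFDerivAt_fderiv_apply hf w) (ha x)
  rw [this.fderiv_eq, (h2.const_mul b).fderiv]
  simp [hess]; ring

lemma fderiv_comp_affine (b : ℝ) (p : E) (x : E) (hf : DifferentiableAt ℝ f (p + b • x)) :
    fderiv ℝ (fun z => f (p + b • z)) x w = b * fderiv ℝ f (p + b • x) w := by
  have ha : HasFDerivAt (fun z : E => p + b • z) (b • ContinuousLinearMap.id ℝ E) x :=
    ((hasFDerivAt_id x).const_smul b).const_add p
  have h3 : HasFDerivAt (fun z => f (p + b • z)) _ x := hf.hasFDerivAt.comp x ha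
  rw [h3.fderiv]
  simp

lemma hess_comp {θ : ℝ → ℝ} (hθ : ContDiff ℝ 2 θ) (hf : ContDiffAt ℝ 2 f x) :
    hess (fun z => θ (f z)) x w =
      deriv (deriv θ) (f x) * (fderiv ℝ f x w) ^ 2 + deriv θ (f x) * hess f x w := by
  have hF : ContDiffAt ℝ 2 (fun z => θ (f z)) x := ContDiffAt.comp x hθ.contDiffAt hf
  rw [hess_eq hF, hess_eq hf]
  have h1 : Differentiable ℝ θ := hθ.differentiable (by norm_num)
  have h2 : Differentiable ℝ (deriv θ) :=
    (ContDiff.differentiable_deriv_two hθ)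
  have : (fun z => fderiv ℝ (fun z => θ (f z)) z w) =ᶠ[𝓝 x]
      fun z => deriv θ (f z) * fderiv ℝ f z w := by
    filter_upwards [eventually_differentiableAt hf] with z hz
    have h3 : HasFDerivAt (fun z => θ (f z)) _ z :=
      (h1 (f z)).hasDerivAt.comp_hasFDerivAt z hz.hasFDerivAt
    rw [h3.fderiv]
    simp
  have d1 := (hf.differentiableAt (by norm_num)).hasFDerivAt
  have d2 : HasFDerivAt (fun z => deriv θ (f z)) _ x :=
    (h2 (f x)).hasDerivAt.comp_hasFDerivAt x d1
  rw [this.fderiv_eq, (d2.fun_mul (hasFDerivAt_fderiv_apply hf w)).fderiv,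
    (hasFDerivAt_fderiv_apply hf w).fderiv]
  simp
  ring

/-- Second differences converge to the second derivative. -/
lemma tendsto_second_difference (hf : ContDiffAt ℝ 2 f x) (w : E) :
    Tendsto (fun s : ℝ => (f (x + s • w) + f (x - s • w) - 2 * f x) / s ^ 2) (𝓝[≠] 0)
      (𝓝 (hess f x w)) := by
  have c1 : ContinuousAt (fun s : ℝ => x + s • w) 0 := by fun_prop
  have c2 : ContinuousAt (fun s : ℝ => x - s • w) 0 := by fun_prop
  have e1 : ∀ᶠ s in 𝓝[≠] (0:ℝ), DifferentiableAt ℝ f (x + s • w) := by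
    have := c1.eventually (p := fun z => DifferentiableAt ℝ f z)
      (by simpa using eventually_differentiableAt hf)
    exact this.filter_mono nhdsWithin_le_nhds
  have e2 : ∀ᶠ s in 𝓝[≠] (0:ℝ), DifferentiableAt ℝ f (x - s • w) := by
    have := c2.eventually (p := fun z => DifferentiableAt ℝ f z)
      (by simpa using eventually_differentiableAt hf)
    exact this.filter_mono nhdsWithin_le_nhds
  have d0 : HasDerivAt (fun s : ℝ => x + s • w) w 0 := by
    simpa using ((hasDerivAt_id (0:ℝ)).smul_const w).const_add x
  have d1 : HasDerivAt (fun s : ℝ => fderiv ℝ f (x + s • w) w) (hess f x w) 0 := by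
    have := hasFDerivAt_fderiv_apply hf w
    have := HasFDerivAt.comp_hasDerivAt_of_eq (l := fun z => fderiv ℝ f z w) (0:ℝ) this d0 (by simp)
    exact this
  refine HasDerivAt.lhopital_zero_nhdsNE (f' := fun s => fderiv ℝ f (x + s • w) w
    - fderiv ℝ f (x - s • w) w) (g' := fun s => 2 * s) ?_ ?_ ?_ ?_ ?_ ?_
  · filter_upwards [e1, e2] with s h1 h2
    have a1 : HasDerivAt (fun s : ℝ => x + s • w) w s := by
      simpa using ((hasDerivAt_id s).smul_const w).const_add x
    have a2 : HasDerivAt (fun s : ℝ => x - s • w) (-w) s := by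
      simpa using ((hasDerivAt_id s).smul_const w).const_sub x
    have b1 := h1.hasFDerivAt.comp_hasDerivAt s a1
    have b2 := h2.hasFDerivAt.comp_hasDerivAt s a2
    have := (b1.add b2).sub_const (2 * f x)
    refine this.congr_deriv ?_
    rw [map_neg]; ring
  · filter_upwards with s
    simpa using hasDerivAt_pow 2 s
  · filter_upwards [self_mem_nhdsWithin] with s hs
    simpa using hs
  · have : ContinuousAt (fun s : ℝ => f (x + s • w) + f (x - s • w) - 2 * f x) 0 := by
      have k1 : ContinuousAt (fun s : ℝ => f (x + s • w)) 0 :=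
        ContinuousAt.comp (g := f) (by simpa using hf.continuousAt) c1
      have k2 : ContinuousAt (fun s : ℝ => f (x - s • w)) 0 :=
        ContinuousAt.comp (g := f) (by simpa using hf.continuousAt) c2
      exact (k1.add k2).sub continuousAt_const
    have := this.tendsto.mono_left (nhdsWithin_le_nhds (s := {0}ᶜ))
    convert this using 2
    simp; ring
  · have : ContinuousAt (fun s : ℝ => s ^ 2) 0 := by fun_prop
    simpa using this.tendsto.mono_left (nhdsWithin_le_nhds (s := {0}ᶜ))
  · have t1 := d1.tendsto_slope_zero
    have t2 : Tendsto (fun s : ℝ => -s) (𝓝[≠] 0) (𝓝[≠] 0) := by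
      refine tendsto_nhdsWithin_iff.2 ⟨?_, ?_⟩
      · have : Continuous fun s : ℝ => -s := continuous_neg
        simpa using (this.tendsto 0).mono_left (nhdsWithin_le_nhds (s := {0}ᶜ))
      · filter_upwards [self_mem_nhdsWithin] with s hs
        simpa using hs
    have t3 := ((t1.add (t1.comp t2)).div_const 2)
    rw [add_self_div_two] at t3
    refine t3.congr' ?_
    filter_upwards [self_mem_nhdsWithin] with s hs
    have hs : s ≠ 0 := hs
    simp [← sub_eq_add_neg]
    field_simp
    ring

lemma hess_nonpos_of_isLocalMax (hf : ContDiffAt ℝ 2 f x) (hm : IsLocalMax f x) (w : E) :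
    hess f x w ≤ 0 := by
  refine le_of_tendsto (tendsto_second_difference hf w) ?_
  have c1 : Tendsto (fun s : ℝ => x + s • w) (𝓝[≠] 0) (𝓝 x) :=
    tendsto_nhdsWithin_of_tendsto_nhds (by
      have : Continuous fun s : ℝ => x + s • w := by fun_prop
      simpa using this.tendsto 0)
  have c2 : Tendsto (fun s : ℝ => x - s • w) (𝓝[≠] 0) (𝓝 x) :=
    tendsto_nhdsWithin_of_tendsto_nhds (by
      have : Continuous fun s : ℝ => x - s • w := by fun_prop
      simpa using this.tendsto 0)
  filter_upwards [c1.eventually hm, c2.eventually hm] with s h1 h2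
  apply div_nonpos_of_nonpos_of_nonneg _ (sq_nonneg s)
  linarith

end Hess

end

section

@[fun_prop]
lemma contDiffAt_inner_const {k : WithTop ℕ∞} {f : Euc n → Euc n} {x : Euc n}
    (hf : ContDiffAt ℝ k f x) (v : Euc n) : ContDiffAt ℝ k (fun z => ⟪f z, v⟫) x :=
  hf.inner ℝ contDiffAt_const

section LaplCalc

variable {f g : Euc n → ℝ} {x : Euc n}

lemma lapl_congr (h : f =ᶠ[𝓝 x] g) : lapl f x = lapl g x := by
  simp only [lapl_eq_sum_hess, hess_congr h]

lemma lapl_add (hf : ContDiffAt ℝ 2 f x) (hg : ContDiffAt ℝ 2 g x) :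
    lapl (fun z => f z + g z) x = lapl f x + lapl g x := by
  simp only [lapl_eq_sum_hess, hess_add hf hg, Finset.sum_add_distrib]

lemma lapl_sub (hf : ContDiffAt ℝ 2 f x) (hg : ContDiffAt ℝ 2 g x) :
    lapl (fun z => f z - g z) x = lapl f x - lapl g x := by
  simp only [lapl_eq_sum_hess, hess_sub hf hg, Finset.sum_sub_distrib]

lemma lapl_neg : lapl (fun z => - f z) x = - lapl f x := by
  simp only [lapl_eq_sum_hess, hess_neg, Finset.sum_neg_distrib]

lemma lapl_const (c : ℝ) : lapl (fun _ : Euc n => c) x = 0 := by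
  simp [lapl_eq_sum_hess, hess_const]

lemma lapl_clm (l : Euc n →L[ℝ] ℝ) : lapl (fun z => l z) x = 0 := by
  simp [lapl_eq_sum_hess, hess_clm]

lemma lapl_const_mul (c : ℝ) (hf : ContDiffAt ℝ 2 f x) :
    lapl (fun z => c * f z) x = c * lapl f x := by
  simp only [lapl_eq_sum_hess, hess_const_mul c hf, Finset.mul_sum]

lemma lapl_mul (hf : ContDiffAt ℝ 2 f x) (hg : ContDiffAt ℝ 2 g x) :
    lapl (fun z => f z * g z) x = lapl f x * g x
      + 2 * (∑ i, fderiv ℝ f x (stdv i) * fderiv ℝ g x (stdv i)) + f x * lapl g x := by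
  simp only [lapl_eq_sum_hess, hess_mul hf hg, Finset.sum_add_distrib, Finset.mul_sum,
    Finset.sum_mul]

lemma lapl_comp_affine (b : ℝ) (p : Euc n) (x : Euc n) (hf : ContDiffAt ℝ 2 f (p + b • x)) :
    lapl (fun z => f (p + b • z)) x = b ^ 2 * lapl f (p + b • x) := by
  simp only [lapl_eq_sum_hess, hess_comp_affine b p x hf, Finset.mul_sum]

lemma lapl_comp {θ : ℝ → ℝ} (hθ : ContDiff ℝ 2 θ) (hf : ContDiffAt ℝ 2 f x) :
    lapl (fun z => θ (f z)) x =
      deriv (deriv θ) (f x) * (∑ i, (fderiv ℝ f x (stdv i)) ^ 2) + deriv θ (f x) * lapl f x := by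
  simp only [lapl_eq_sum_hess, hess_comp hθ hf, Finset.sum_add_distrib, Finset.mul_sum]

lemma lapl_nonpos_of_isLocalMax (hf : ContDiffAt ℝ 2 f x) (hm : IsLocalMax f x) :
    lapl f x ≤ 0 := by
  rw [lapl_eq_sum_hess]
  exact Finset.sum_nonpos fun i _ => hess_nonpos_of_isLocalMax hf hm _

lemma sum_fderiv_sq (l : Euc n →L[ℝ] ℝ) : ∑ i, (l (stdv i)) ^ 2 = ‖l‖ ^ 2 := by
  obtain ⟨v, rfl⟩ := (InnerProductSpace.toDual ℝ (Euc n)).surjective l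
  simp [EuclideanSpace.norm_sq_eq, EuclideanSpace.inner_single_right]

lemma lapl_inner_sq (v c : Euc n) : lapl (fun z => ⟪z - c, v⟫ * ⟪z - c, v⟫) x = 2 * ‖v‖ ^ 2 := by
  have h0 : (fun z : Euc n => ⟪z - c, v⟫) = fun z => (innerSL ℝ v) z + (-⟪c, v⟫) := by
    ext z; rw [inner_sub_left, innerSL_apply_apply, real_inner_comm, sub_eq_add_neg]
  have hc : ContDiffAt ℝ 2 (fun z : Euc n => ⟪z - c, v⟫) x := by fun_prop
  have hl : lapl (fun z : Euc n => ⟪z - c, v⟫) x = 0 := by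
    rw [h0, lapl_add (by fun_prop) (by fun_prop), lapl_clm, lapl_const]; simp
  have hd : fderiv ℝ (fun z : Euc n => ⟪z - c, v⟫) x = innerSL ℝ v := by
    rw [h0, fderiv_add_const]; exact (innerSL ℝ v).fderiv
  rw [lapl_mul hc hc, hl, hd]
  have := sum_fderiv_sq (innerSL ℝ v)
  simp only [pow_two] at this
  rw [this]
  simp [pow_two]

lemma lapl_norm_sq (c : Euc n) : lapl (fun z => ‖z - c‖ ^ 2) x = 2 * n := by
  have : (fun z : Euc n => ‖z - c‖ ^ 2)
      = fun z => ∑ i, ⟪z - c, stdv i⟫ * ⟪z - c, stdv i⟫ := by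
    ext z; rw [EuclideanSpace.norm_sq_eq]; simp [EuclideanSpace.inner_single_right, pow_two]
  rw [this, lapl_eq_sum_hess]
  have h1 : ∀ j : Fin n, hess (fun z : Euc n => ∑ i, ⟪z - c, stdv i⟫ * ⟪z - c, stdv i⟫) x (stdv j)
      = ∑ i, hess (fun z : Euc n => ⟪z - c, stdv i⟫ * ⟪z - c, stdv i⟫) x (stdv j) := fun j =>
    hess_sum Finset.univ (F := fun i z => ⟪z - c, stdv i⟫ * ⟪z - c, stdv i⟫)
      (fun i _ => by fun_prop)
  rw [Finset.sum_congr rfl fun j _ => h1 j, Finset.sum_comm]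
  have : ∀ i : Fin n, ∑ j, hess (fun z => ⟪z - c, stdv i⟫ * ⟪z - c, stdv i⟫) x (stdv j) = 2 := by
    intro i; rw [← lapl_eq_sum_hess, lapl_inner_sq]; simp
  simp [this, mul_comm]

end LaplCalc

/-- The weak maximum principle. -/
lemma max_principle (hn : 0 < n) {D : Set (Euc n)} (hD : IsOpen D) (hb : IsBounded D)
    {w : Euc n → ℝ} (hc : ContinuousOn w (closure D)) (h2 : ∀ x ∈ D, ContDiffAt ℝ 2 w x)
    (hl : ∀ x ∈ D, 0 ≤ lapl w x) {M : ℝ} (hM : ∀ x ∈ frontier D, w x ≤ M) :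
    ∀ x ∈ closure D, w x ≤ M := by
  intro x hx
  have hK : IsCompact (closure D) := hb.isCompact_closure
  obtain ⟨R, hR⟩ := hb.closure.exists_norm_le
  have key : ∀ ε > 0, w x ≤ M + ε * R ^ 2 := by
    intro ε hε
    obtain ⟨y, hy, hmax⟩ := hK.exists_isMaxOn ⟨x, hx⟩
      (f := fun z => w z + ε * ‖z - 0‖ ^ 2) (by fun_prop)
    have h1 : w x + ε * ‖x - 0‖ ^ 2 ≤ w y + ε * ‖y - 0‖ ^ 2 := hmax hx
    have hyR : ‖y - 0‖ ^ 2 ≤ R ^ 2 := by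
      have := hR y hy
      simp only [sub_zero]; gcongr
    have h3 : 0 ≤ ε * ‖x - 0‖ ^ 2 := by positivity
    have h4 : ε * ‖y - 0‖ ^ 2 ≤ ε * R ^ 2 := by gcongr
    by_cases hyD : y ∈ D
    · exfalso
      have hloc : IsLocalMax (fun z => w z + ε * ‖z - 0‖ ^ 2) y :=
        hmax.isLocalMax (mem_of_superset (hD.mem_nhds hyD) subset_closure)
      have hn2 : ContDiffAt ℝ 2 (fun z : Euc n => ‖z - 0‖ ^ 2) y := by
        apply ContDiff.contDiffAt
        exact (contDiff_id.sub contDiff_const).norm_sq ℝ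
      have := lapl_nonpos_of_isLocalMax ((h2 y hyD).add (contDiffAt_const.mul hn2)) hloc
      rw [lapl_add (h2 y hyD) (contDiffAt_const.mul hn2), lapl_const_mul _ hn2, lapl_norm_sq] at this
      have h5 := hl y hyD
      have : 0 < ε * (2 * (n:ℝ)) := by positivity
      linarith
    · have := hM y (by rw [hD.frontier_eq]; exact ⟨hy, hyD⟩)
      linarith
  have : Tendsto (fun ε : ℝ => M + ε * R ^ 2) (𝓝[>] 0) (𝓝 M) := by
    have : Continuous fun ε : ℝ => M + ε * R ^ 2 := by fun_prop
    simpa using (this.tendsto 0).mono_left nhdsWithin_le_nhds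
  refine ge_of_tendsto this ?_
  filter_upwards [self_mem_nhdsWithin] with ε hε using key ε hε

/-- The comparison principle. -/
lemma comparison (hn : 0 < n) {D : Set (Euc n)} (hD : IsOpen D) (hb : IsBounded D)
    {w₁ w₂ : Euc n → ℝ} (hc₁ : ContinuousOn w₁ (closure D)) (hc₂ : ContinuousOn w₂ (closure D))
    (h₁ : ∀ x ∈ D, ContDiffAt ℝ 2 w₁ x) (h₂ : ∀ x ∈ D, ContDiffAt ℝ 2 w₂ x)
    (hl : ∀ x ∈ D, lapl w₂ x ≤ lapl w₁ x) (hM : ∀ x ∈ frontier D, w₁ x ≤ w₂ x) :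
    ∀ x ∈ closure D, w₁ x ≤ w₂ x := by
  intro x hx
  have := max_principle hn hD hb (w := fun z => w₁ z - w₂ z) (M := 0) (hc₁.sub hc₂)
    (fun x hx => (h₁ x hx).sub (h₂ x hx))
    (fun x hx => by rw [lapl_sub (h₁ x hx) (h₂ x hx)]; linarith [hl x hx])
    (fun x hx => by linarith [hM x hx]) x hx
  linarith

/-- The torsion function of a nonempty bounded open convex set, extended by zero. -/
structure Tor (Ω : Set (Euc n)) (u : Euc n → ℝ) : Prop where
  hn : 2 ≤ n
  isOpen : IsOpen Ω
  bdd : IsBounded Ω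
  convex : Convex ℝ Ω
  nonempty : Ω.Nonempty
  cont : Continuous u
  zero : ∀ x ∉ Ω, u x = 0
  smooth : ∀ x ∈ Ω, ContDiffAt ℝ 2 u x
  smooth' : ContDiffOn ℝ (⊤ : ℕ∞) u Ω
  lapl_eq : ∀ x ∈ Ω, lapl u x = -2

/-- A point outside an open convex set is separated from it by a unit normal. -/
lemma exists_unit_normal {Ω : Set (Euc n)} (ho : IsOpen Ω) (hc : Convex ℝ Ω) (hne : Ω.Nonempty)
    {z : Euc n} (hz : z ∉ Ω) : ∃ ν : Euc n, ‖ν‖ = 1 ∧ ∀ y ∈ Ω, ⟪y, ν⟫ < ⟪z, ν⟫ := by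
  obtain ⟨l, hl⟩ := geometric_hahn_banach_open_point hc ho hz
  obtain ⟨v, rfl⟩ := (InnerProductSpace.toDual ℝ (Euc n)).surjective l
  simp only [InnerProductSpace.toDual_apply_apply] at hl
  obtain ⟨y, hy⟩ := hne
  have hv : v ≠ 0 := by
    rintro rfl
    simpa using hl y hy
  have hv' : 0 < ‖v‖ := norm_pos_iff.2 hv
  refine ⟨‖v‖⁻¹ • v, by simp [norm_smul, hv'.ne'], fun y hy => ?_⟩
  simp only [inner_smul_right]
  have := hl y hy
  rw [real_inner_comm, real_inner_comm v z]
  gcongr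

lemma inner_le_of_mem_closure {Ω : Set (Euc n)} {ν : Euc n} {c : ℝ} (h : ∀ y ∈ Ω, ⟪y, ν⟫ ≤ c) :
    ∀ y ∈ closure Ω, ⟪y, ν⟫ ≤ c := by
  have : IsClosed {y : Euc n | ⟪y, ν⟫ ≤ c} := isClosed_le (by fun_prop) continuous_const
  exact fun y hy => closure_minimal (show Ω ⊆ {y : Euc n | ⟪y, ν⟫ ≤ c} from h) this hy

namespace Tor

variable {Ω : Set (Euc n)} {u : Euc n → ℝ}

lemma pos_n (h : Tor Ω u) : 0 < n := by have := h.hn; omega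

lemma frontier_not_mem (h : Tor Ω u) {x : Euc n} (hx : x ∈ frontier Ω) : x ∉ Ω := by
  rw [h.isOpen.frontier_eq] at hx; exact hx.2

lemma ball_lower (h : Tor Ω u) {x₀ : Euc n} {r : ℝ} (hr : 0 < r) (hB : ball x₀ r ⊆ Ω)
    (hnn : ∀ x, 0 ≤ u x) : ∀ x ∈ ball x₀ r, (r ^ 2 - ‖x - x₀‖ ^ 2) / n ≤ u x := by
  have hn := h.pos_n
  have hcd : ∀ x, ContDiffAt ℝ 2 (fun z : Euc n => ‖z - x₀‖ ^ 2) x := fun x => by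
    apply ContDiff.contDiffAt
    exact (contDiff_id.sub contDiff_const).norm_sq ℝ
  have e : (fun z : Euc n => (r ^ 2 - ‖z - x₀‖ ^ 2) / n)
      = fun z => r ^ 2 / n + (-(1 / n)) * ‖z - x₀‖ ^ 2 := by ext z; ring
  intro x hx
  refine comparison hn isOpen_ball isBounded_ball (w₁ := fun z => (r ^ 2 - ‖z - x₀‖ ^ 2) / n)
    (by fun_prop) h.cont.continuousOn ?_ (fun x hx => h.smooth x (hB hx)) ?_ ?_ x
    (subset_closure hx)
  · intro x _; rw [e]; exact contDiffAt_const.add (contDiffAt_const.mul (hcd x))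
  · intro x hx
    rw [h.lapl_eq x (hB hx), e, lapl_add contDiffAt_const (contDiffAt_const.mul (hcd x)),
      lapl_const, lapl_const_mul _ (hcd x), lapl_norm_sq]
    have : (n:ℝ) ≠ 0 := by positivity
    field_simp; norm_num
  · intro x hx
    rw [frontier_ball _ hr.ne', mem_sphere, dist_eq_norm] at hx
    simpa [hx] using hnn x

lemma nonneg (h : Tor Ω u) (x : Euc n) : 0 ≤ u x := by
  by_cases hx : x ∈ Ω
  · refine comparison h.pos_n h.isOpen h.bdd (w₁ := fun _ => 0) continuousOn_const
      h.cont.continuousOn (fun _ _ => contDiffAt_const) h.smooth ?_ ?_ x (subset_closure hx)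
    · intro x hx; rw [h.lapl_eq x hx, lapl_const]; norm_num
    · intro x hx; rw [h.zero x (h.frontier_not_mem hx)]
  · rw [h.zero x hx]

lemma pos (h : Tor Ω u) {x : Euc n} (hx : x ∈ Ω) : 0 < u x := by
  obtain ⟨r, hr, hB⟩ := Metric.isOpen_iff.1 h.isOpen x hx
  have := h.ball_lower hr hB h.nonneg x (mem_ball_self hr)
  have hn : (0:ℝ) < n := by exact_mod_cast h.pos_n
  refine lt_of_lt_of_le ?_ this
  simp; positivity

/-- The diameter of `Ω`. -/
lemma exists_diam (h : Tor Ω u) : ∃ D : ℝ, 0 < D ∧ ∀ x ∈ closure Ω, ∀ y ∈ closure Ω, dist x y ≤ D := by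
  refine ⟨diam (closure Ω) + 1, by positivity, fun x hx y hy => ?_⟩
  have := dist_le_diam_of_mem h.bdd.closure hx hy
  linarith

lemma barrier (h : Tor Ω u) {D : ℝ} (hD : ∀ x ∈ closure Ω, ∀ y ∈ closure Ω, dist x y ≤ D)
    {z ν : Euc n} (hz : z ∈ closure Ω) (hν : ‖ν‖ = 1) (hs : ∀ y ∈ Ω, ⟪y, ν⟫ ≤ ⟪z, ν⟫)
    {x : Euc n} (hx : x ∈ closure Ω) : u x ≤ D * ⟪z - x, ν⟫ := by
  have hD0 : 0 ≤ D := le_trans dist_nonneg (hD z hz z hz)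
  have hs' := inner_le_of_mem_closure hs
  have e : (fun x : Euc n => -(⟪x - z, ν⟫ * ⟪x - z, ν⟫) + (innerSL ℝ (-D • ν)) x + D * ⟪z, ν⟫)
      = fun x => D * ⟪z - x, ν⟫ - ⟪z - x, ν⟫ * ⟪z - x, ν⟫ := by
    ext x; simp [inner_sub_left, real_inner_comm]; ring
  have c0 : ∀ x, ContDiffAt ℝ 2 (fun x : Euc n => ⟪x - z, ν⟫ * ⟪x - z, ν⟫) x := fun x => by
    fun_prop
  have key : u x ≤ D * ⟪z - x, ν⟫ - ⟪z - x, ν⟫ * ⟪z - x, ν⟫ := by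
    refine comparison h.pos_n h.isOpen h.bdd
      (w₂ := fun x => D * ⟪z - x, ν⟫ - ⟪z - x, ν⟫ * ⟪z - x, ν⟫) h.cont.continuousOn
      (by fun_prop) h.smooth (fun x _ => by fun_prop) ?_ ?_ x hx
    · intro x hx
      rw [h.lapl_eq x hx, ← e, lapl_add ((c0 x).neg.add (by fun_prop)) contDiffAt_const,
        lapl_add (c0 x).neg (by fun_prop), lapl_neg, lapl_inner_sq, lapl_clm, lapl_const, hν]
      norm_num
    · intro x hx
      rw [h.zero x (h.frontier_not_mem hx)]
      have hxc := frontier_subset_closure hx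
      have h1 := hs' x hxc
      have h2 : ⟪z - x, ν⟫ ≤ D := by
        calc ⟪z - x, ν⟫ ≤ ‖z - x‖ * ‖ν‖ := real_inner_le_norm _ _
          _ = dist z x := by rw [hν, mul_one, dist_eq_norm]
          _ ≤ D := hD z hz x hxc
      rw [inner_sub_left] at h2 ⊢
      nlinarith
  nlinarith [mul_self_nonneg ⟪z - x, ν⟫]

lemma le_dist (h : Tor Ω u) {D : ℝ} (hD : ∀ x ∈ closure Ω, ∀ y ∈ closure Ω, dist x y ≤ D)
    {x z : Euc n} (hz : z ∉ Ω) : u x ≤ D * dist x z := by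
  have hD0 : 0 ≤ D := by
    obtain ⟨p, hp⟩ := h.nonempty
    exact le_trans dist_nonneg (hD p (subset_closure hp) p (subset_closure hp))
  by_cases hx : x ∈ Ω
  · have hu : Ω ≠ univ := fun e => hz (e ▸ mem_univ z)
    obtain ⟨y, hy, hxy⟩ := exists_mem_frontier_infDist_compl_eq_dist hx hu
    obtain ⟨ν, hν, hs⟩ := exists_unit_normal h.isOpen h.convex h.nonempty (h.frontier_not_mem hy)
    have := h.barrier hD (frontier_subset_closure hy) hν (fun y hy => (hs y hy).le)
      (subset_closure hx)
    refine this.trans ?_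
    gcongr
    calc ⟪y - x, ν⟫ ≤ ‖y - x‖ * ‖ν‖ := real_inner_le_norm _ _
      _ = dist x y := by rw [hν, mul_one, dist_comm, dist_eq_norm]
      _ = infDist x Ωᶜ := hxy.symm
      _ ≤ dist x z := infDist_le_dist_of_mem hz
  · rw [h.zero x hx]; positivity

lemma sub_le (h : Tor Ω u) {D : ℝ} (hD : ∀ x ∈ closure Ω, ∀ y ∈ closure Ω, dist x y ≤ D)
    (x k : Euc n) : u (x + k) - u x ≤ D * ‖k‖ := by
  have hD0 : 0 ≤ D := by
    obtain ⟨p, hp⟩ := h.nonempty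
    exact le_trans dist_nonneg (hD p (subset_closure hp) p (subset_closure hp))
  have out : ∀ x, ¬ (x ∈ Ω ∧ x + k ∈ Ω) → u (x + k) - u x ≤ D * ‖k‖ := by
    intro x hx
    by_cases h1 : x ∈ Ω
    · have h2 : x + k ∉ Ω := fun h2 => hx ⟨h1, h2⟩
      rw [h.zero _ h2]
      have := h.nonneg x
      have : 0 ≤ D * ‖k‖ := by positivity
      linarith
    · have := h.le_dist hD (x := x + k) h1
      rw [h.zero _ h1]
      simpa [dist_eq_norm] using this
  by_cases hx : x ∈ Ω ∧ x + k ∈ Ω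
  swap
  · exact out x hx
  have ho : IsOpen (Ω ∩ (fun x => x + k) ⁻¹' Ω) :=
    h.isOpen.inter (h.isOpen.preimage (by fun_prop))
  have hcd : ∀ x ∈ Ω ∩ (fun x => x + k) ⁻¹' Ω, ContDiffAt ℝ 2 (fun x => u (k + (1:ℝ) • x)) x := by
    intro x hx
    have : ContDiffAt ℝ 2 u (k + (1:ℝ) • x) := by
      rw [one_smul, add_comm]; exact h.smooth _ hx.2
    exact ContDiffAt.comp x this (by fun_prop)
  have hcu := h.cont
  have := max_principle h.pos_n ho (h.bdd.subset inter_subset_left)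
    (w := fun x => u (k + (1:ℝ) • x) - u x) (M := D * ‖k‖)
    (by fun_prop) (fun x hx => (hcd x hx).sub (h.smooth x hx.1))
    (fun x hx => ?_) (fun x hx => ?_) x (subset_closure hx)
  · simpa [add_comm] using this
  · have h3 : k + (1:ℝ) • x ∈ Ω := by rw [one_smul, add_comm]; exact hx.2
    rw [lapl_sub (hcd x hx) (h.smooth x hx.1), lapl_comp_affine _ _ _ (h.smooth _ h3),
      h.lapl_eq _ h3, h.lapl_eq _ hx.1]
    norm_num
  · rw [ho.frontier_eq] at hx
    have := out x hx.2
    simpa [add_comm] using this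

lemma exists_lipschitz (h : Tor Ω u) : ∃ C : ℝ≥0, LipschitzWith C u := by
  obtain ⟨D, hD0, hD⟩ := h.exists_diam
  refine ⟨D.toNNReal, LipschitzWith.of_le_add_mul _ fun x y => ?_⟩
  have := h.sub_le hD y (x - y)
  simp only [add_sub_cancel] at this
  rw [Real.coe_toNNReal _ hD0.le, dist_eq_norm]
  linarith

end Tor

end

section

lemma contDiffAt_comp_affine {k : WithTop ℕ∞} {f : Euc n → ℝ} {p x : Euc n} {a : ℝ}
    (hf : ContDiffAt ℝ k f (p + a • x)) : ContDiffAt ℝ k (fun z => f (p + a • z)) x :=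
  ContDiffAt.comp x hf (by fun_prop)

namespace Tor

variable {Ω : Set (Euc n)} {u : Euc n → ℝ}

lemma sqrt_pos (h : Tor Ω u) {x : Euc n} (hx : x ∈ Ω) : 0 < √(u x) := Real.sqrt_pos.2 (h.pos hx)

lemma contDiffAt_sqrt (h : Tor Ω u) {x : Euc n} (hx : x ∈ Ω) :
    ContDiffAt ℝ 2 (fun z => √(u z)) x :=
  (h.smooth x hx).sqrt (h.pos hx).ne'

lemma sqrt_zero (h : Tor Ω u) {x : Euc n} (hx : x ∉ Ω) : √(u x) = 0 := by
  rw [h.zero x hx, Real.sqrt_zero]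

lemma sqrt_lapl (h : Tor Ω u) {x : Euc n} (hx : x ∈ Ω) :
    √(u x) * lapl (fun z => √(u z)) x = - (1 + ‖fderiv ℝ (fun z => √(u z)) x‖ ^ 2) := by
  have hc := h.contDiffAt_sqrt hx
  have h1 := lapl_mul hc hc
  have h2 : (fun z => √(u z) * √(u z)) = u := by
    ext z; exact Real.mul_self_sqrt (h.nonneg z)
  rw [h2, h.lapl_eq x hx] at h1
  simp only [← pow_two] at h1
  rw [sum_fderiv_sq] at h1
  linarith

lemma combo_mem (h : Tor Ω u) {x y : Euc n} {t : ℝ} (ht : 0 < t) (ht1 : t < 1)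
    (hx : x ∈ closure Ω) (hy : y ∈ Ω) : (1 - t) • x + t • y ∈ Ω := by
  have := h.convex.combo_closure_interior_mem_interior (x := x) (y := y) hx
    (by rwa [h.isOpen.interior_eq]) (a := 1 - t) (b := t) (by linarith) ht (by ring)
  rwa [h.isOpen.interior_eq] at this

lemma sq_mul_le (h : Tor Ω u) {x y : Euc n} {t : ℝ} (ht : 0 < t) (ht1 : t < 1)
    (hx : x ∈ closure Ω) (hy : y ∈ closure Ω) : t ^ 2 * u y ≤ u ((1 - t) • x + t • y) := by
  have hcd : ∀ z ∈ Ω, ContDiffAt ℝ 2 (fun z => u ((1 - t) • x + t • z)) z := fun z hz =>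
    ContDiffAt.comp z (h.smooth _ (h.combo_mem ht ht1 hx hz)) (by fun_prop)
  have hcu := h.cont
  refine comparison h.pos_n h.isOpen h.bdd (w₁ := fun z => t ^ 2 * u z)
    (w₂ := fun z => u ((1 - t) • x + t • z)) (by fun_prop) (by fun_prop)
    (fun z hz => contDiffAt_const.mul (h.smooth z hz)) hcd ?_ ?_ y hy
  · intro z hz
    rw [lapl_comp_affine _ _ _ (h.smooth _ (h.combo_mem ht ht1 hx hz)),
      lapl_const_mul _ (h.smooth z hz), h.lapl_eq z hz, h.lapl_eq _ (h.combo_mem ht ht1 hx hz)]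
  · intro z hz
    rw [h.zero z (h.frontier_not_mem hz)]
    simpa using h.nonneg _

lemma sqrt_concave_bdry (h : Tor Ω u) {x y : Euc n} {t : ℝ} (ht : 0 < t) (ht1 : t < 1)
    (hx : x ∈ closure Ω) (hy : y ∈ closure Ω) :
    t * √(u y) ≤ √(u ((1 - t) • x + t • y)) := by
  have := Real.sqrt_le_sqrt (h.sq_mul_le ht ht1 hx hy)
  rwa [Real.sqrt_mul (by positivity), Real.sqrt_sq ht.le] at this

/-- The interior step of the concavity of `√u`. -/
lemma sqrt_interior_max (h : Tor Ω u) {x y : Euc n} {t : ℝ} (ht : 0 < t) (ht1 : t < 1)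
    (hx : x ∈ Ω) (hy : y ∈ Ω)
    (hmax : ∀ x' ∈ Ω, ∀ y' ∈ Ω, (1 - t) * √(u x') + t * √(u y') - √(u ((1 - t) • x' + t • y'))
      ≤ (1 - t) * √(u x) + t * √(u y) - √(u ((1 - t) • x + t • y))) :
    (1 - t) * √(u x) + t * √(u y) ≤ √(u ((1 - t) • x + t • y)) := by
  set f : Euc n → ℝ := fun z => √(u z) with hf
  set P := (1 - t) • x + t • y with hP
  have hPm : P ∈ Ω := h.combo_mem ht ht1 (subset_closure hx) hy
  have cx := h.contDiffAt_sqrt hx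
  have cy := h.contDiffAt_sqrt hy
  have cP := h.contDiffAt_sqrt hPm
  have cx' : ∀ a : ℝ, ContDiffAt ℝ 2 f (x + a • 0) := by simpa using cx
  have cy' : ∀ a : ℝ, ContDiffAt ℝ 2 f (y + a • 0) := by simpa using cy
  have cP' : ∀ a : ℝ, ContDiffAt ℝ 2 f (P + a • 0) := by simpa using cP
  have ch : ∀ (p : Euc n) (a : ℝ), ContDiffAt ℝ 2 f (p + a • 0) →
      ContDiffAt ℝ 2 (fun z => f (p + a • z)) 0 := fun p a hp =>
    contDiffAt_comp_affine hp
  have loc : ∀ a b : ℝ, (1 - t) * a + t * b = 1 → IsLocalMax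
      (fun z => ((1 - t) * f (x + a • z) + t * f (y + b • z)) - f (P + (1:ℝ) • z)) 0 := by
    intro a b hab
    have e1 : ∀ᶠ z in 𝓝 (0 : Euc n), x + a • z ∈ Ω := by
      have : Continuous fun z : Euc n => x + a • z := by fun_prop
      exact this.continuousAt.eventually (by simpa using h.isOpen.mem_nhds hx)
    have e2 : ∀ᶠ z in 𝓝 (0 : Euc n), y + b • z ∈ Ω := by
      have : Continuous fun z : Euc n => y + b • z := by fun_prop
      exact this.continuousAt.eventually (by simpa using h.isOpen.mem_nhds hy)
    filter_upwards [e1, e2] with z h1 h2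
    have := hmax _ h1 _ h2
    have e3 : (1 - t) • (x + a • z) + t • (y + b • z) = P + (1:ℝ) • z := by
      rw [show P + (1:ℝ) • z = P + ((1 - t) * a + t * b) • z by rw [hab], hP]; module
    rw [e3] at this
    simpa [hf] using this
  have hC : ∀ a b : ℝ, ContDiffAt ℝ 2 (fun z => (1 - t) * f (x + a • z) + t * f (y + b • z)) 0 :=
    fun a b => (contDiffAt_const.mul (ch x a (cx' a))).add
      (contDiffAt_const.mul (ch y b (cy' b)))
  have hgrad : ∀ a b : ℝ, (1 - t) * a + t * b = 1 → ∀ w,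
      (1 - t) * (a * fderiv ℝ f x w) + t * (b * fderiv ℝ f y w) = fderiv ℝ f P w := by
    intro a b hab w
    have h0 := (loc a b hab).fderiv_eq_zero
    have dx := (cx' a).differentiableAt (by norm_num)
    have dy := (cy' b).differentiableAt (by norm_num)
    have dP := (cP' 1).differentiableAt (by norm_num)
    have dx' := (ch x a (cx' a)).differentiableAt (by norm_num)
    have dy' := (ch y b (cy' b)).differentiableAt (by norm_num)
    have dP' := (ch P 1 (cP' 1)).differentiableAt (by norm_num)
    rw [fderiv_fun_sub ((dx'.const_mul _).fun_add (dy'.const_mul _)) dP',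
      fderiv_fun_add (dx'.const_mul _) (dy'.const_mul _), fderiv_const_mul dx',
      fderiv_const_mul dy'] at h0
    have := congrArg (fun l => l w) h0
    simp only [_root_.sub_apply, _root_.add_apply,
      _root_.smul_apply, fderiv_comp_affine _ _ _ dx, fderiv_comp_affine _ _ _ dy,
      fderiv_comp_affine _ _ _ dP, smul_eq_mul, smul_zero, add_zero, one_mul,
      _root_.zero_apply] at this
    linarith
  have ht1' : 1 - t ≠ 0 := by linarith
  have gx : fderiv ℝ f x = fderiv ℝ f P := by
    ext w
    have := hgrad (1 / (1 - t)) 0 (by field_simp; ring) w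
    rw [← this]; field_simp; ring
  have gy : fderiv ℝ f y = fderiv ℝ f P := by
    ext w
    have := hgrad 0 (1 / t) (by field_simp; ring) w
    rw [← this]; field_simp; ring
  have sx := h.sqrt_lapl hx
  have sy := h.sqrt_lapl hy
  have sP := h.sqrt_lapl hPm
  have px := h.sqrt_pos hx
  have py := h.sqrt_pos hy
  have pP := h.sqrt_pos hPm
  change f x * lapl f x = -(1 + ‖fderiv ℝ f x‖ ^ 2) at sx
  change f y * lapl f y = -(1 + ‖fderiv ℝ f y‖ ^ 2) at sy
  change f P * lapl f P = -(1 + ‖fderiv ℝ f P‖ ^ 2) at sP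
  rw [gx] at sx
  rw [gy] at sy
  set G := 1 + ‖fderiv ℝ f P‖ ^ 2 with hG
  have hGp : 0 < G := by positivity
  change 0 < f x at px
  change 0 < f y at py
  change 0 < f P at pP
  change (1 - t) * f x + t * f y ≤ f P
  set m := (1 - t) * f x + t * f y with hm
  have hmp : 0 < m := by
    have : 0 < (1 - t) * f x := mul_pos (by linarith) px
    positivity
  have hab : (1 - t) * (f x / m) + t * (f y / m) = 1 := by
    field_simp; rw [hm]
  have hl := lapl_nonpos_of_isLocalMax ((hC _ _).sub (ch P 1 (cP' 1))) (loc _ _ hab)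
  rw [lapl_sub (hC _ _) (ch P 1 (cP' 1)), lapl_add (contDiffAt_const.mul (ch x _ (cx' _)))
      (contDiffAt_const.mul (ch y _ (cy' _))), lapl_const_mul _ (ch x _ (cx' _)),
      lapl_const_mul _ (ch y _ (cy' _)), lapl_comp_affine _ _ _ (cx' _),
      lapl_comp_affine _ _ _ (cy' _), lapl_comp_affine _ _ _ (cP' _)] at hl
  simp only [smul_zero, add_zero] at hl
  have lx : lapl f x = - G / f x := by field_simp; linarith
  have ly : lapl f y = - G / f y := by field_simp; linarith
  have lP : lapl f P = - G / f P := by field_simp; linarith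
  rw [lx, ly, lP] at hl
  have e : (1 - t) * ((f x / m) ^ 2 * (-G / f x)) + t * ((f y / m) ^ 2 * (-G / f y))
      = - G / m := by
    have : (1 - t) * ((f x / m) ^ 2 * (-G / f x)) + t * ((f y / m) ^ 2 * (-G / f y))
      = - G * ((1 - t) * f x + t * f y) / m ^ 2 := by field_simp; ring
    rw [this, ← hm, pow_two]; field_simp
  rw [e] at hl
  have h5 : G / f P ≤ G / m := by
    have e1 : - G / m = - (G / m) := by ring
    have e2 : 1 ^ 2 * (- G / f P) = - (G / f P) := by ring
    rw [e1, e2] at hl; linarith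
  exact (div_le_div_iff_of_pos_left hGp pP hmp).1 h5

/-- The square root of the torsion function is concave. -/
lemma sqrt_concave (h : Tor Ω u) {x y : Euc n} {t : ℝ} (ht : 0 < t) (ht1 : t < 1)
    (hx : x ∈ closure Ω) (hy : y ∈ closure Ω) :
    (1 - t) * √(u x) + t * √(u y) ≤ √(u ((1 - t) • x + t • y)) := by
  have hK : IsCompact (closure Ω ×ˢ closure Ω) := h.bdd.isCompact_closure.prod h.bdd.isCompact_closure
  have hcu := h.cont
  obtain ⟨⟨x₀, y₀⟩, hp, hmax⟩ := hK.exists_isMaxOn ⟨(x, y), hx, hy⟩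
    (f := fun p : Euc n × Euc n => (1 - t) * √(u p.1) + t * √(u p.2)
      - √(u ((1 - t) • p.1 + t • p.2))) (by fun_prop)
  have hmax' : ∀ x' ∈ closure Ω, ∀ y' ∈ closure Ω,
      (1 - t) * √(u x') + t * √(u y') - √(u ((1 - t) • x' + t • y'))
      ≤ (1 - t) * √(u x₀) + t * √(u y₀) - √(u ((1 - t) • x₀ + t • y₀)) :=
    fun x' hx' y' hy' => hmax (show (x', y') ∈ _ from ⟨hx', hy'⟩)
  suffices H : (1 - t) * √(u x₀) + t * √(u y₀) ≤ √(u ((1 - t) • x₀ + t • y₀)) by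
    have := hmax' x hx y hy
    linarith
  by_cases h1 : x₀ ∈ Ω
  · by_cases h2 : y₀ ∈ Ω
    · exact h.sqrt_interior_max ht ht1 h1 h2 fun x' hx' y' hy' =>
        hmax' x' (subset_closure hx') y' (subset_closure hy')
    · have := h.sqrt_concave_bdry (t := 1 - t) (x := y₀) (y := x₀) (by linarith) (by linarith)
        hp.2 hp.1
      rw [h.sqrt_zero h2]
      rw [sub_sub_cancel, add_comm (t • y₀)] at this
      linarith
  · have := h.sqrt_concave_bdry ht ht1 hp.1 hp.2
    rw [h.sqrt_zero h1]
    linarith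

lemma concaveOn_sqrt (h : Tor Ω u) : ConcaveOn ℝ (closure Ω) fun x => √(u x) := by
  refine ⟨h.convex.closure, fun x hx y hy a b ha hb hab => ?_⟩
  rcases ha.eq_or_lt with rfl | ha
  · have : b = 1 := by linarith
    simp [this]
  rcases hb.eq_or_lt with rfl | hb
  · have : a = 1 := by linarith
    simp [this]
  obtain rfl : a = 1 - b := by linarith
  simpa using h.sqrt_concave hb (by linarith) hx hy

end Tor

end

section

/-- A smooth nondecreasing cutoff, `0` for `t ≤ ε` and `1` for `t ≥ 2 * ε`. -/
def cutoff (ε t : ℝ) : ℝ := Real.smoothTransition (t / ε - 1)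

/-- The primitive of the cutoff. -/
def trunc (ε t : ℝ) : ℝ := ∫ s in (0:ℝ)..t, cutoff ε s

section Cutoff

variable {ε : ℝ}

lemma cutoff_contDiff (ε : ℝ) {k : ℕ∞} : ContDiff ℝ k (cutoff ε) :=
  Real.smoothTransition.contDiff.comp (by fun_prop)

lemma cutoff_nonneg (ε t : ℝ) : 0 ≤ cutoff ε t := Real.smoothTransition.nonneg _

lemma cutoff_le_one (ε t : ℝ) : cutoff ε t ≤ 1 := Real.smoothTransition.le_one _

lemma cutoff_monotone (hε : 0 < ε) : Monotone (cutoff ε) := fun s t hst =>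
  Real.smoothTransition.monotone (by gcongr)

lemma cutoff_of_le (hε : 0 < ε) {t : ℝ} (ht : t ≤ ε) : cutoff ε t = 0 :=
  Real.smoothTransition.zero_of_nonpos (by rw [sub_nonpos, div_le_one hε]; exact ht)

lemma cutoff_of_ge (hε : 0 < ε) {t : ℝ} (ht : 2 * ε ≤ t) : cutoff ε t = 1 :=
  Real.smoothTransition.one_of_one_le (by
    have : 2 ≤ t / ε := by rw [le_div_iff₀ hε]; exact ht
    linarith)

lemma trunc_hasDerivAt (ε t : ℝ) : HasDerivAt (trunc ε) (cutoff ε t) t := by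
  have hc : Continuous (cutoff ε) := (cutoff_contDiff ε (k := 0)).continuous
  exact intervalIntegral.integral_hasDerivAt_right (hc.intervalIntegrable _ _)
    hc.stronglyMeasurable.stronglyMeasurableAtFilter hc.continuousAt

lemma deriv_trunc (ε : ℝ) : deriv (trunc ε) = cutoff ε :=
  funext fun t => (trunc_hasDerivAt ε t).deriv

lemma trunc_contDiff (ε : ℝ) : ContDiff ℝ 2 (trunc ε) := by
  rw [show (2 : WithTop ℕ∞) = 1 + 1 by norm_num, contDiff_succ_iff_deriv]
  refine ⟨fun t => (trunc_hasDerivAt ε t).differentiableAt, by simp, ?_⟩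
  rw [deriv_trunc]; exact cutoff_contDiff ε (k := 1)

lemma trunc_zero (ε : ℝ) : trunc ε 0 = 0 := by simp [trunc]

lemma trunc_of_le (hε : 0 < ε) {t : ℝ} (ht : t ≤ ε) : trunc ε t = 0 := by
  have : ∀ s ∈ uIcc 0 t, cutoff ε s = 0 := fun s hs =>
    cutoff_of_le hε (hs.2.trans (max_le hε.le ht))
  rw [trunc, intervalIntegral.integral_congr this]; simp

lemma trunc_nonneg (ε : ℝ) {t : ℝ} (ht : 0 ≤ t) : 0 ≤ trunc ε t :=
  intervalIntegral.integral_nonneg ht fun s _ => cutoff_nonneg ε s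

lemma id_sub_trunc_monotone (ε : ℝ) : Monotone fun t => t - trunc ε t := by
  have hd : ∀ t, HasDerivAt (fun t => t - trunc ε t) (1 - cutoff ε t) t := fun t =>
    (hasDerivAt_id t).sub (trunc_hasDerivAt ε t)
  refine monotone_of_deriv_nonneg (fun t => (hd t).differentiableAt) fun t => ?_
  rw [(hd t).deriv]; linarith [cutoff_le_one ε t]

lemma trunc_le (ε : ℝ) {t : ℝ} (ht : 0 ≤ t) : trunc ε t ≤ t := by
  have := id_sub_trunc_monotone ε ht
  simp only [trunc_zero] at this; linarith

lemma le_trunc_add (hε : 0 < ε) (t : ℝ) : t ≤ trunc ε t + 2 * ε := by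
  have h0 := trunc_nonneg ε (t := 2 * ε) (by linarith)
  rcases le_total t (2 * ε) with h | h
  · have := id_sub_trunc_monotone ε h
    simp only at this; linarith
  · have hc : Continuous (cutoff ε) := (cutoff_contDiff ε (k := 0)).continuous
    have e : ∫ s in (2 * ε)..t, cutoff ε s = t - 2 * ε := by
      have : ∀ s ∈ uIcc (2 * ε) t, cutoff ε s = 1 := fun s hs =>
        cutoff_of_ge hε (by rw [uIcc_of_le h] at hs; exact hs.1)
      rw [intervalIntegral.integral_congr this]; simp
    have : trunc ε t = trunc ε (2 * ε) + (t - 2 * ε) := by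
      rw [trunc, trunc, ← e, intervalIntegral.integral_add_adjacent_intervals] <;>
      exact hc.intervalIntegrable _ _
    linarith

end Cutoff

section Green

variable {f g : Euc n → ℝ}

lemma continuous_fderiv_apply_of_contDiff (hf : ContDiff ℝ 2 f) (w : Euc n) :
    ContDiff ℝ 1 (fun x => fderiv ℝ f x w) :=
  (hf.fderiv_right (m := 1) (by norm_num)).clm_apply contDiff_const

lemma lapl_eq_sum_fderiv (hf : ContDiff ℝ 2 f) (x : Euc n) :
    lapl f x = ∑ i, fderiv ℝ (fun z => fderiv ℝ f z (stdv i)) x (stdv i) := by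
  rw [lapl_eq_sum_hess]
  exact Finset.sum_congr rfl fun i _ => hess_eq hf.contDiffAt _

lemma continuous_lapl (hf : ContDiff ℝ 2 f) : Continuous (lapl f) := by
  rw [funext fun x => lapl_eq_sum_fderiv hf x]
  refine continuous_finsetSum _ fun i _ => ?_
  exact ((continuous_fderiv_apply_of_contDiff hf (stdv i)).continuous_fderiv (by norm_num)).clm_apply
    continuous_const

lemma support_lapl_subset : tsupport (lapl f) ⊆ tsupport f := by
  refine closure_minimal (fun x hx => ?_) (isClosed_tsupport f)
  by_contra h
  have : f =ᶠ[𝓝 x] fun _ => 0 := notMem_tsupport_iff_eventuallyEq.1 h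
  exact hx (by rw [lapl_congr this, lapl_const])

lemma hasCompactSupport_lapl (hf : HasCompactSupport f) : HasCompactSupport (lapl f) :=
  hf.mono' (subset_closure.trans support_lapl_subset)

lemma integral_fderiv_mul_fderiv (hf : ContDiff ℝ 2 f) (hg : ContDiff ℝ 1 g)
    (hs : HasCompactSupport f ∨ HasCompactSupport g) (w : Euc n) :
    ∫ x, g x * fderiv ℝ (fun z => fderiv ℝ f z w) x w
      = - ∫ x, fderiv ℝ g x w * fderiv ℝ f x w := by
  have hF := continuous_fderiv_apply_of_contDiff hf w
  have c1 : Continuous fun x => fderiv ℝ g x w :=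
    (hg.continuous_fderiv (by norm_num)).clm_apply continuous_const
  have c2 : Continuous fun x => fderiv ℝ (fun z => fderiv ℝ f z w) x w :=
    (hF.continuous_fderiv (by norm_num)).clm_apply continuous_const
  have s1 : HasCompactSupport f → HasCompactSupport fun x => fderiv ℝ f x w := fun h =>
    h.fderiv_apply ℝ w
  have s2 : HasCompactSupport f →
      HasCompactSupport fun x => fderiv ℝ (fun z => fderiv ℝ f z w) x w := fun h =>
    (s1 h).fderiv_apply ℝ w
  have s3 : HasCompactSupport g → HasCompactSupport fun x => fderiv ℝ g x w := fun h =>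
    h.fderiv_apply ℝ w
  refine integral_mul_fderiv_eq_neg_fderiv_mul_of_integrable ?_ ?_ ?_
    (fun x _ => (hg.differentiable (by norm_num)).differentiableAt)
    (fun x _ => (hF.differentiable (by norm_num)).differentiableAt)
  · exact (c1.mul hF.continuous).integrable_of_hasCompactSupport
      (hs.elim (fun h => (s1 h).mul_left) (fun h => (s3 h).mul_right))
  · exact (hg.continuous.mul c2).integrable_of_hasCompactSupport
      (hs.elim (fun h => (s2 h).mul_left) (fun h => h.mul_right))
  · exact (hg.continuous.mul hF.continuous).integrable_of_hasCompactSupport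
      (hs.elim (fun h => (s1 h).mul_left) (fun h => h.mul_right))

/-- Green's second identity. -/
lemma integral_mul_lapl (hf : ContDiff ℝ 2 f) (hg : ContDiff ℝ 2 g)
    (hs : HasCompactSupport f) : ∫ x, g x * lapl f x = ∫ x, f x * lapl g x := by
  have c : ∀ {f : Euc n → ℝ}, ContDiff ℝ 2 f → ∀ w,
      Continuous fun x => fderiv ℝ (fun z => fderiv ℝ f z w) x w := fun hf w =>
    ((continuous_fderiv_apply_of_contDiff hf w).continuous_fderiv (by norm_num)).clm_apply
      continuous_const
  simp_rw [lapl_eq_sum_fderiv hf, lapl_eq_sum_fderiv hg, Finset.mul_sum]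
  rw [integral_finsetSum, integral_finsetSum]
  · refine Finset.sum_congr rfl fun i _ => ?_
    rw [integral_fderiv_mul_fderiv hf (hg.of_le (by norm_num)) (Or.inl hs),
      integral_fderiv_mul_fderiv hg (hf.of_le (by norm_num)) (Or.inr hs)]
    simp_rw [mul_comm]
  · exact fun i _ => (hf.continuous.mul (c hg _)).integrable_of_hasCompactSupport hs.mul_right
  · exact fun i _ => (hg.continuous.mul (c hf _)).integrable_of_hasCompactSupport
      (HasCompactSupport.mul_left ((hs.fderiv_apply ℝ _).fderiv_apply ℝ _))

end Green

/-- The truncated torsion function. -/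
def cutTor (u : Euc n → ℝ) (ε : ℝ) (x : Euc n) : ℝ := trunc ε (u x)

/-- The density of the approximating measures. -/
def torDens (u : Euc n → ℝ) (ε : ℝ) (x : Euc n) : ℝ :=
  lapl (cutTor u ε) x + 2 * cutoff ε (u x)

namespace Tor

variable {Ω : Set (Euc n)} {u : Euc n → ℝ} {ε : ℝ}

lemma cutTor_eventually_zero (h : Tor Ω u) (hε : 0 < ε) {x : Euc n} (hx : x ∉ Ω) :
    cutTor u ε =ᶠ[𝓝 x] fun _ => 0 := by
  have : ∀ᶠ z in 𝓝 x, u z < ε :=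
    h.cont.continuousAt.eventually (gt_mem_nhds (by rw [h.zero x hx]; exact hε))
  filter_upwards [this] with z hz using trunc_of_le hε hz.le

lemma cutTor_contDiff (h : Tor Ω u) (hε : 0 < ε) : ContDiff ℝ 2 (cutTor u ε) := by
  rw [contDiff_iff_contDiffAt]
  intro x
  by_cases hx : x ∈ Ω
  · exact (trunc_contDiff ε).contDiffAt.comp x (h.smooth x hx)
  · exact contDiffAt_const.congr_of_eventuallyEq (h.cutTor_eventually_zero hε hx)

lemma cutTor_tsupport (h : Tor Ω u) (hε : 0 < ε) : tsupport (cutTor u ε) ⊆ Ω := by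
  intro x hx
  by_contra hxΩ
  exact (notMem_tsupport_iff_eventuallyEq.2 (h.cutTor_eventually_zero hε hxΩ)) hx

lemma cutTor_compact (h : Tor Ω u) (hε : 0 < ε) : HasCompactSupport (cutTor u ε) :=
  h.bdd.isCompact_closure.of_isClosed_subset (isClosed_tsupport _)
    ((h.cutTor_tsupport hε).trans subset_closure)

lemma cutTor_nonneg (h : Tor Ω u) (x : Euc n) : 0 ≤ cutTor u ε x := trunc_nonneg ε (h.nonneg x)

lemma torDens_continuous (h : Tor Ω u) (hε : 0 < ε) : Continuous (torDens u ε) :=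
  (continuous_lapl (h.cutTor_contDiff hε)).add
    (continuous_const.mul ((cutoff_contDiff ε (k := 0)).continuous.comp h.cont))

lemma torDens_eq (h : Tor Ω u) {x : Euc n} (hx : x ∈ Ω) :
    torDens u ε x = deriv (cutoff ε) (u x) * ‖fderiv ℝ u x‖ ^ 2 := by
  have := lapl_comp (trunc_contDiff ε) (h.smooth x hx)
  rw [sum_fderiv_sq, deriv_trunc, h.lapl_eq x hx] at this
  change lapl (fun z => trunc ε (u z)) x + _ = _
  rw [this]; ring

lemma torDens_of_notMem (h : Tor Ω u) (hε : 0 < ε) {x : Euc n} (hx : x ∉ Ω) :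
    torDens u ε x = 0 := by
  rw [torDens, lapl_congr (h.cutTor_eventually_zero hε hx), lapl_const, h.zero x hx,
    cutoff_of_le hε hε.le]
  simp

lemma torDens_nonneg (h : Tor Ω u) (hε : 0 < ε) (x : Euc n) : 0 ≤ torDens u ε x := by
  by_cases hx : x ∈ Ω
  · rw [h.torDens_eq hx]
    have := (cutoff_monotone hε).deriv_nonneg (x := u x)
    positivity
  · rw [h.torDens_of_notMem hε hx]

lemma torDens_of_lt (h : Tor Ω u) (hε : 0 < ε) {x : Euc n} (hx : 2 * ε < u x) :
    torDens u ε x = 0 := by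
  have hxΩ : x ∈ Ω := by
    by_contra hc; rw [h.zero x hc] at hx; linarith
  have : cutoff ε =ᶠ[𝓝 (u x)] fun _ => 1 := by
    filter_upwards [lt_mem_nhds hx] with t ht using cutoff_of_ge hε ht.le
  rw [h.torDens_eq hxΩ, this.deriv_eq]; simp

lemma torDens_compact (h : Tor Ω u) (hε : 0 < ε) : HasCompactSupport (torDens u ε) :=
  HasCompactSupport.intro h.bdd.isCompact_closure fun _ hx =>
    h.torDens_of_notMem hε fun hc => hx (subset_closure hc)

end Tor

end

section

/-- The defining properties of the measure `|∇u| dH^{n-1}` on the boundary, obtained as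
a weak limit. -/
structure IsTorMeasure (Ω : Set (Euc n)) (u : Euc n → ℝ) (σ : Measure (Euc n)) : Prop where
  finite : IsFiniteMeasure σ
  null : σ (frontier Ω)ᶜ = 0
  green : ∀ η : Euc n → ℝ, ContDiff ℝ 2 η → ∫ x, η x ∂σ = (∫ x, u x * lapl η x) + 2 * ∫ x in Ω, η x
  super : ∀ W : Euc n → ℝ, Continuous W → (∀ ε > 0, 0 ≤ ∫ x, W x * lapl (cutTor u ε) x) →
    2 * ∫ x in Ω, W x ≤ ∫ x, W x ∂σ

namespace Tor

variable {Ω : Set (Euc n)} {u : Euc n → ℝ} {ε : ℝ}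

lemma compactSupport (h : Tor Ω u) : HasCompactSupport u :=
  HasCompactSupport.intro h.bdd.isCompact_closure fun x hx =>
    h.zero x fun hc => hx (subset_closure hc)

lemma cutoff_compact (h : Tor Ω u) (hε : 0 < ε) : HasCompactSupport fun x => cutoff ε (u x) :=
  HasCompactSupport.intro h.bdd.isCompact_closure fun x hx => by
    rw [h.zero x fun hc => hx (subset_closure hc), cutoff_of_le hε hε.le]

lemma integrable_mul_lapl (h : Tor Ω u) (hε : 0 < ε) {W : Euc n → ℝ} (hW : Continuous W) :
    Integrable fun x => W x * lapl (cutTor u ε) x :=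
  (hW.mul (continuous_lapl (h.cutTor_contDiff hε))).integrable_of_hasCompactSupport
    (hasCompactSupport_lapl (h.cutTor_compact hε)).mul_left

lemma integrable_mul_cutoff (h : Tor Ω u) (hε : 0 < ε) {W : Euc n → ℝ} (hW : Continuous W) :
    Integrable fun x => W x * cutoff ε (u x) :=
  (hW.mul ((cutoff_contDiff ε (k := 0)).continuous.comp h.cont)).integrable_of_hasCompactSupport
    (h.cutoff_compact hε).mul_left

lemma integrableOn_of_continuous (h : Tor Ω u) {W : Euc n → ℝ} (hW : Continuous W) :
    IntegrableOn W Ω :=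
  (hW.continuousOn.integrableOn_compact h.bdd.isCompact_closure).mono_set subset_closure

lemma integral_mul_torDens (h : Tor Ω u) (hε : 0 < ε) {W : Euc n → ℝ} (hW : Continuous W) :
    ∫ x, W x * torDens u ε x
      = (∫ x, W x * lapl (cutTor u ε) x) + 2 * ∫ x, W x * cutoff ε (u x) := by
  rw [← integral_const_mul, ← integral_add (h.integrable_mul_lapl hε hW)
    ((h.integrable_mul_cutoff hε hW).const_mul 2)]
  congr 1; ext x; rw [torDens]; ring

lemma tendsto_eps : Tendsto (fun k : ℕ => 1 / ((k:ℝ) + 1)) atTop (𝓝 0) :=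
  tendsto_one_div_add_atTop_nhds_zero_nat

lemma tendsto_cutoff (h : Tor Ω u) {W : Euc n → ℝ} (hW : Continuous W) :
    Tendsto (fun k : ℕ => ∫ x, W x * cutoff (1 / ((k:ℝ) + 1)) (u x)) atTop
      (𝓝 (∫ x in Ω, W x)) := by
  rw [← integral_indicator h.isOpen.measurableSet]
  refine tendsto_integral_of_dominated_convergence (Ω.indicator fun x => |W x|) ?_ ?_ ?_ ?_
  · intro k
    exact (hW.mul ((cutoff_contDiff _ (k := 0)).continuous.comp h.cont)).aestronglyMeasurable
  · rw [integrable_indicator_iff h.isOpen.measurableSet]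
    exact h.integrableOn_of_continuous hW.abs
  · intro k
    refine Eventually.of_forall fun x => ?_
    have hk : (0:ℝ) < 1 / ((k:ℝ) + 1) := by positivity
    by_cases hx : x ∈ Ω
    · rw [indicator_of_mem hx, Real.norm_eq_abs, abs_mul, abs_of_nonneg (cutoff_nonneg _ _)]
      exact mul_le_of_le_one_right (abs_nonneg _) (cutoff_le_one _ _)
    · rw [h.zero x hx, cutoff_of_le hk hk.le, indicator_of_notMem hx]; simp
  · refine Eventually.of_forall fun x => ?_
    by_cases hx : x ∈ Ω
    · rw [indicator_of_mem hx]
      refine tendsto_const_nhds.congr' ?_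
      have hp : (0:ℝ) < u x / 2 := by have := h.pos hx; positivity
      filter_upwards [tendsto_eps.eventually (gt_mem_nhds hp)] with k hk
      rw [cutoff_of_ge (by positivity) (by linarith), mul_one]
    · rw [indicator_of_notMem hx]
      refine tendsto_const_nhds.congr fun k => ?_
      have hk : (0:ℝ) < 1 / ((k:ℝ) + 1) := by positivity
      rw [h.zero x hx, cutoff_of_le hk hk.le, mul_zero]

lemma tendsto_mul_cutTor (h : Tor Ω u) {W : Euc n → ℝ} (hW : Continuous W) :
    Tendsto (fun k : ℕ => ∫ x, cutTor u (1 / ((k:ℝ) + 1)) x * W x) atTop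
      (𝓝 (∫ x, u x * W x)) := by
  refine tendsto_integral_of_dominated_convergence (fun x => u x * |W x|) ?_ ?_ ?_ ?_
  · intro k
    have : Continuous (cutTor u (1 / ((k:ℝ) + 1))) := (trunc_contDiff _).continuous.comp h.cont
    exact (this.mul hW).aestronglyMeasurable
  · exact (h.cont.mul hW.abs).integrable_of_hasCompactSupport h.compactSupport.mul_right
  · intro k
    refine Eventually.of_forall fun x => ?_
    rw [Real.norm_eq_abs, abs_mul, abs_of_nonneg (h.cutTor_nonneg x)]
    exact mul_le_mul_of_nonneg_right (trunc_le _ (h.nonneg x)) (abs_nonneg _)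
  · refine Eventually.of_forall fun x => Tendsto.mul_const _ ?_
    refine tendsto_of_tendsto_of_tendsto_of_le_of_le
      (g := fun k : ℕ => u x - 2 * (1 / ((k:ℝ) + 1))) (h := fun _ => u x) ?_
      tendsto_const_nhds (fun k => ?_) (fun k => trunc_le _ (h.nonneg x))
    · simpa using (tendsto_eps.const_mul 2).const_sub (u x)
    · have := le_trunc_add (ε := 1 / ((k:ℝ) + 1)) (by positivity) (u x)
      simp only [cutTor]; linarith

lemma exists_weak_limit (h : Tor Ω u) : ∃ (σ : Measure (Euc n)) (𝒰 : Ultrafilter ℕ),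
    IsFiniteMeasure σ ∧ (𝒰 : Filter ℕ) ≤ atTop ∧ σ (closure Ω)ᶜ = 0 ∧
    ∀ W : Euc n → ℝ, Continuous W →
      Tendsto (fun k : ℕ => ∫ x, W x * torDens u (1 / ((k:ℝ) + 1)) x) 𝒰 (𝓝 (∫ x, W x ∂σ)) := by
  have hpos : ∀ k : ℕ, (0:ℝ) < 1 / ((k:ℝ) + 1) := fun k => by positivity
  have hInt : ∀ k : ℕ, Integrable (torDens u (1 / ((k:ℝ) + 1))) := fun k =>
    (h.torDens_continuous (hpos k)).integrable_of_hasCompactSupport (h.torDens_compact (hpos k))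
  set m : ℕ → Measure (Euc n) := fun k =>
    volume.withDensity fun x => ENNReal.ofReal (torDens u (1 / ((k:ℝ) + 1)) x) with hm
  have hfin : ∀ k, IsFiniteMeasure (m k) := fun k =>
    isFiniteMeasure_withDensity_ofReal (hInt k).2
  have hmint : ∀ k (W : Euc n → ℝ), ∫ x, W x ∂(m k)
      = ∫ x, W x * torDens u (1 / ((k:ℝ) + 1)) x := by
    intro k W
    have hme : Measurable fun x => (torDens u (1 / ((k:ℝ) + 1)) x).toNNReal :=
      (h.torDens_continuous (hpos k)).measurable.real_toNNReal
    change ∫ x, W x ∂(volume.withDensity fun x =>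
      (((torDens u (1 / ((k:ℝ) + 1)) x).toNNReal : ℝ≥0) : ℝ≥0∞)) = _
    rw [integral_withDensity_eq_integral_smul hme]
    congr 1; ext x
    rw [NNReal.smul_def, Real.coe_toNNReal _ (h.torDens_nonneg (hpos k) x), smul_eq_mul, mul_comm]
  set M : ℕ → FiniteMeasure (Euc n) := fun k => ⟨m k, hfin k⟩ with hM
  set C : ℝ≥0 := (2 * volume.real Ω).toNNReal with hC
  have hmass : ∀ k, (M k).mass ≤ C := by
    intro k
    have h1 : ∫ x, (1:ℝ) ∂(m k) ≤ 2 * volume.real Ω := by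
      rw [hmint k, h.integral_mul_torDens (hpos k) continuous_const]
      have e1 : ∫ x, (1:ℝ) * lapl (cutTor u (1 / ((k:ℝ) + 1))) x = 0 := by
        rw [integral_mul_lapl (h.cutTor_contDiff (hpos k)) contDiff_const (h.cutTor_compact (hpos k))]
        simp [lapl_const]
      rw [e1, zero_add]
      have e2 : ∫ x, (1:ℝ) * cutoff (1 / ((k:ℝ) + 1)) (u x) ≤ ∫ x in Ω, (1:ℝ) := by
        rw [← integral_indicator h.isOpen.measurableSet]
        refine integral_mono (h.integrable_mul_cutoff (hpos k) continuous_const) ?_ fun x => ?_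
        · rw [integrable_indicator_iff h.isOpen.measurableSet]
          exact h.integrableOn_of_continuous continuous_const
        · by_cases hx : x ∈ Ω
          · simp [indicator_of_mem hx, cutoff_le_one]
          · rw [indicator_of_notMem hx, h.zero x hx, cutoff_of_le (hpos k) (hpos k).le, mul_zero]
      simp at e2 ⊢
      linarith
    have h2 : ((M k).mass : ℝ) = ∫ x, (1:ℝ) ∂(m k) := by
      simp [FiniteMeasure.mass, M, Measure.real]
      rfl
    rw [hC, ← NNReal.coe_le_coe, h2, Real.coe_toNNReal _ (by positivity)]
    exact h1
  have hnull : ∀ k, M k (closure Ω)ᶜ = 0 := by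
    intro k
    rw [FiniteMeasure.null_iff_toMeasure_null]
    change (m k) _ = 0
    rw [hm, withDensity_apply _ isClosed_closure.measurableSet.compl]
    rw [setLIntegral_congr_fun (g := fun _ => 0) isClosed_closure.measurableSet.compl]
    · simp
    · intro x hx
      simp only
      rw [h.torDens_of_notMem (hpos k) fun hc => hx (subset_closure hc)]; simp
  have hcpt := isCompact_setOfPred_finiteMeasure_le_of_isCompact C h.bdd.isCompact_closure
  obtain ⟨N, hN, hlim⟩ := isCompact_iff_ultrafilter_le_nhds.1 hcpt ((hyperfilter ℕ).map M) (by
    rw [le_principal_iff]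
    exact Filter.mem_map.2 (Eventually.of_forall fun k => ⟨hmass k, hnull k⟩))
  have hN0 : (N : Measure (Euc n)) (closure Ω)ᶜ = 0 :=
    (FiniteMeasure.null_iff_toMeasure_null _ _).1 hN.2
  refine ⟨N, hyperfilter ℕ, inferInstance, Nat.hyperfilter_le_atTop, hN0, fun W hW => ?_⟩
  obtain ⟨B, hB⟩ := h.bdd.isCompact_closure.exists_bound_of_continuousOn hW.continuousOn
  set W' : BoundedContinuousFunction (Euc n) ℝ := BoundedContinuousFunction.ofNormedAddCommGroup
    (fun x => max (-B) (min B (W x))) (by fun_prop) |B| (fun x => by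
      rw [Real.norm_eq_abs, abs_le]
      refine ⟨?_, ?_⟩
      · exact le_max_of_le_left (neg_le_neg (le_abs_self B))
      · exact max_le (neg_le_abs B) ((min_le_left _ _).trans (le_abs_self B))) with hW'
  have hWW : ∀ x ∈ closure Ω, W' x = W x := by
    intro x hx
    have := abs_le.1 (hB x hx)
    change max (-B) (min B (W x)) = W x
    rw [min_eq_right this.2, max_eq_right this.1]
  have h3 := FiniteMeasure.tendsto_iff_forall_integral_tendsto.1
    (show Tendsto M (hyperfilter ℕ) (𝓝 N) from hlim) W'
  have ae : ∀ (ρ : Measure (Euc n)), ρ (closure Ω)ᶜ = 0 → ∫ x, W' x ∂ρ = ∫ x, W x ∂ρ := by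
    intro ρ hρ
    refine integral_congr_ae ?_
    have : ∀ᵐ x ∂ρ, x ∈ closure Ω := hρ
    filter_upwards [this] with x hx using hWW x hx
  rw [ae _ hN0] at h3
  refine h3.congr fun k => ?_
  rw [ae _ ((FiniteMeasure.null_iff_toMeasure_null _ _).1 (hnull k))]
  exact hmint k W

theorem exists_torMeasure (h : Tor Ω u) : ∃ σ, IsTorMeasure Ω u σ := by
  obtain ⟨σ, 𝒰, hfin, h𝒰, hcl, hlim⟩ := h.exists_weak_limit
  have hpos : ∀ k : ℕ, (0:ℝ) < 1 / ((k:ℝ) + 1) := fun k => by positivity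
  refine ⟨σ, hfin, ?_, ?_, ?_⟩
  · have hΩ0 : σ Ω = 0 := by
      refine measure_null_of_locally_null _ fun x hx => ?_
      have hp : 0 < u x / 2 := by have := h.pos hx; positivity
      have hV : {z | u x / 2 < u z} ∈ 𝓝 x :=
        h.cont.continuousAt.eventually (lt_mem_nhds (by have := h.pos hx; linarith))
      obtain ⟨r, hr, hB⟩ := Metric.nhds_basis_closedBall.mem_iff.1 hV
      let φ : ContDiffBump x := ⟨r / 2, r, by positivity, by linarith⟩
      refine ⟨ball x (r / 2), mem_nhdsWithin_of_mem_nhds (ball_mem_nhds x (by positivity)), ?_⟩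
      have h1 := hlim φ φ.continuous
      have h2 : ∀ᶠ k : ℕ in 𝒰, ∫ x, φ x * torDens u (1 / ((k:ℝ) + 1)) x = 0 := by
        have hp4 : 0 < u x / 4 := by linarith
        filter_upwards [h𝒰 (tendsto_eps.eventually (gt_mem_nhds hp4))] with k hk
        rw [integral_eq_zero_of_ae]
        refine Eventually.of_forall fun z => ?_
        by_cases hz : z ∈ ball x r
        · have : u x / 2 < u z := hB (ball_subset_closedBall hz)
          show φ z * torDens u (1 / ((k:ℝ) + 1)) z = 0
          rw [h.torDens_of_lt (hpos k) (x := z) (by linarith), mul_zero]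
        · have : φ z = 0 := by
            rw [← Function.notMem_support, φ.support_eq]; exact hz
          simp [this]
      have h3 : ∫ z, φ z ∂σ = 0 := tendsto_nhds_unique h1 (tendsto_const_nhds.congr' (h2.mono fun _ h => h.symm))
      have hInt : Integrable φ σ := φ.continuous.integrable_of_hasCompactSupport φ.hasCompactSupport
      rw [integral_eq_zero_iff_of_nonneg (fun z => φ.nonneg) hInt] at h3
      refine measure_mono_null (fun z hz => ?_) h3
      have : φ z = 1 := φ.one_of_mem_closedBall (ball_subset_closedBall hz)
      simp [this]
    have : (frontier Ω)ᶜ ⊆ Ω ∪ (closure Ω)ᶜ := by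
      intro x hx
      by_cases hxc : x ∈ closure Ω
      · left
        by_contra hxo
        exact hx (by rw [h.isOpen.frontier_eq]; exact ⟨hxc, hxo⟩)
      · exact Or.inr hxc
    exact measure_mono_null this (measure_union_null hΩ0 hcl)
  · intro η hη
    refine tendsto_nhds_unique (hlim η hη.continuous) ?_
    have h1 := (h.tendsto_mul_cutTor (continuous_lapl hη)).add
      ((h.tendsto_cutoff hη.continuous).const_mul 2)
    refine (h1.mono_left h𝒰).congr fun k => ?_
    rw [h.integral_mul_torDens (hpos k) hη.continuous,
      integral_mul_lapl (h.cutTor_contDiff (hpos k)) hη (h.cutTor_compact (hpos k))]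
  · intro W hW hsup
    refine le_of_tendsto_of_tendsto (((h.tendsto_cutoff hW).const_mul 2).mono_left h𝒰)
      (hlim W hW) (Eventually.of_forall fun k => ?_)
    simp only
    rw [h.integral_mul_torDens (hpos k) hW]
    linarith [hsup _ (hpos k)]

end Tor

end

section

lemma exists_bump (n : ℕ) : ∃ η : Euc n → ℝ, ContDiff ℝ 2 η ∧ (∀ x, 0 ≤ η x) ∧ (∀ x, η x ≤ 1) ∧
    (∀ x ∈ closedBall (0 : Euc n) 1, η x = 1) ∧ (∀ x ∉ closedBall (0 : Euc n) 2, η x = 0) := by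
  let b : ContDiffBump (0 : Euc n) := ⟨1, 2, by norm_num, by norm_num⟩
  refine ⟨b, b.contDiff, fun x => b.nonneg, fun x => b.le_one,
    fun x hx => b.one_of_mem_closedBall hx, fun x hx => b.zero_of_le_dist ?_⟩
  rw [mem_closedBall, not_le] at hx
  exact hx.le

namespace IsTorMeasure

variable {Ω : Set (Euc n)} {u : Euc n → ℝ} {σ : Measure (Euc n)}

lemma growth (hσ : IsTorMeasure Ω u σ) (h : Tor Ω u) : ∃ C : ℝ, 0 < C ∧ ∀ x₀ ∉ Ω, ∀ r : ℝ, 0 < r → r ≤ 1 →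
    σ.real (closedBall x₀ r) ≤ C * r ^ (n - 1) := by
  have := hσ.finite
  obtain ⟨η, hη2, hη0, hη1, hηone, hηzero⟩ := exists_bump n
  have hcs : HasCompactSupport η := by
    refine HasCompactSupport.intro (isCompact_closedBall (0 : Euc n) 2) hηzero
  obtain ⟨M, hM⟩ : ∃ M, ∀ x, ‖lapl η x‖ ≤ M :=
    (hasCompactSupport_lapl hcs).exists_bound_of_continuous (continuous_lapl hη2)
  have hM0 : 0 ≤ M := le_trans (norm_nonneg _) (hM 0)
  obtain ⟨D, hD0, hD⟩ := h.exists_diam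
  set V : ℝ := volume.real (ball (0 : Euc n) 1)
  have hV : 0 ≤ V := measureReal_nonneg
  refine ⟨(2 * D * M + 2) * (2 ^ n * V) + 1, by positivity, fun x₀ hx₀ r hr hr1 => ?_⟩
  have hn := h.pos_n
  have : Nonempty (Fin n) := ⟨⟨0, hn⟩⟩
  let ηr : Euc n → ℝ := fun z => η (-(r⁻¹ • x₀) + r⁻¹ • z)
  have harg : ∀ z : Euc n, -(r⁻¹ • x₀) + r⁻¹ • z = r⁻¹ • (z - x₀) := fun z => by
    rw [smul_sub]; abel
  have hmem : ∀ z (ρ : ℝ), -(r⁻¹ • x₀) + r⁻¹ • z ∈ closedBall (0 : Euc n) ρ ↔ z ∈ closedBall x₀ (r * ρ) := by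
    intro z ρ
    rw [harg, mem_closedBall_zero_iff, norm_smul, norm_inv, Real.norm_of_nonneg hr.le,
      mem_closedBall_iff_norm, inv_mul_le_iff₀ hr]
  have hηr2 : ContDiff ℝ 2 ηr := hη2.comp (by fun_prop)
  have hlap : ∀ z, lapl ηr z = (r⁻¹) ^ 2 * lapl η (-(r⁻¹ • x₀) + r⁻¹ • z) := fun z =>
    lapl_comp_affine _ _ _ hη2.contDiffAt
  have hout : ∀ z ∉ closedBall x₀ (r * 2), ηr z = 0 := fun z hz => hηzero _ (by rwa [hmem])
  have hlapout : ∀ z ∉ closedBall x₀ (r * 2), lapl ηr z = 0 := by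
    intro z hz
    have : ηr =ᶠ[𝓝 z] fun _ => 0 := by
      filter_upwards [isClosed_closedBall.isOpen_compl.mem_nhds hz] with y hy using hout y hy
    rw [lapl_congr this, lapl_const]
  have hvol : volume.real (closedBall x₀ (r * 2)) = r ^ n * (2 ^ n * V) := by
    rw [Measure.addHaar_real_closedBall _ _ (by positivity)]
    simp [V, mul_pow, mul_assoc]
  have hfin : volume (closedBall x₀ (r * 2)) < ⊤ := measure_closedBall_lt_top
  have h1 : σ.real (closedBall x₀ r) ≤ ∫ x, ηr x ∂σ := by
    rw [← integral_indicator_one measurableSet_closedBall]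
    refine integral_mono_of_nonneg (Eventually.of_forall fun z => ?_) ?_ (Eventually.of_forall fun z => ?_)
    · exact indicator_nonneg (fun _ _ => zero_le_one) _
    · refine Integrable.of_bound hηr2.continuous.aestronglyMeasurable 1 (Eventually.of_forall fun z => ?_)
      rw [Real.norm_of_nonneg (hη0 _)]; exact hη1 _
    · by_cases hz : z ∈ closedBall x₀ r
      · rw [indicator_of_mem hz]
        exact (hηone _ (by rwa [hmem, mul_one])).ge
      · rw [indicator_of_notMem hz]; exact hη0 _
  rw [hσ.green _ hηr2] at h1
  have h2 : ∫ x, u x * lapl ηr x ≤ (D * (r * 2) * ((r⁻¹) ^ 2 * M)) * (r ^ n * (2 ^ n * V)) := by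
    rw [← hvol, ← setIntegral_eq_integral_of_forall_compl_eq_zero (s := closedBall x₀ (r * 2))
      (fun z hz => by rw [hlapout z hz, mul_zero])]
    refine (Real.le_norm_self _).trans (norm_setIntegral_le_of_norm_le_const hfin fun z hz => ?_)
    rw [norm_mul, Real.norm_of_nonneg (h.nonneg z), hlap, norm_mul, norm_pow, norm_inv, Real.norm_of_nonneg hr.le]
    have := h.le_dist hD (x := z) hx₀
    rw [mem_closedBall] at hz
    gcongr
    · exact this.trans (by gcongr)
    · exact hM _
  have h3 : ∫ x in Ω, ηr x ≤ r ^ n * (2 ^ n * V) := by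
    rw [← hvol]
    calc ∫ x in Ω, ηr x ≤ ∫ x, ηr x := by
          refine setIntegral_le_integral ?_ (Eventually.of_forall fun z => hη0 _)
          exact hηr2.continuous.integrable_of_hasCompactSupport
            (HasCompactSupport.intro (isCompact_closedBall x₀ (r * 2)) hout)
      _ = ∫ x in closedBall x₀ (r * 2), ηr x :=
          (setIntegral_eq_integral_of_forall_compl_eq_zero hout).symm
      _ ≤ ∫ x in closedBall x₀ (r * 2), (1:ℝ) := by
          refine setIntegral_mono_on (hηr2.continuous.continuousOn.integrableOn_compact (isCompact_closedBall _ _)) (by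
            simpa using hfin) measurableSet_closedBall fun z _ => hη1 _
      _ = _ := by simp
  have h4 : r ^ n = r ^ (n - 1) * r := by rw [← pow_succ]; congr 1; omega
  calc σ.real (closedBall x₀ r) ≤ (D * (r * 2) * ((r⁻¹) ^ 2 * M)) * (r ^ n * (2 ^ n * V)) + 2 * (r ^ n * (2 ^ n * V)) := by
        linarith
    _ = (2 * D * M + 2 * r) * (2 ^ n * V) * r ^ (n-1) := by
        rw [h4]; field_simp
    _ ≤ ((2 * D * M + 2) * (2 ^ n * V) + 1) * r ^ (n-1) := by
        have : (2 * D * M + 2 * r) * (2 ^ n * V) ≤ (2 * D * M + 2) * (2 ^ n * V) := by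
          gcongr; linarith
        gcongr; linarith

lemma singleton_zero (hσ : IsTorMeasure Ω u σ) (h : Tor Ω u) {x₀ : Euc n} (hx₀ : x₀ ∉ Ω) : σ {x₀} = 0 := by
  have := hσ.finite
  obtain ⟨C, hC, hg⟩ := hσ.growth h
  have hn := h.hn
  have h1 : Tendsto (fun r : ℝ => C * r ^ (n - 1)) (𝓝[>] 0) (𝓝 0) := by
    have : Tendsto (fun r : ℝ => C * r ^ (n - 1)) (𝓝 0) (𝓝 (C * 0 ^ (n-1))) :=
      (Continuous.tendsto (by fun_prop) 0)
    rw [zero_pow (by omega), mul_zero] at this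
    exact this.mono_left nhdsWithin_le_nhds
  have h2 : σ.real {x₀} ≤ 0 := by
    refine ge_of_tendsto h1 ?_
    filter_upwards [Ioc_mem_nhdsGT (show (0:ℝ) < 1 by norm_num)] with r hr
    refine le_trans (measureReal_mono ?_) (hg x₀ hx₀ r hr.1 hr.2)
    simpa using hr.1.le
  have h3 : σ.real {x₀} = 0 := le_antisymm h2 measureReal_nonneg
  rwa [measureReal_eq_zero_iff] at h3

/-- The measure is dominated by a multiple of the surface measure. -/
lemma le_hausdorff (hσ : IsTorMeasure Ω u σ) (h : Tor Ω u) :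
    ∃ C : ℝ≥0, σ ≤ (C : ℝ≥0∞) • (μH[(n:ℝ) - 1] : Measure (Euc n)).restrict (frontier Ω) := by
  have := hσ.finite
  obtain ⟨C, hC, hg⟩ := hσ.growth h
  have hn := h.hn
  have hn1 : ((n - 1 : ℕ) : ℝ) = (n : ℝ) - 1 := by
    rw [Nat.cast_sub (by omega)]; simp
  set c : ℝ≥0 := C.toNNReal
  have hc0 : c ≠ 0 := by simpa [c] using hC
  have hle : (c⁻¹ : ℝ≥0) • σ ≤ (μH[(n:ℝ) - 1] : Measure (Euc n)) := by
    refine Measure.le_hausdorffMeasure _ _ 1 one_pos fun s hs => ?_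
    by_cases hse : (s ∩ frontier Ω).Nonempty
    swap
    · have : s ⊆ (frontier Ω)ᶜ := by
        intro x hx hxf
        exact hse ⟨x, hx, hxf⟩
      have h0 : σ s = 0 := measure_mono_null this hσ.null
      simp [h0]
    obtain ⟨x₀, hxs, hxf⟩ := hse
    have hx₀ := h.frontier_not_mem hxf
    have hdfin : ediam s ≠ ⊤ := ne_top_of_le_ne_top ENNReal.one_ne_top hs
    set d : ℝ := (ediam s).toReal with hd
    have hded : ediam s = ENNReal.ofReal d := (ENNReal.ofReal_toReal hdfin).symm
    have hsub : s ⊆ closedBall x₀ d := by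
      intro y hy
      rw [mem_closedBall, dist_edist]
      exact ENNReal.toReal_mono hdfin (edist_le_ediam_of_mem hy hxs)
    have hd0 : 0 ≤ d := ENNReal.toReal_nonneg
    have hd1 : d ≤ 1 := by
      have := ENNReal.toReal_mono ENNReal.one_ne_top hs
      simpa using this
    rcases hd0.eq_or_lt with hd' | hd'
    · have : s ⊆ {x₀} := by
        rw [← hd', closedBall_zero] at hsub; exact hsub
      have h0 : σ s = 0 := measure_mono_null this (hσ.singleton_zero h hx₀)
      simp [h0]
    · have h1 : σ s ≤ ENNReal.ofReal (C * d ^ (n-1)) := by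
        refine (measure_mono hsub).trans ?_
        rw [← ofReal_measureReal]
        exact ENNReal.ofReal_le_ofReal (hg x₀ hx₀ d hd' hd1)
      rw [ENNReal.ofReal_mul hC.le] at h1
      have h2 : ediam s ^ ((n:ℝ) - 1) = ENNReal.ofReal (d ^ (n-1)) := by
        rw [← hn1, ENNReal.rpow_natCast, hded, ENNReal.ofReal_pow hd0]
      rw [h2, Measure.smul_apply, ENNReal.smul_def, smul_eq_mul]
      calc ((c⁻¹ : ℝ≥0) : ℝ≥0∞) * σ s ≤ ((c⁻¹ : ℝ≥0) : ℝ≥0∞) * ((c : ℝ≥0∞) * ENNReal.ofReal (d ^ (n-1))) := by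
            gcongr; exact h1
        _ = _ := by
            rw [← mul_assoc, ← ENNReal.coe_mul, inv_mul_cancel₀ hc0]; simp
  refine ⟨c, ?_⟩
  have hres : σ = σ.restrict (frontier Ω) := by
    rw [Measure.restrict_eq_self_of_ae_mem]
    exact hσ.null
  rw [hres]
  refine Measure.le_iff.2 fun s hs => ?_
  rw [Measure.smul_apply, Measure.restrict_apply hs, Measure.restrict_apply hs]
  have h1 := hle (s ∩ frontier Ω)
  rw [Measure.smul_apply, ENNReal.smul_def, smul_eq_mul] at h1
  calc σ (s ∩ frontier Ω) = (c : ℝ≥0∞) * (((c⁻¹ : ℝ≥0) : ℝ≥0∞) * σ (s ∩ frontier Ω)) := by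
        rw [← mul_assoc, ← ENNReal.coe_mul, mul_inv_cancel₀ hc0]; simp
    _ ≤ _ := by rw [smul_eq_mul]; gcongr

end IsTorMeasure

end

section

namespace Tor

variable {Ω : Set (Euc n)} {u : Euc n → ℝ}

lemma inner_pos_of_normal {p : Euc n} {ρ : ℝ} (hρ : 0 < ρ) (hB : ball p ρ ⊆ Ω) {x X : Euc n}
    (hX : IsOuterNormalAt (closure Ω) x X) : ρ / 2 ≤ ⟪x - p, X⟫ := by
  have h1 : p + (ρ / 2) • X ∈ Ω := hB (by
    rw [mem_ball_iff_norm, add_sub_cancel_left, norm_smul, hX.1, Real.norm_of_nonneg (by positivity)]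
    linarith)
  have h2 := hX.2 _ (subset_closure h1)
  rw [inner_add_left, inner_smul_left, real_inner_self_eq_norm_sq, hX.1] at h2
  rw [inner_sub_left]
  simp at h2
  linarith

lemma exists_normal (h : Tor Ω u) {x : Euc n} (hx : x ∉ Ω) : ∃ X, IsOuterNormalAt (closure Ω) x X := by
  obtain ⟨ν, hν, hl⟩ := exists_unit_normal h.isOpen h.convex h.nonempty hx
  exact ⟨ν, hν, inner_le_of_mem_closure fun y hy => (hl y hy).le⟩

/-- The gauge of `Ω` with respect to an interior point. -/
lemma exists_gauge (h : Tor Ω u) {p : Euc n} (hp : p ∈ Ω) : ∃ (j : Euc n → ℝ) (K : ℝ≥0) (R : ℝ),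
    LipschitzWith K j ∧ 0 < R ∧ (∀ w, ‖w‖ ≤ R * j w) ∧ (∀ x ∈ frontier Ω, j (x - p) = 1) ∧
    (∀ w, ∀ t : ℝ, 0 ≤ t → j (t • w) = t * j w) ∧
    (∀ x X, IsOuterNormalAt (closure Ω) x X →
      0 < ⟪x - p, X⟫ ∧ ∀ w, ⟪w, X⟫ ≤ ⟪x - p, X⟫ * j w) := by
  obtain ⟨ρ, hρ, hB⟩ := Metric.isOpen_iff.1 h.isOpen p hp
  obtain ⟨D, hD0, hD⟩ := h.exists_diam
  set S : Set (Euc n) := (Homeomorph.addLeft p) ⁻¹' Ω with hS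
  have hmem : ∀ z, z ∈ S ↔ p + z ∈ Ω := fun z => Iff.rfl
  have hSc : Convex ℝ S := by
    intro x hx y hy a b ha hb hab
    rw [hmem] at hx hy ⊢
    have := h.convex hx hy ha hb hab
    rwa [show p + (a • x + b • y) = a • (p + x) + b • (p + y) by
      rw [smul_add, smul_add, add_add_add_comm, ← add_smul, hab, one_smul]]
  have hSo : IsOpen S := h.isOpen.preimage (Homeomorph.continuous _)
  have hSB : ball 0 ρ ⊆ S := by
    intro z hz
    rw [hmem]
    apply hB
    rw [mem_ball_iff_norm, add_sub_cancel_left]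
    simpa using hz
  have hS0 : S ∈ 𝓝 (0 : Euc n) := Filter.mem_of_superset (ball_mem_nhds _ hρ) hSB
  have habs : Absorbent ℝ S := absorbent_nhds_zero hS0
  have hSR : S ⊆ closedBall 0 D := by
    intro z hz
    have := hD _ (subset_closure hz) p (subset_closure hp)
    simpa [dist_eq_norm] using this
  have hnorm : ∀ w, ‖w‖ ≤ D * gauge S w := by
    intro w
    have := le_gauge_of_subset_closedBall (x := w) habs hD0.le hSR
    rwa [div_le_iff₀' hD0] at this
  have hfr : ∀ x, gauge S (x - p) = 1 ↔ x ∈ frontier Ω := by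
    intro x
    rw [gauge_eq_one_iff_mem_frontier hSc hS0, hS, ← Homeomorph.preimage_frontier]
    simp
  have hsm : ∀ w, ∀ t : ℝ, 0 ≤ t → gauge S (t • w) = t * gauge S w := fun w t ht => by
    rw [gauge_smul_of_nonneg ht, smul_eq_mul]
  refine ⟨gauge S, _, D, hSc.lipschitzWith_gauge (r := ⟨ρ, hρ.le⟩) hρ hSB, hD0, hnorm,
    fun x hx => (hfr x).2 hx, hsm, fun x X hX => ⟨by linarith [inner_pos_of_normal hρ hB hX], fun w => ?_⟩⟩
  by_cases hw : w = 0
  · subst hw; simp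
  have hj : 0 < gauge S w := by
    by_contra hc
    have := hnorm w
    have h2 : 0 < ‖w‖ := norm_pos_iff.2 hw
    nlinarith
  have h1 : p + (gauge S w)⁻¹ • w ∈ frontier Ω := by
    rw [← hfr, add_sub_cancel_left, hsm _ _ (by positivity), inv_mul_cancel₀ hj.ne']
  have h2 := hX.2 _ (frontier_subset_closure h1)
  rw [inner_add_left, inner_smul_left] at h2
  simp only [conj_trivial] at h2
  have h3 : (gauge S w)⁻¹ * ⟪w, X⟫ ≤ ⟪x - p, X⟫ := by rw [inner_sub_left]; linarith
  rwa [inv_mul_le_iff₀ hj, mul_comm] at h3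

section Radial

variable {j : Euc n → ℝ} {K : ℝ≥0} {R : ℝ} {p ν : Euc n}

lemma radial_lipschitz (hL : LipschitzWith K j) (hR : 0 < R) (hj : ∀ w, ‖w‖ ≤ R * j w) (hν : ‖ν‖ = 1) :
    ∃ L : ℝ≥0, LipschitzWith L fun z : (ℝ ∙ ν)ᗮ => p + (j (ν + z))⁻¹ • (ν + (z : Euc n)) := by
  refine ⟨(R + R * R * K).toNNReal, LipschitzWith.of_dist_le_mul fun z z' => ?_⟩
  have h1 : ∀ z : (ℝ ∙ ν)ᗮ, 1 ≤ ‖ν + (z : Euc n)‖ := by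
    intro z
    have := norm_add_sq_real ν (z : Euc n)
    rw [Submodule.mem_orthogonal_singleton_iff_inner_right.1 z.2, hν] at this
    nlinarith [norm_nonneg (ν + (z : Euc n)), sq_nonneg ‖(z : Euc n)‖]
  have e : dist z z' = ‖(ν + (z : Euc n)) - (ν + (z' : Euc n))‖ := by
    rw [add_sub_add_left_eq_sub]; rw [dist_eq_norm]; rfl
  rw [e]
  have hz := h1 z
  have hz' := h1 z'
  set w := ν + (z : Euc n)
  set w' := ν + (z' : Euc n)
  have hjw := hj w
  have hjw' := hj w'
  have p1 : 0 < j w := by by_contra hc; nlinarith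
  have p2 : 0 < j w' := by by_contra hc; nlinarith
  have i1 : (j w)⁻¹ ≤ R := by
    rw [inv_le_comm₀ p1 hR, inv_eq_one_div, div_le_iff₀ hR]; nlinarith
  have i2 : (j w')⁻¹ * ‖w'‖ ≤ R := by
    rw [inv_mul_le_iff₀ p2]; linarith
  have hjj : |j w' - j w| ≤ K * ‖w - w'‖ := by
    have := hL.dist_le_mul w' w
    rwa [Real.dist_eq, dist_comm, dist_eq_norm] at this
  rw [dist_add_left, dist_eq_norm, Real.coe_toNNReal _ (by positivity)]
  have e2 : (j w)⁻¹ • w - (j w')⁻¹ • w' = (j w)⁻¹ • (w - w') + ((j w)⁻¹ * (j w' - j w)) • ((j w')⁻¹ • w') := by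
    rw [smul_sub, smul_smul, sub_add, ← sub_smul]
    congr 2
    field_simp
    ring
  rw [e2]
  calc _ ≤ (j w)⁻¹ * ‖w - w'‖ + ((j w)⁻¹ * |j w' - j w|) * ((j w')⁻¹ * ‖w'‖) := by
        refine (norm_add_le _ _).trans ?_
        simp only [norm_smul, norm_mul, Real.norm_eq_abs, abs_inv, abs_of_pos p1, abs_of_pos p2]
        exact le_rfl
    _ ≤ R * ‖w - w'‖ + (R * (K * ‖w - w'‖)) * R := by gcongr
    _ = _ := by ring

lemma eq_radial {x : Euc n} (hx : j (x - p) = 1) (hsm : ∀ w, ∀ t : ℝ, 0 ≤ t → j (t • w) = t * j w)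
    (hν : ‖ν‖ = 1) (hpos : 0 < ⟪x - p, ν⟫) :
    ∃ z : (ℝ ∙ ν)ᗮ, (ν + (z : Euc n)) = ⟪x - p, ν⟫⁻¹ • (x - p) ∧ p + (j (ν + z))⁻¹ • (ν + (z : Euc n)) = x := by
  refine ⟨⟨⟪x - p, ν⟫⁻¹ • (x - p) - ν, ?_⟩, by simp, ?_⟩
  · rw [Submodule.mem_orthogonal_singleton_iff_inner_left, inner_sub_left, inner_smul_left,
      real_inner_self_eq_norm_sq, hν]
    simp [hpos.ne']
  · simp only [add_sub_cancel]
    rw [hsm _ _ (by positivity), hx, mul_one, inv_inv, smul_smul, mul_inv_cancel₀ hpos.ne', one_smul]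
    abel

lemma normal_eq_of_differentiableAt {z : (ℝ ∙ ν)ᗮ} {x X Y : Euc n} (hpos : 0 < ⟪x - p, ν⟫)
    (hz : ν + (z : Euc n) = ⟪x - p, ν⟫⁻¹ • (x - p)) (hx : j (x - p) = 1)
    (hsm : ∀ w, ∀ t : ℝ, 0 ≤ t → j (t • w) = t * j w)
    (hd : DifferentiableAt ℝ (fun z : (ℝ ∙ ν)ᗮ => j (ν + z)) z)
    (hX : ‖X‖ = 1) (hXp : 0 < ⟪x - p, X⟫) (hXj : ∀ w, ⟪w, X⟫ ≤ ⟪x - p, X⟫ * j w)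
    (hY : ‖Y‖ = 1) (hYp : 0 < ⟪x - p, Y⟫) (hYj : ∀ w, ⟪w, Y⟫ ≤ ⟪x - p, Y⟫ * j w) : X = Y := by
  have key : ∀ X : Euc n, 0 < ⟪x - p, X⟫ → (∀ w, ⟪w, X⟫ ≤ ⟪x - p, X⟫ * j w) → ∀ e : (ℝ ∙ ν)ᗮ,
      ⟪(e : Euc n), X⟫ = ⟪x - p, X⟫ * fderiv ℝ (fun z : (ℝ ∙ ν)ᗮ => j (ν + z)) z e := by
    intro X hXp hXj e
    let l : (ℝ ∙ ν)ᗮ →L[ℝ] ℝ := (innerSL ℝ X).comp (Submodule.subtypeL _)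
    have hl : ∀ y, l y = ⟪(y : Euc n), X⟫ := fun y => real_inner_comm (y : Euc n) X
    have h1 : HasFDerivAt (fun y : (ℝ ∙ ν)ᗮ => ⟪x - p, X⟫ * j (ν + y) - (⟪ν, X⟫ + l y))
        (⟪x - p, X⟫ • fderiv ℝ (fun z : (ℝ ∙ ν)ᗮ => j (ν + z)) z - l) z :=
      (hd.hasFDerivAt.const_mul _).fun_sub ((l.hasFDerivAt).const_add _)
    have h2 : IsLocalMin (fun y : (ℝ ∙ ν)ᗮ => ⟪x - p, X⟫ * j (ν + y) - (⟪ν, X⟫ + l y)) z := by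
      refine Eventually.of_forall fun y => ?_
      simp only [hl, ← inner_add_left]
      rw [hz, hsm _ _ (by positivity), hx, inner_smul_left]
      have := hXj (ν + y)
      simp only [conj_trivial]
      linarith
    have h3 := h2.hasFDerivAt_eq_zero h1
    have h4 := congrArg (fun L => L e) h3
    simp only [_root_.sub_apply, _root_.smul_apply, smul_eq_mul, _root_.zero_apply, hl] at h4
    linarith
  have hQ : ⟪x - p, X⟫⁻¹ • X = ⟪x - p, Y⟫⁻¹ • Y := by
    rw [← sub_eq_zero]
    set Q := ⟪x - p, X⟫⁻¹ • X - ⟪x - p, Y⟫⁻¹ • Y with hQd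
    have h1 : Q ∈ ((ℝ ∙ ν)ᗮ)ᗮ := by
      rw [Submodule.mem_orthogonal]
      intro e he
      have a1 := key X hXp hXj ⟨e, he⟩
      have a2 := key Y hYp hYj ⟨e, he⟩
      simp only at a1 a2
      rw [hQd, inner_sub_right, inner_smul_right, inner_smul_right, a1, a2]
      field_simp
      ring
    rw [Submodule.orthogonal_orthogonal] at h1
    obtain ⟨c, hc⟩ := Submodule.mem_span_singleton.1 h1
    have h2 : ⟪x - p, Q⟫ = 0 := by
      rw [hQd, inner_sub_right, inner_smul_right, inner_smul_right, inv_mul_cancel₀ hXp.ne',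
        inv_mul_cancel₀ hYp.ne', sub_self]
    rw [← hc, inner_smul_right] at h2
    rcases mul_eq_zero.1 h2 with h2 | h2
    · rw [← hc, h2, zero_smul]
    · exact absurd h2 hpos.ne'
  have h3 : ⟪x - p, X⟫⁻¹ = ⟪x - p, Y⟫⁻¹ := by
    have := congrArg norm hQ
    rwa [norm_smul, norm_smul, hX, hY, mul_one, mul_one, norm_inv, norm_inv, Real.norm_of_nonneg hXp.le,
      Real.norm_of_nonneg hYp.le] at this
  rw [h3] at hQ
  exact smul_right_injective _ (inv_ne_zero hYp.ne') hQ

end Radial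

lemma finrank_orth (h : Tor Ω u) {ν : Euc n} (hν : ‖ν‖ = 1) : ((Module.finrank ℝ (ℝ ∙ ν)ᗮ : ℕ) : ℝ) = (n : ℝ) - 1 := by
  have hn := h.pos_n
  have : Fact (Module.finrank ℝ (Euc n) = (n - 1) + 1) := ⟨by simp; omega⟩
  rw [Submodule.finrank_orthogonal_span_singleton (n := n - 1) (by rintro rfl; simp at hν),
    Nat.cast_sub (by omega), Nat.cast_one]

/-- Locally the boundary is the Lipschitz image of a bounded part of a hyperplane, and the points
without unique normal form a null set. -/
lemma frontier_local (h : Tor Ω u) {x₀ : Euc n} (hx₀ : x₀ ∈ frontier Ω) : ∃ U ∈ 𝓝 x₀,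
    (μH[(n:ℝ) - 1] : Measure (Euc n)) (frontier Ω ∩ U) < ⊤ ∧
    (μH[(n:ℝ) - 1] : Measure (Euc n)) ({x ∈ frontier Ω | ¬ ∃! X, IsOuterNormalAt (closure Ω) x X} ∩ U) = 0 := by
  obtain ⟨p, hp⟩ := h.nonempty
  obtain ⟨j, K, R, hL, hR, hj, hj1, hsm, hN⟩ := h.exists_gauge hp
  have hne : x₀ - p ≠ 0 := by
    intro h0
    rw [sub_eq_zero] at h0
    exact h.frontier_not_mem hx₀ (h0 ▸ hp)
  have hne' : 0 < ‖x₀ - p‖ := norm_pos_iff.2 hne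
  set ν := ‖x₀ - p‖⁻¹ • (x₀ - p) with hνd
  have hν : ‖ν‖ = 1 := by simp [hνd, norm_smul, hne'.ne']
  obtain ⟨L, hLG⟩ := radial_lipschitz (p := p) hL hR hj hν
  set G := fun z : (ℝ ∙ ν)ᗮ => p + (j (ν + z))⁻¹ • (ν + (z : Euc n)) with hG
  have hn1 : (0:ℝ) ≤ (n:ℝ) - 1 := by
    have : (2:ℝ) ≤ n := by exact_mod_cast h.hn
    linarith
  set c := ‖x₀ - p‖ / 2 with hc
  have hc0 : 0 < c := by positivity
  have hU : {x : Euc n | c < ⟪x - p, ν⟫} ∈ 𝓝 x₀ := by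
    refine (isOpen_lt continuous_const (by fun_prop)).mem_nhds ?_
    rw [mem_ofPred_eq, hνd, inner_smul_right, real_inner_self_eq_norm_sq, hc]
    field_simp
    linarith
  have : (μH[(n:ℝ) - 1] : Measure (ℝ ∙ ν)ᗮ).IsAddHaarMeasure := by
    rw [← h.finrank_orth hν]; exact isAddHaarMeasure_hausdorffMeasure
  refine ⟨_, hU, ?_, ?_⟩
  · have hsub : frontier Ω ∩ {x : Euc n | c < ⟪x - p, ν⟫} ⊆ G '' closedBall 0 (R / c + 1) := by
      rintro x ⟨hx, hxU⟩
      have hxp : 0 < ⟪x - p, ν⟫ := hc0.trans hxU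
      obtain ⟨z, hz, hzx⟩ := eq_radial (hj1 x hx) hsm hν hxp
      refine ⟨z, ?_, hzx⟩
      rw [mem_closedBall_zero_iff]
      have e : (z : Euc n) = ⟪x - p, ν⟫⁻¹ • (x - p) - ν := by rw [← hz]; abel
      have hxR := hj (x - p)
      rw [hj1 x hx, mul_one] at hxR
      rw [Submodule.coe_norm, e]
      refine (norm_sub_le _ _).trans ?_
      rw [hν, norm_smul, norm_inv, Real.norm_of_nonneg hxp.le, inv_mul_eq_div]
      gcongr
      exact le_of_lt hxU
    refine (measure_mono hsub).trans_lt ((hLG.hausdorffMeasure_image_le hn1 _).trans_lt ?_)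
    refine ENNReal.mul_lt_top (ENNReal.rpow_lt_top_of_nonneg hn1 ENNReal.coe_ne_top) ?_
    exact (isCompact_closedBall _ _).measure_lt_top
  · have hLj : LipschitzWith K fun z : (ℝ ∙ ν)ᗮ => j (ν + z) := by
      refine LipschitzWith.of_dist_le_mul fun z z' => ?_
      refine (hL.dist_le_mul _ _).trans ?_
      rw [dist_add_left]; rfl
    have hae := hLj.ae_differentiableAt (μ := (μH[(n:ℝ) - 1] : Measure (ℝ ∙ ν)ᗮ))
    have hsub : {x ∈ frontier Ω | ¬ ∃! X, IsOuterNormalAt (closure Ω) x X} ∩ {x : Euc n | c < ⟪x - p, ν⟫} ⊆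
        G '' {z | ¬ DifferentiableAt ℝ (fun z : (ℝ ∙ ν)ᗮ => j (ν + z)) z} := by
      rintro x ⟨⟨hx, hxn⟩, hxU⟩
      have hxp : 0 < ⟪x - p, ν⟫ := hc0.trans hxU
      obtain ⟨z, hz, hzx⟩ := eq_radial (hj1 x hx) hsm hν hxp
      refine ⟨z, fun hd => hxn ?_, hzx⟩
      obtain ⟨X, hX⟩ := h.exists_normal (h.frontier_not_mem hx)
      refine ⟨X, hX, fun Y hY => ?_⟩
      exact normal_eq_of_differentiableAt hxp hz (hj1 x hx) hsm hd hY.1 (hN x Y hY).1 (hN x Y hY).2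
        hX.1 (hN x X hX).1 (hN x X hX).2
    refine measure_mono_null hsub (le_antisymm ((hLG.hausdorffMeasure_image_le hn1 _).trans ?_) (zero_le))
    rw [ae_iff.1 hae, mul_zero]

lemma isCompact_frontier (h : Tor Ω u) : IsCompact (frontier Ω) :=
  h.bdd.isCompact_closure.of_isClosed_subset isClosed_frontier frontier_subset_closure

lemma hausdorff_frontier_lt_top (h : Tor Ω u) : (μH[(n:ℝ) - 1] : Measure (Euc n)) (frontier Ω) < ⊤ := by
  have := h.isCompact_frontier.measure_lt_top_of_nhdsWithin
    (μ := (μH[(n:ℝ) - 1] : Measure (Euc n)).restrict (frontier Ω)) fun x hx => ?_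
  · rwa [Measure.restrict_apply_self] at this
  · obtain ⟨U, hU, h1, -⟩ := h.frontier_local hx
    refine ⟨U, mem_nhdsWithin_of_mem_nhds hU, ?_⟩
    rwa [Measure.restrict_apply' isClosed_frontier.measurableSet, inter_comm]

lemma ae_unique_normal (h : Tor Ω u) :
    ∀ᵐ x ∂(μH[(n:ℝ) - 1] : Measure (Euc n)).restrict (frontier Ω), ∃! X, IsOuterNormalAt (closure Ω) x X := by
  rw [ae_restrict_iff' isClosed_frontier.measurableSet, ae_iff]
  simp only [Classical.not_imp]
  refine measure_null_of_locally_null _ fun x hx => ?_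
  obtain ⟨U, hU, -, h2⟩ := h.frontier_local hx.1
  exact ⟨_, inter_mem self_mem_nhdsWithin (mem_nhdsWithin_of_mem_nhds hU), h2⟩

end Tor

end

section

/-- `ν` is the only outer unit normal to `cl Ω` at the boundary point `x`. -/
structure IsUniqueNormal (Ω : Set (Euc n)) (x ν : Euc n) : Prop where
  mem : x ∈ frontier Ω
  normal : IsOuterNormalAt (closure Ω) x ν
  unique : ∀ Y, IsOuterNormalAt (closure Ω) x Y → Y = ν

lemma exists_mem_frontier_segment {Ω : Set (Euc n)} (ho : IsOpen Ω) {a d : Euc n} {T : ℝ} (hT : 0 ≤ T)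
    (ha : a ∉ Ω) (hb : a + T • d ∈ Ω) : ∃ t ∈ Icc 0 T, a + t • d ∈ frontier Ω := by
  by_contra! hc
  have hcont : Continuous fun t : ℝ => a + t • d := by fun_prop
  have := (isPreconnected_Icc (a := (0:ℝ)) (b := T)).subset_or_subset
    (ho.preimage hcont) ((isClosed_closure (s := Ω)).isOpen_compl.preimage hcont) ?_ ?_
  · rcases this with h1 | h1
    · exact ha (by simpa using h1 (left_mem_Icc.2 hT))
    · exact h1 (right_mem_Icc.2 hT) (subset_closure hb)
  · rw [Set.disjoint_left]
    exact fun t h1 h2 => h2 (subset_closure h1)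
  · intro t ht
    by_cases h1 : a + t • d ∈ Ω
    · exact Or.inl h1
    · refine Or.inr fun h2 => hc t ht ?_
      rw [ho.frontier_eq]; exact ⟨h2, h1⟩

section Proj

variable {ν : Euc n}

lemma proj_perp_eq (hν : ‖ν‖ = 1) (w : Euc n) :
    ((ℝ ∙ ν)ᗮ.orthogonalProjectionOnto w : Euc n) = w - ⟪w, ν⟫ • ν := by
  have h1 := Submodule.starProjection_orthogonal_val (K := (ℝ ∙ ν)) w
  rw [Submodule.starProjection_unit_singleton ℝ hν, real_inner_comm] at h1
  exact h1

lemma norm_proj_perp_sq (hν : ‖ν‖ = 1) (w : Euc n) :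
    ‖(ℝ ∙ ν)ᗮ.orthogonalProjectionOnto w‖ ^ 2 = ‖w‖ ^ 2 - ⟪w, ν⟫ ^ 2 := by
  rw [Submodule.coe_norm, proj_perp_eq hν, norm_sub_sq_real, inner_smul_right, norm_smul, hν]
  simp
  ring

lemma inner_eq_proj (hν : ‖ν‖ = 1) (w X : Euc n) :
    ⟪w, X⟫ = ⟪w, ν⟫ * ⟪X, ν⟫ + ⟪(ℝ ∙ ν)ᗮ.orthogonalProjectionOnto w, (ℝ ∙ ν)ᗮ.orthogonalProjectionOnto X⟫ := by
  rw [Submodule.coe_inner, proj_perp_eq hν, proj_perp_eq hν]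
  simp only [inner_sub_left, inner_sub_right, inner_smul_left, inner_smul_right, real_inner_self_eq_norm_sq, hν,
    conj_trivial, real_inner_comm ν X]
  ring

end Proj

namespace Tor

variable {Ω : Set (Euc n)} {u : Euc n → ℝ}

lemma exists_uniqueNormal (h : Tor Ω u) :
    ∀ᵐ x ∂(μH[(n:ℝ) - 1] : Measure (Euc n)).restrict (frontier Ω), ∃ ν, IsUniqueNormal Ω x ν := by
  filter_upwards [h.ae_unique_normal, self_mem_ae_restrict isClosed_frontier.measurableSet] with x hx hxf
  obtain ⟨ν, h1, h2⟩ := hx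
  exact ⟨ν, hxf, h1, h2⟩

lemma inner_lt (h : Tor Ω u) {x ν : Euc n} (hν : IsOuterNormalAt (closure Ω) x ν) {y : Euc n} (hy : y ∈ Ω) :
    ⟪y, ν⟫ < ⟪x, ν⟫ := by
  obtain ⟨ρ, hρ, hB⟩ := Metric.isOpen_iff.1 h.isOpen y hy
  have := inner_pos_of_normal hρ hB hν
  rw [inner_sub_left] at this
  linarith

/-- Rays pointing inside the half space enter the domain. -/
lemma exists_ray_mem (h : Tor Ω u) {x₀ ν : Euc n} (hx : IsUniqueNormal Ω x₀ ν) {w : Euc n} (hw : ⟪w, ν⟫ < 0) :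
    ∃ t > (0:ℝ), x₀ + t • w ∈ Ω := by
  by_contra! hc
  have hx₀ := h.frontier_not_mem hx.mem
  obtain ⟨l, s, hl, hs⟩ := geometric_hahn_banach_open h.convex h.isOpen
    (t := (fun t : ℝ => x₀ + t • w) '' Ici 0)
    (by
      have : (fun t : ℝ => x₀ + t • w) = AffineMap.lineMap x₀ (x₀ + w) := by
        ext1 t; simp [AffineMap.lineMap_apply]; abel
      rw [this]
      exact (convex_Ici 0).affine_image _)
    (by
      rw [Set.disjoint_right]
      rintro _ ⟨t, ht, rfl⟩
      rcases (mem_Ici.1 ht).eq_or_lt with h0 | h0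
      · simpa [← h0] using hx₀
      · exact hc t h0)
  obtain ⟨X, rfl⟩ := (InnerProductSpace.toDual ℝ (Euc n)).surjective l
  simp only [InnerProductSpace.toDual_apply_apply] at hl hs
  have h1 : s ≤ ⟪X, x₀⟫ := by simpa using hs _ ⟨0, mem_Ici.2 le_rfl, rfl⟩
  have h2 : ⟪x₀, X⟫ ≤ s := inner_le_of_mem_closure (fun y hy => by rw [real_inner_comm]; exact (hl y hy).le) _
    (frontier_subset_closure hx.mem)
  have h3 : 0 ≤ ⟪X, w⟫ := by
    have := hs _ ⟨1, mem_Ici.2 zero_le_one, rfl⟩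
    rw [inner_add_right, one_smul] at this
    rw [real_inner_comm] at h2
    linarith
  have hX : 0 < ‖X‖ := by
    rw [norm_pos_iff]
    rintro rfl
    obtain ⟨y, hy⟩ := h.nonempty
    have := hl y hy
    simp at this h1
    linarith
  have hN : IsOuterNormalAt (closure Ω) x₀ (‖X‖⁻¹ • X) := by
    refine ⟨by simp [norm_smul, hX.ne'], inner_le_of_mem_closure fun y hy => ?_⟩
    rw [inner_smul_right, inner_smul_right]
    have := hl y hy
    rw [real_inner_comm y X] at this
    rw [real_inner_comm x₀ X] at h1
    gcongr
    linarith
  have h4 := hx.unique _ hN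
  rw [← h4, inner_smul_right, real_inner_comm] at hw
  have : 0 ≤ ‖X‖⁻¹ * ⟪X, w⟫ := by positivity
  linarith

/-- At a point with a unique normal the tangent cone is a half space, locally uniformly. -/
lemma exists_cone_mem (h : Tor Ω u) {x₀ ν : Euc n} (hx : IsUniqueNormal Ω x₀ ν) {Q : Set (Euc n)} (hQ : IsCompact Q)
    (hQν : ∀ w ∈ Q, ⟪w, ν⟫ < 0) : ∃ r₀ > (0:ℝ), ∀ w ∈ Q, ∀ t ∈ Ioc 0 r₀, x₀ + t • w ∈ Ω := by
  have hx₀ := frontier_subset_closure hx.mem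
  refine hQ.induction_on (p := fun Q => ∃ r₀ > (0:ℝ), ∀ w ∈ Q, ∀ t ∈ Ioc 0 r₀, x₀ + t • w ∈ Ω)
    ⟨1, one_pos, by simp⟩ ?_ ?_ ?_
  · rintro s t hst ⟨r, hr, hrt⟩
    exact ⟨r, hr, fun w hw => hrt w (hst hw)⟩
  · rintro s t ⟨r, hr, hrs⟩ ⟨r', hr', hrt⟩
    refine ⟨min r r', lt_min hr hr', ?_⟩
    rintro w (hw | hw) τ hτ
    · exact hrs w hw τ ⟨hτ.1, hτ.2.trans (min_le_left _ _)⟩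
    · exact hrt w hw τ ⟨hτ.1, hτ.2.trans (min_le_right _ _)⟩
  · intro w hw
    obtain ⟨t, ht, htw⟩ := h.exists_ray_mem hx (hQν w hw)
    have hcont : Continuous fun w' : Euc n => x₀ + t • w' := by fun_prop
    refine ⟨_, mem_nhdsWithin_of_mem_nhds ((h.isOpen.preimage hcont).mem_nhds htw), t, ht, fun w' hw' τ hτ => ?_⟩
    rcases hτ.2.eq_or_lt with h1 | h1
    · rw [h1]; exact hw'
    · have := h.combo_mem (t := τ / t) (div_pos hτ.1 ht) ((div_lt_one ht).2 h1) hx₀ hw'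
      convert this using 1
      rw [smul_add, smul_smul, div_mul_cancel₀ _ ht.ne', ← add_assoc, ← add_smul, sub_add_cancel, one_smul]

/-- Normals at nearby boundary points are close to the unique normal. -/
lemma exists_normal_close (h : Tor Ω u) {x₀ ν : Euc n} (hx : IsUniqueNormal Ω x₀ ν) {a : ℝ} (ha : a < 1) :
    ∃ r₀ > (0:ℝ), ∀ x ∈ frontier Ω, dist x x₀ ≤ r₀ → ∀ X, IsOuterNormalAt (closure Ω) x X → a < ⟪X, ν⟫ := by
  set S : Set (Euc n × Euc n) := {q | q.1 ∈ frontier Ω ∧ IsOuterNormalAt (closure Ω) q.1 q.2 ∧ ⟪q.2, ν⟫ ≤ a} with hS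
  have hSc : IsCompact S := by
    refine (h.isCompact_frontier.prod (isCompact_sphere (0 : Euc n) 1)).of_isClosed_subset ?_ ?_
    · have : S = {q | q.1 ∈ frontier Ω} ∩ ({q | ‖q.2‖ = 1} ∩ (⋂ y ∈ closure Ω, {q : Euc n × Euc n | ⟪y, q.2⟫ ≤ ⟪q.1, q.2⟫})
          ∩ {q | ⟪q.2, ν⟫ ≤ a}) := by
        ext q; simp [hS, IsOuterNormalAt]
      rw [this]
      refine (isClosed_frontier.preimage continuous_fst).inter (IsClosed.inter (IsClosed.inter ?_ ?_) ?_)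
      · exact isClosed_eq (by fun_prop) (by fun_prop)
      · exact isClosed_biInter fun y _ => isClosed_le (by fun_prop) (by fun_prop)
      · exact isClosed_le (by fun_prop) (by fun_prop)
    · rintro q ⟨h1, h2, -⟩
      exact ⟨h1, by simpa using h2.1⟩
  have hI := (hSc.image continuous_fst).isClosed
  have hx₀ : x₀ ∉ Prod.fst '' S := by
    rintro ⟨⟨x, X⟩, ⟨h1, h2, h3⟩, rfl⟩
    simp only at h1 h2 h3
    rw [hx.unique X h2, real_inner_self_eq_norm_sq, hx.normal.1] at h3
    linarith
  obtain ⟨r, hr, hB⟩ := Metric.isOpen_iff.1 hI.isOpen_compl x₀ hx₀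
  refine ⟨r / 2, by positivity, fun x hxf hxr X hX => ?_⟩
  by_contra hc
  exact hB (mem_ball.2 (by linarith : dist x x₀ < r)) ⟨(x, X), ⟨hxf, hX, not_lt.1 hc⟩, rfl⟩

/-- The boundary is a Lipschitz graph where the normals are close to a fixed direction. -/
lemma dist_le_proj {ν x y X Y : Euc n} (hν : ‖ν‖ = 1) {a : ℝ} (ha : 0 < a)
    (hx : x ∈ closure Ω) (hy : y ∈ closure Ω)
    (hX : IsOuterNormalAt (closure Ω) x X) (hY : IsOuterNormalAt (closure Ω) y Y)
    (haX : a ≤ ⟪X, ν⟫) (haY : a ≤ ⟪Y, ν⟫) :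
    a * ‖x - y‖ ≤ ‖(ℝ ∙ ν)ᗮ.orthogonalProjectionOnto (x - y)‖ := by
  have key : ∀ x y X : Euc n, y ∈ closure Ω → IsOuterNormalAt (closure Ω) x X → a ≤ ⟪X, ν⟫ → 0 ≤ ⟪y - x, ν⟫ →
      a * ‖y - x‖ ≤ ‖(ℝ ∙ ν)ᗮ.orthogonalProjectionOnto (y - x)‖ := by
    intro x y X hy hX haX h0
    have h1 := hX.2 y hy
    have h2 : ⟪y - x, X⟫ ≤ 0 := by rw [inner_sub_left]; linarith
    rw [inner_eq_proj hν] at h2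
    have h3 := abs_real_inner_le_norm ((ℝ ∙ ν)ᗮ.orthogonalProjectionOnto (y - x)) ((ℝ ∙ ν)ᗮ.orthogonalProjectionOnto X)
    have h4 := norm_proj_perp_sq hν X
    have h5 := norm_proj_perp_sq hν (y - x)
    rw [hX.1] at h4
    set P := ‖(ℝ ∙ ν)ᗮ.orthogonalProjectionOnto (y - x)‖
    set Q := ‖(ℝ ∙ ν)ᗮ.orthogonalProjectionOnto X‖
    have hP : 0 ≤ P := norm_nonneg _
    have hQ : 0 ≤ Q := norm_nonneg _
    have h6 : ⟪y - x, ν⟫ * a ≤ P * Q := by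
      have := (abs_le.1 h3).1
      nlinarith
    have hQ1 : Q ^ 2 ≤ 1 - a ^ 2 := by nlinarith
    have h7 : ⟪y - x, ν⟫ ^ 2 * a ^ 2 ≤ P ^ 2 * (1 - a ^ 2) := by
      calc _ = (⟪y - x, ν⟫ * a) ^ 2 := by ring
        _ ≤ (P * Q) ^ 2 := by gcongr
        _ = P ^ 2 * Q ^ 2 := by ring
        _ ≤ _ := by gcongr
    have h8 : (a * ‖y - x‖) ^ 2 ≤ P ^ 2 := by
      have : ‖y - x‖ ^ 2 = P ^ 2 + ⟪y - x, ν⟫ ^ 2 := by linarith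
      rw [mul_pow, this]; nlinarith
    exact le_of_sq_le_sq h8 hP
  rcases le_total 0 ⟪y - x, ν⟫ with h0 | h0
  · have := key x y X hy hX haX h0
    rwa [← neg_sub, norm_neg, map_neg, norm_neg]
  · have : 0 ≤ ⟪x - y, ν⟫ := by rw [← neg_sub, inner_neg_left]; linarith
    exact key y x Y hx hY haY this

end Tor

end

section

/-- The `(n-1)`-dimensional Hausdorff measure of the unit ball of `ℝ^{n-1}`. -/
def kap (n : ℕ) : ℝ := (μH[(n:ℝ) - 1] : Measure (Euc (n - 1))).real (closedBall 0 1)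

lemma isAddHaar_euc (hn : 2 ≤ n) : (μH[(n:ℝ) - 1] : Measure (Euc (n - 1))).IsAddHaarMeasure := by
  have : ((Module.finrank ℝ (Euc (n - 1)) : ℕ) : ℝ) = (n:ℝ) - 1 := by
    simp [Nat.cast_sub (by omega : 1 ≤ n)]
  rw [← this]; exact isAddHaarMeasure_hausdorffMeasure

lemma kap_pos (hn : 2 ≤ n) : 0 < kap n := by
  have := isAddHaar_euc hn
  exact ENNReal.toReal_pos (measure_closedBall_pos _ _ one_pos).ne' measure_closedBall_lt_top.ne

lemma hausdorff_perp_closedBall (hn : 2 ≤ n) {ν : Euc n} (hν : ‖ν‖ = 1) (z : (ℝ ∙ ν)ᗮ) {r : ℝ} (hr : 0 ≤ r) :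
    (μH[(n:ℝ) - 1] : Measure (ℝ ∙ ν)ᗮ) (closedBall z r) = ENNReal.ofReal (r ^ (n - 1) * kap n) := by
  have : Fact (Module.finrank ℝ (Euc n) = (n - 1) + 1) := ⟨by simp; omega⟩
  have hfr : Module.finrank ℝ (ℝ ∙ ν)ᗮ = n - 1 :=
    Submodule.finrank_orthogonal_span_singleton (n := n - 1) (by rintro rfl; simp at hν)
  let e : (ℝ ∙ ν)ᗮ ≃ₗᵢ[ℝ] Euc (n - 1) := ((stdOrthonormalBasis ℝ (ℝ ∙ ν)ᗮ).reindex (finCongr hfr)).repr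
  have h1 := e.toIsometryEquiv.hausdorffMeasure_image ((n:ℝ) - 1) (closedBall z r)
  rw [e.toIsometryEquiv.image_closedBall] at h1
  rw [← h1]
  have := isAddHaar_euc hn
  have hne : Nonempty (Fin (n - 1)) := ⟨⟨0, by omega⟩⟩
  have h2 := Measure.addHaar_closedBall (μH[(n:ℝ) - 1] : Measure (Euc (n - 1))) (0 : Euc (n-1)) zero_le_one
  rw [Measure.addHaar_closedBall _ _ hr, ENNReal.ofReal_mul (by positivity), kap, Measure.real,
    ENNReal.ofReal_toReal measure_closedBall_lt_top.ne, h2]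
  simp

namespace Tor

variable {Ω : Set (Euc n)} {u : Euc n → ℝ}

lemma hausdorff_ball_le (h : Tor Ω u) {x₀ ν : Euc n} (hx : IsUniqueNormal Ω x₀ ν) {a : ℝ} (ha : 0 < a) (ha1 : a < 1) :
    ∃ r₀ > (0:ℝ), ∀ r ∈ Ioc 0 r₀, (μH[(n:ℝ) - 1] : Measure (Euc n)) (frontier Ω ∩ closedBall x₀ r) ≤
      ENNReal.ofReal ((a⁻¹ * r) ^ (n - 1) * kap n) := by
  obtain ⟨r₀, hr₀, hN⟩ := h.exists_normal_close hx ha1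
  have hν := hx.normal.1
  have hn := h.hn
  have hn1 : (0:ℝ) ≤ (n:ℝ) - 1 := by
    have : (2:ℝ) ≤ n := by exact_mod_cast h.hn
    linarith
  have hcast : ((n - 1 : ℕ) : ℝ) = (n:ℝ) - 1 := by rw [Nat.cast_sub (by omega)]; simp
  refine ⟨r₀, hr₀, fun r hr => ?_⟩
  set s := frontier Ω ∩ closedBall x₀ r with hs
  let π := (ℝ ∙ ν)ᗮ.orthogonalProjectionOnto
  let f : s → (ℝ ∙ ν)ᗮ := fun x => π x
  have hanti : AntilipschitzWith (a⁻¹).toNNReal f := by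
    refine AntilipschitzWith.of_le_mul_dist fun x y => ?_
    obtain ⟨X, hX⟩ := h.exists_normal (h.frontier_not_mem x.2.1)
    obtain ⟨Y, hY⟩ := h.exists_normal (h.frontier_not_mem y.2.1)
    have := dist_le_proj hν ha (frontier_subset_closure x.2.1) (frontier_subset_closure y.2.1) hX hY
      (hN x x.2.1 ((mem_closedBall.1 x.2.2).trans hr.2) X hX).le (hN y y.2.1 ((mem_closedBall.1 y.2.2).trans hr.2) Y hY).le
    rw [Real.coe_toNNReal _ (by positivity), Subtype.dist_eq, dist_eq_norm, dist_eq_norm, ← map_sub,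
      ← div_eq_inv_mul, le_div_iff₀ ha, mul_comm]
    exact this
  have h1 := hanti.le_hausdorffMeasure_image hn1 univ
  have h2 := (isometry_subtype_coe (s := s)).hausdorffMeasure_image (Or.inl hn1) univ
  rw [image_univ, Subtype.range_coe] at h2
  rw [h2]
  refine h1.trans ?_
  have h3 : f '' univ ⊆ closedBall (π x₀) r := by
    rintro _ ⟨x, -, rfl⟩
    rw [mem_closedBall, dist_eq_norm, ← map_sub]
    refine ((ℝ ∙ ν)ᗮ.norm_orthogonalProjectionOnto_apply_le _).trans ?_
    rw [← dist_eq_norm]; exact x.2.2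
  calc _ ≤ (((a⁻¹).toNNReal : ℝ≥0) : ℝ≥0∞) ^ ((n:ℝ) - 1) * ENNReal.ofReal (r ^ (n - 1) * kap n) := by
        rw [← hausdorff_perp_closedBall hn hν (π x₀) hr.1.le]
        gcongr
    _ = _ := by
        rw [← hcast, ENNReal.rpow_natCast, mul_pow, mul_assoc, ENNReal.ofReal_mul (p := a⁻¹ ^ (n-1)) (by positivity),
          ENNReal.ofReal_pow (by positivity)]
        rfl

lemma hausdorff_ball_ge (h : Tor Ω u) {x₀ ν : Euc n} (hx : IsUniqueNormal Ω x₀ ν) {a : ℝ} (ha : 0 < a) (ha1 : a < 1) :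
    ∃ r₀ > (0:ℝ), ∀ r ∈ Ioc 0 r₀, ENNReal.ofReal ((a * r) ^ (n - 1) * kap n) ≤
      (μH[(n:ℝ) - 1] : Measure (Euc n)) (frontier Ω ∩ closedBall x₀ r) := by
  have hν := hx.normal.1
  have hn := h.hn
  have hn1 : (0:ℝ) ≤ (n:ℝ) - 1 := by
    have : (2:ℝ) ≤ n := by exact_mod_cast h.hn
    linarith
  set ε := √(1 - a ^ 2) with hε
  have hε0 : 0 < ε := Real.sqrt_pos.2 (by nlinarith)
  have hε2 : ε ^ 2 = 1 - a ^ 2 := Real.sq_sqrt (by nlinarith)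
  let Q : Set (Euc n) := closedBall 0 1 ∩ {w | ⟪w, ν⟫ ≤ -ε}
  have hQ : IsCompact Q := (isCompact_closedBall _ _).inter_right (isClosed_le (by fun_prop) (by fun_prop))
  obtain ⟨r₀, hr₀, hC⟩ := h.exists_cone_mem hx hQ (fun w hw => by have := hw.2; simp only [mem_ofPred_eq] at this; linarith)
  refine ⟨r₀, hr₀, fun r hr => ?_⟩
  let π := (ℝ ∙ ν)ᗮ.orthogonalProjectionOnto
  have hsub : closedBall (π x₀) (a * r) ⊆ π '' (frontier Ω ∩ closedBall x₀ r) := by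
    intro y hy
    set z : (ℝ ∙ ν)ᗮ := y - π x₀ with hz
    have hzn : ‖z‖ ≤ a * r := by rw [hz, ← dist_eq_norm]; exact hy
    have hzν : ⟪(z : Euc n), ν⟫ = 0 := Submodule.mem_orthogonal_singleton_iff_inner_left.1 z.2
    have hnot : x₀ + (z : Euc n) ∉ Ω := fun hc => by
      have := h.inner_lt hx.normal hc
      rw [inner_add_left, hzν] at this
      linarith
    have hw : r⁻¹ • (z : Euc n) - ε • ν ∈ Q := by
      constructor
      · rw [mem_closedBall_zero_iff]
        have h1 : ‖r⁻¹ • (z : Euc n) - ε • ν‖ ^ 2 = (r⁻¹ * ‖z‖) ^ 2 + ε ^ 2 := by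
          rw [norm_sub_sq_real, norm_smul, norm_smul, hν, inner_smul_left, inner_smul_right, hzν, norm_inv,
            Real.norm_of_nonneg hr.1.le, Real.norm_of_nonneg hε0.le]
          simp
        have h2 : r⁻¹ * ‖z‖ ≤ a := by
          rw [inv_mul_le_iff₀ hr.1]; linarith
        have h3 : (r⁻¹ * ‖z‖) ^ 2 ≤ a ^ 2 := by
          have := hr.1.le
          gcongr
        have h4 : ‖r⁻¹ • (z : Euc n) - ε • ν‖ ^ 2 ≤ 1 := by rw [h1]; linarith
        exact (sq_le_one_iff₀ (norm_nonneg _)).1 h4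
      · simp only [mem_ofPred_eq, inner_sub_left, inner_smul_left, hzν, real_inner_self_eq_norm_sq, hν]
        simp
    have hin := hC _ hw r hr
    have hin' : (x₀ + (z : Euc n)) + (ε * r) • (-ν) ∈ Ω := by
      convert hin using 1
      rw [smul_sub, smul_smul, smul_smul, mul_inv_cancel₀ hr.1.ne', one_smul, smul_neg, mul_comm ε r]
      abel
    obtain ⟨t, ht, htf⟩ := exists_mem_frontier_segment h.isOpen (by have := hr.1; positivity) hnot hin'
    refine ⟨_, ⟨htf, ?_⟩, ?_⟩
    · rw [mem_closedBall_iff_norm]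
      have h1 : ‖x₀ + (z : Euc n) + t • -ν - x₀‖ ^ 2 = ‖z‖ ^ 2 + t ^ 2 := by
        rw [show x₀ + (z : Euc n) + t • -ν - x₀ = (z : Euc n) - t • ν by rw [smul_neg]; abel,
          norm_sub_sq_real, inner_smul_right, hzν, norm_smul, hν, Submodule.coe_norm]
        simp
      have h2 : t ^ 2 ≤ (ε * r) ^ 2 := by gcongr; exact ht.1; exact ht.2
      have h3 : ‖z‖ ^ 2 ≤ (a * r) ^ 2 := by gcongr
      have h4 : ‖x₀ + (z : Euc n) + t • -ν - x₀‖ ^ 2 ≤ r ^ 2 := by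
        rw [h1]
        rw [mul_pow, hε2] at h2
        nlinarith
      exact le_of_sq_le_sq h4 hr.1.le
    · have h1 : π ν = 0 := by
        apply Submodule.orthogonalProjectionOnto_orthogonal_apply_eq_zero
        exact Submodule.mem_span_singleton_self ν
      have h2 : π (z : Euc n) = z := Submodule.orthogonalProjectionOnto_mem_subspace_eq_self z
      rw [map_add, map_add, map_smul, map_neg, h1, h2, hz]
      simp
  have hr' := hr.1
  rw [← hausdorff_perp_closedBall hn hν (π x₀) (by positivity : 0 ≤ a * r)]
  exact (measure_mono hsub).trans (hausdorffMeasure_orthogonalProjectionOnto_le _ _ _ hn1)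

/-- At a point with a unique normal the surface measure has the flat density. -/
lemma tendsto_hausdorff_ball (h : Tor Ω u) {x₀ ν : Euc n} (hx : IsUniqueNormal Ω x₀ ν) :
    Tendsto (fun r : ℝ => (μH[(n:ℝ) - 1] : Measure (Euc n)).real (frontier Ω ∩ closedBall x₀ r) / r ^ (n - 1))
      (𝓝[>] 0) (𝓝 (kap n)) := by
  have hk := kap_pos h.hn
  have hfin : ∀ r, (μH[(n:ℝ) - 1] : Measure (Euc n)) (frontier Ω ∩ closedBall x₀ r) ≠ ⊤ := fun r =>
    (measure_mono inter_subset_left |>.trans_lt h.hausdorff_frontier_lt_top).ne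
  have lower : ∀ a : ℝ, 0 < a → a < 1 → ∀ᶠ r in 𝓝[>] (0:ℝ), a ^ (n-1) * kap n ≤
      (μH[(n:ℝ) - 1] : Measure (Euc n)).real (frontier Ω ∩ closedBall x₀ r) / r ^ (n - 1) := by
    intro a ha ha1
    obtain ⟨r₀, hr₀, hH⟩ := h.hausdorff_ball_ge hx ha ha1
    filter_upwards [Ioc_mem_nhdsGT hr₀] with r hr
    have h1 := hr.1
    have := ENNReal.toReal_mono (hfin r) (hH r hr)
    rw [ENNReal.toReal_ofReal (by positivity)] at this
    rw [le_div_iff₀ (by positivity), Measure.real]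
    refine le_trans (le_of_eq ?_) this
    ring
  have upper : ∀ a : ℝ, 0 < a → a < 1 → ∀ᶠ r in 𝓝[>] (0:ℝ),
      (μH[(n:ℝ) - 1] : Measure (Euc n)).real (frontier Ω ∩ closedBall x₀ r) / r ^ (n - 1) ≤ a⁻¹ ^ (n-1) * kap n := by
    intro a ha ha1
    obtain ⟨r₀, hr₀, hH⟩ := h.hausdorff_ball_le hx ha ha1
    filter_upwards [Ioc_mem_nhdsGT hr₀] with r hr
    have h1 := hr.1
    have := ENNReal.toReal_mono ENNReal.ofReal_ne_top (hH r hr)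
    rw [ENNReal.toReal_ofReal (by positivity)] at this
    rw [div_le_iff₀ (by positivity), Measure.real]
    refine this.trans (le_of_eq ?_)
    ring
  have hev : ∀ᶠ a : ℝ in 𝓝[<] 1, 0 < a ∧ a < 1 := Ioo_mem_nhdsLT zero_lt_one
  have lim1 : Tendsto (fun a : ℝ => a ^ (n-1) * kap n) (𝓝[<] 1) (𝓝 (kap n)) := by
    have : Tendsto (fun a : ℝ => a ^ (n-1) * kap n) (𝓝 1) (𝓝 (1 ^ (n-1) * kap n)) :=
      Continuous.tendsto (by fun_prop) 1
    simpa using this.mono_left nhdsWithin_le_nhds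
  have lim2 : Tendsto (fun a : ℝ => a⁻¹ ^ (n-1) * kap n) (𝓝[<] 1) (𝓝 (kap n)) := by
    have h1 : Tendsto (fun a : ℝ => a⁻¹) (𝓝 1) (𝓝 (1⁻¹)) := tendsto_inv₀ one_ne_zero
    have := (h1.pow (n-1)).mul_const (kap n)
    simpa using this.mono_left nhdsWithin_le_nhds
  refine tendsto_order.2 ⟨fun b hb => ?_, fun b hb => ?_⟩
  · obtain ⟨a, h1, h2⟩ := ((lim1.eventually_const_lt hb).and hev).exists
    filter_upwards [lower a h2.1 h2.2] with r hr using h1.trans_le hr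
  · obtain ⟨a, h1, h2⟩ := ((lim2.eventually_lt_const hb).and hev).exists
    filter_upwards [upper a h2.1 h2.2] with r hr using hr.trans_lt h1

end Tor

end

section

lemma tendsto_unif_of_lipschitz {ι : Type*} {l : Filter ι} [l.NeBot] {F : ι → Euc n → ℝ} {U : Euc n → ℝ} {C : ℝ≥0}
    (hF : ∀ᶠ r in l, LipschitzWith C (F r)) (hU : ∀ z, Tendsto (fun r => F r z) l (𝓝 (U z))) :
    LipschitzWith C U ∧ ∀ K : Set (Euc n), IsCompact K → ∀ ε > 0, ∀ᶠ r in l, ∀ z ∈ K, |F r z - U z| ≤ ε := by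
  have hUL : LipschitzWith C U := by
    refine LipschitzWith.of_dist_le_mul fun x y => ?_
    refine le_of_tendsto ((hU x).dist (hU y)) ?_
    filter_upwards [hF] with r hr using hr.dist_le_mul x y
  refine ⟨hUL, fun K hK ε hε => ?_⟩
  refine hK.induction_on (p := fun K => ∀ᶠ r in l, ∀ z ∈ K, |F r z - U z| ≤ ε) (by simp) ?_ ?_ ?_
  · intro s t hst ht
    filter_upwards [ht] with r hr z hz using hr z (hst hz)
  · intro s t hs ht
    filter_upwards [hs, ht] with r h1 h2 z hz using hz.elim (h1 z) (h2 z)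
  · intro x _
    set δ := ε / (3 * (C + 1)) with hδ
    have hδ0 : 0 < δ := by positivity
    refine ⟨ball x δ, mem_nhdsWithin_of_mem_nhds (ball_mem_nhds _ hδ0), ?_⟩
    have h1 := (Metric.tendsto_nhds.1 (hU x)) (ε / 3) (by positivity)
    filter_upwards [hF, h1] with r h2 h3 z hz
    have h4 := h2.dist_le_mul z x
    have h5 := hUL.dist_le_mul x z
    have h6 : C * dist z x ≤ ε / 3 := by
      have : C * dist z x ≤ (C + 1) * δ := by
        have := (mem_ball.1 hz).le
        gcongr; simp
      refine this.trans (le_of_eq ?_)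
      rw [hδ]; field_simp
    rw [dist_comm x z] at h5
    rw [← Real.dist_eq]
    have := dist_triangle4 (F r z) (F r x) (U x) (U z)
    linarith

/-- The rescaling of `u` around `x₀` at scale `r`. -/
def blow (u : Euc n → ℝ) (x₀ : Euc n) (r : ℝ) (z : Euc n) : ℝ := r⁻¹ * u (x₀ + r • z)

lemma blow_lipschitz {u : Euc n → ℝ} {C : ℝ≥0} (hu : LipschitzWith C u) (x₀ : Euc n) {r : ℝ} (hr : 0 < r) :
    LipschitzWith C (blow u x₀ r) := by
  refine LipschitzWith.of_dist_le_mul fun x y => ?_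
  have h1 := hu.dist_le_mul (x₀ + r • x) (x₀ + r • y)
  rw [dist_add_left, dist_smul₀, Real.norm_of_nonneg hr.le] at h1
  rw [blow, blow, dist_eq_norm, ← mul_sub, norm_mul, norm_inv, Real.norm_of_nonneg hr.le, ← dist_eq_norm,
    inv_mul_le_iff₀ hr]
  linarith

lemma slope_const_of_affine {q : ℝ → ℝ} (h0 : Tendsto q (𝓝[>] 0) (𝓝 0))
    (ha : ∀ s₁ s s₂ : ℝ, 0 < s₁ → s₁ < s → s < s₂ → (s₂ - s₁) * q s = (s₂ - s) * q s₁ + (s - s₁) * q s₂) :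
    ∀ s > 0, q s = q 1 * s := by
  have key : ∀ s s₂ : ℝ, 0 < s → s < s₂ → s₂ * q s = s * q s₂ := by
    intro s s₂ hs hs₂
    have hid : Tendsto (fun x : ℝ => x) (𝓝[>] 0) (𝓝 0) := tendsto_nhdsWithin_of_tendsto_nhds tendsto_id
    have l1 : Tendsto (fun s₁ => (s₂ - s₁) * q s) (𝓝[>] 0) (𝓝 ((s₂ - 0) * q s)) :=
      (hid.const_sub s₂).mul_const _
    have l2 : Tendsto (fun s₁ => (s₂ - s) * q s₁ + (s - s₁) * q s₂) (𝓝[>] 0) (𝓝 ((s₂ - s) * 0 + (s - 0) * q s₂)) :=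
      (h0.const_mul _).add ((hid.const_sub s).mul_const _)
    have e : (fun s₁ => (s₂ - s₁) * q s) =ᶠ[𝓝[>] 0] (fun s₁ => (s₂ - s) * q s₁ + (s - s₁) * q s₂) := by
      filter_upwards [Ioo_mem_nhdsGT hs] with s₁ h1 using ha s₁ s s₂ h1.1 h1.2 hs₂
    have := tendsto_nhds_unique (l1.congr' e) l2
    simpa using this
  intro s hs
  rcases lt_trichotomy s 1 with h | h | h
  · have := key s 1 hs h; linarith
  · simp [h]
  · have := key 1 s one_pos h; linarith

namespace Tor

variable {Ω : Set (Euc n)} {u : Euc n → ℝ} {x₀ ν : Euc n} {U : Euc n → ℝ} {l : Filter ℝ}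

lemma contDiffAt_blow (h : Tor Ω u) {r : ℝ} {z : Euc n} (hz : x₀ + r • z ∈ Ω) : ContDiffAt ℝ 2 (blow u x₀ r) z :=
  contDiffAt_const.mul (contDiffAt_comp_affine (h.smooth _ hz))

lemma lapl_blow (h : Tor Ω u) {r : ℝ} (hr : 0 < r) {z : Euc n} (hz : x₀ + r • z ∈ Ω) :
    lapl (blow u x₀ r) z = -2 * r := by
  have h1 : ContDiffAt ℝ 2 (fun z => u (x₀ + r • z)) z := contDiffAt_comp_affine (h.smooth _ hz)
  change lapl (fun z => r⁻¹ * u (x₀ + r • z)) z = _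
  rw [lapl_const_mul _ h1, lapl_comp_affine _ _ _ (h.smooth _ hz), h.lapl_eq _ hz]
  field_simp

/-- Comparison principle for blow-up limits. -/
lemma blow_comparison (h : Tor Ω u) (hx : IsUniqueNormal Ω x₀ ν) [l.NeBot] (hl : l ≤ 𝓝[>] 0)
    (hU : ∀ z, Tendsto (fun r => blow u x₀ r z) l (𝓝 (U z))) {τ : ℝ} (hτ : |τ| = 1)
    {D : Set (Euc n)} (hD : IsOpen D) (hDb : IsBounded D) (hDν : ∀ z ∈ closure D, ⟪z, ν⟫ < 0)
    {φ : Euc n → ℝ} (hφ : ContDiff ℝ 2 φ) {c : ℝ} (hc : 0 < c) (hφl : ∀ z ∈ D, lapl φ z ≤ -c)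
    (hM : ∀ z ∈ frontier D, τ * U z ≤ φ z) : ∀ z ∈ closure D, τ * U z ≤ φ z := by
  intro z hz
  obtain ⟨C, hC⟩ := h.exists_lipschitz
  have hpos : ∀ᶠ r in l, 0 < r := hl self_mem_nhdsWithin
  obtain ⟨hUL, hunif⟩ := tendsto_unif_of_lipschitz (hpos.mono fun r hr => blow_lipschitz hC x₀ hr) hU
  obtain ⟨r₀, hr₀, hcone⟩ := h.exists_cone_mem hx hDb.isCompact_closure hDν
  have hsmall : ∀ᶠ r in l, r ∈ Ioc 0 (min r₀ (c / 2)) := hl (Ioc_mem_nhdsGT (by positivity))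
  refine le_of_forall_pos_le_add fun ε hε => ?_
  have h1 : ∀ᶠ r in l, τ * blow u x₀ r z ≤ φ z + ε := by
    filter_upwards [hunif _ (hDb.isCompact_closure.of_isClosed_subset isClosed_frontier frontier_subset_closure) ε hε,
      hsmall, hpos] with r hr hr2 hr0
    have hin : ∀ y ∈ closure D, x₀ + r • y ∈ Ω := fun y hy => hcone y hy r ⟨hr0, hr2.2.trans (min_le_left _ _)⟩
    have hcd : ∀ y ∈ closure D, ContDiffAt ℝ 2 (fun y => τ * blow u x₀ r y) y := fun y hy =>
      contDiffAt_const.mul (h.contDiffAt_blow (hin y hy))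
    have := max_principle h.pos_n hD hDb (w := fun y => τ * blow u x₀ r y - φ y) (M := ε)
      (fun y hy => ((hcd y hy).continuousAt.sub hφ.continuous.continuousAt).continuousWithinAt)
      (fun y hy => (hcd y (subset_closure hy)).sub hφ.contDiffAt)
      (fun y hy => by
        rw [lapl_sub (hcd y (subset_closure hy)) hφ.contDiffAt,
          lapl_const_mul _ (h.contDiffAt_blow (hin y (subset_closure hy))), h.lapl_blow hr0 (hin y (subset_closure hy))]
        have h1 := hφl y hy
        have h2 := hr2.2.trans (min_le_right _ _)
        have h3 : τ ≤ 1 := by rw [← hτ]; exact le_abs_self τ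
        nlinarith)
      (fun y hy => by
        have h1 := hM y hy
        have h2 := hr y hy
        have h3 : τ * (blow u x₀ r y - U y) ≤ ε := by
          refine (le_abs_self _).trans ?_
          rw [abs_mul, hτ, one_mul]; exact h2
        linarith) z hz
    linarith
  exact le_of_tendsto ((hU z).const_mul τ) h1

lemma blow_inner (h : Tor Ω u) (hx : IsUniqueNormal Ω x₀ ν) [l.NeBot] (hl : l ≤ 𝓝[>] 0)
    (hU : ∀ z, Tendsto (fun r => blow u x₀ r z) l (𝓝 (U z))) {z z' : Euc n} (hz : ⟪z, ν⟫ < 0)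
    (hzz : ⟪z', ν⟫ = ⟪z, ν⟫) : U z = U z' := by
  have hpos : ∀ᶠ r in l, 0 < r := hl self_mem_nhdsWithin
  have conc : ∀ x y : Euc n, ⟪x, ν⟫ < 0 → ⟪y, ν⟫ < 0 → ∀ t ∈ Ioo (0:ℝ) 1,
      (1 - t) * √(U x) ≤ √(U ((1 - t) • x + t • y)) := by
    intro x y hx0 hy0 t ht
    obtain ⟨r₀, hr₀, hcone⟩ := h.exists_cone_mem hx (Set.toFinite {x, y}).isCompact (by
      rintro w (rfl | rfl) <;> assumption)
    have hsmall : ∀ᶠ r in l, r ∈ Ioc 0 r₀ := hl (Ioc_mem_nhdsGT hr₀)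
    have lim : ∀ w, Tendsto (fun r => √(blow u x₀ r w)) l (𝓝 (√(U w))) := fun w =>
      (Real.continuous_sqrt.tendsto _).comp (hU w)
    refine le_of_tendsto_of_tendsto ((lim x).const_mul (1 - t)) (lim _) ?_
    filter_upwards [hpos, hsmall] with r hr0 hr
    have h1 := subset_closure (hcone x (by simp) r hr)
    have h2 := subset_closure (hcone y (by simp) r hr)
    have h3 := h.concaveOn_sqrt.2 h1 h2 (show (0:ℝ) ≤ 1 - t by linarith [ht.2]) ht.1.le (by ring)
    simp only [smul_eq_mul] at h3
    simp only [blow, Real.sqrt_mul (inv_nonneg.2 hr0.le)]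
    have h4 : x₀ + r • ((1 - t) • x + t • y) = (1 - t) • (x₀ + r • x) + t • (x₀ + r • y) := by module
    rw [h4]
    have h5 : 0 ≤ t * √(u (x₀ + r • y)) := mul_nonneg ht.1.le (Real.sqrt_nonneg _)
    have h6 : 0 ≤ √r⁻¹ := Real.sqrt_nonneg _
    calc (1 - t) * (√r⁻¹ * √(u (x₀ + r • x))) = √r⁻¹ * ((1 - t) * √(u (x₀ + r • x))) := by ring
      _ ≤ _ := by gcongr; linarith
  have hU0 : ∀ w, 0 ≤ U w := fun w => ge_of_tendsto (hU w) (by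
    filter_upwards [hpos] with r hr
    exact mul_nonneg (inv_nonneg.2 hr.le) (h.nonneg _))
  have main : ∀ z z' : Euc n, ⟪z, ν⟫ < 0 → ⟪z', ν⟫ = ⟪z, ν⟫ → U z' ≤ U z := by
    intro z z' hz hzz
    have h1 : ∀ t ∈ Ioo (0:ℝ) 1, (1 - t) * √(U z') ≤ √(U z) := by
      intro t ht
      have ht0 := ht.1.ne'
      have := conc z' (t⁻¹ • (z - (1 - t) • z')) (by linarith) (by
        rw [inner_smul_left, inner_sub_left, inner_smul_left, hzz]
        simp only [conj_trivial]
        have : t⁻¹ * (⟪z, ν⟫ - (1 - t) * ⟪z, ν⟫) = ⟪z, ν⟫ := by field_simp; ring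
        linarith) t ht
      rwa [smul_smul, mul_inv_cancel₀ ht0, one_smul, add_sub_cancel] at this
    have h2 : Tendsto (fun t : ℝ => (1 - t) * √(U z')) (𝓝[>] 0) (𝓝 ((1 - 0) * √(U z'))) :=
      tendsto_nhdsWithin_of_tendsto_nhds (Continuous.tendsto (by fun_prop) 0)
    have h3 : (1 - 0) * √(U z') ≤ √(U z) := le_of_tendsto h2 (by
      filter_upwards [Ioo_mem_nhdsGT one_pos] with t ht using h1 t ht)
    rw [sub_zero, one_mul] at h3
    exact (Real.sqrt_le_sqrt_iff (hU0 z)).1 h3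
  exact le_antisymm (main z' z (by linarith) hzz.symm) (main z z' hz hzz)

lemma lapl_quad (hν : ‖ν‖ = 1) (a b c d : ℝ) (x : Euc n) :
    lapl (fun z : Euc n => a * ‖z‖ ^ 2 + b * (⟪z, ν⟫ * ⟪z, ν⟫) + (c * ⟪z, ν⟫ + d)) x = 2 * n * a + 2 * b := by
  have h1 : lapl (fun z : Euc n => ‖z‖ ^ 2) x = 2 * n := by simpa using lapl_norm_sq (x := x) (0 : Euc n)
  have h2 : lapl (fun z : Euc n => ⟪z, ν⟫ * ⟪z, ν⟫) x = 2 := by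
    simpa [hν] using lapl_inner_sq (x := x) ν 0
  have h3 : lapl (fun z : Euc n => ⟪z, ν⟫) x = 0 := by
    have := lapl_clm (x := x) (innerSL ℝ ν)
    simpa [real_inner_comm] using this
  have c1 : ContDiffAt ℝ 2 (fun z : Euc n => ‖z‖ ^ 2) x := (contDiff_norm_sq ℝ).contDiffAt
  have c3 : ContDiffAt ℝ 2 (fun z : Euc n => ⟪z, ν⟫) x := by fun_prop
  rw [lapl_add ((contDiffAt_const.mul c1).add (contDiffAt_const.mul (c3.mul c3)))
    ((contDiffAt_const.mul c3).add contDiffAt_const),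
    lapl_add (contDiffAt_const.mul c1) (contDiffAt_const.mul (c3.mul c3)),
    lapl_add (contDiffAt_const.mul c3) contDiffAt_const,
    lapl_const_mul _ c1, lapl_const_mul _ (c3.mul c3), lapl_const_mul _ c3, h1, h2, h3, lapl_const]
  ring

/-- Blow-up limits at a point with a unique normal are linear functions of the distance to the tangent
hyperplane. -/
lemma blow_eq (h : Tor Ω u) (hx : IsUniqueNormal Ω x₀ ν) [l.NeBot] (hl : l ≤ 𝓝[>] 0)
    (hU : ∀ z, Tendsto (fun r => blow u x₀ r z) l (𝓝 (U z))) (z : Euc n) :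
    U z = U (-ν) * max (-⟪z, ν⟫) 0 := by
  have hν := hx.normal.1
  have hνν : ⟪ν, ν⟫ = 1 := by rw [real_inner_self_eq_norm_sq, hν]; norm_num
  obtain ⟨C, hC⟩ := h.exists_lipschitz
  have hpos : ∀ᶠ r in l, 0 < r := hl self_mem_nhdsWithin
  obtain ⟨hUL, -⟩ := tendsto_unif_of_lipschitz (hpos.mono fun r hr => blow_lipschitz hC x₀ hr) hU
  have hU0 : ∀ z, 0 ≤ ⟪z, ν⟫ → U z = 0 := by
    intro z hz
    refine tendsto_nhds_unique (hU z) (tendsto_const_nhds.congr' ?_)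
    filter_upwards [hpos] with r hr
    have : x₀ + r • z ∉ Ω := fun hm => by
      have := h.inner_lt hx.normal hm
      rw [inner_add_left, inner_smul_left] at this
      simp only [conj_trivial] at this
      nlinarith
    rw [blow, h.zero _ this, mul_zero]
  rcases le_or_gt 0 ⟪z, ν⟫ with hz | hz
  · rw [hU0 z hz, max_eq_right (by linarith), mul_zero]
  rw [max_eq_left (by linarith)]
  set q : ℝ → ℝ := fun s => U (-s • ν) with hq
  have hin : ∀ s : ℝ, ⟪-s • ν, ν⟫ = -s := fun s => by
    rw [inner_smul_left, hνν]; simp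
  have hqU : ∀ w : Euc n, ⟪w, ν⟫ < 0 → U w = q (-⟪w, ν⟫) := fun w hw =>
    h.blow_inner hx hl hU hw (by rw [hin]; ring)
  have hqb : ∀ s, 0 ≤ s → |q s| ≤ C * s := by
    intro s hs
    have h1 := hUL.dist_le_mul (-s • ν) 0
    rw [hU0 0 (by simp), dist_zero_right, dist_zero_right, norm_smul, hν, norm_neg, Real.norm_of_nonneg hs, mul_one] at h1
    exact h1
  have h0 : Tendsto q (𝓝[>] 0) (𝓝 0) := by
    have h1 : Tendsto (fun s : ℝ => (C:ℝ) * s) (𝓝[>] 0) (𝓝 (C * 0)) :=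
      tendsto_nhdsWithin_of_tendsto_nhds (Continuous.tendsto (by fun_prop) 0)
    rw [mul_zero] at h1
    refine squeeze_zero_norm' ?_ h1
    filter_upwards [self_mem_nhdsWithin] with s hs using hqb s (le_of_lt hs)
  have key : ∀ τ : ℝ, |τ| = 1 → ∀ s₁ s s₂ : ℝ, 0 < s₁ → s₁ < s → s < s₂ →
      (s₂ - s₁) * (τ * q s) ≤ τ * ((s₂ - s) * q s₁ + (s - s₁) * q s₂) := by
    intro τ hτ s₁ s s₂ hs₁ hs hs₂
    have h12 : 0 < s₂ - s₁ := by linarith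
    set m := (τ * (q s₂ - q s₁)) / (s₂ - s₁) with hm
    have hmm : m * (s₂ - s₁) = τ * (q s₂ - q s₁) := by rw [hm]; field_simp
    set A := 2 * (C * s₂) + |m| * (s₂ - s₁) + 1 with hA
    have hbd : ∀ s, 0 ≤ s → s ≤ s₂ → |τ * q s| ≤ C * s₂ := fun s h1 h2 => by
      rw [abs_mul, hτ, one_mul]; exact (hqb s h1).trans (by gcongr)
    have hA0 : 0 < A := by have := C.2; have h3 : 0 < s₂ := by linarith
                           positivity
    have step : ∀ ε > 0, τ * q s ≤ τ * q s₁ + m * (s - s₁) + n * ε * ((s - s₁) * (s₂ - s)) := by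
      intro ε hε
      set D : Set (Euc n) := {w | s₁ < -⟪w, ν⟫ ∧ -⟪w, ν⟫ < s₂ ∧ ε * (‖w‖ ^ 2 - ⟪w, ν⟫ ^ 2) < A} with hD
      have hDo : IsOpen D := by
        have c1 : Continuous fun w : Euc n => -⟪w, ν⟫ := by fun_prop
        have c2 : Continuous fun w : Euc n => ε * (‖w‖ ^ 2 - ⟪w, ν⟫ ^ 2) := by fun_prop
        exact (isOpen_lt continuous_const c1).inter
          ((isOpen_lt c1 continuous_const).inter (isOpen_lt c2 continuous_const))
      have hcl : closure D ⊆ {w | s₁ ≤ -⟪w, ν⟫ ∧ -⟪w, ν⟫ ≤ s₂ ∧ ε * (‖w‖ ^ 2 - ⟪w, ν⟫ ^ 2) ≤ A} := by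
        refine closure_minimal (fun w hw => ⟨hw.1.le, hw.2.1.le, hw.2.2.le⟩) ?_
        have c1 : Continuous fun w : Euc n => -⟪w, ν⟫ := by fun_prop
        have c2 : Continuous fun w : Euc n => ε * (‖w‖ ^ 2 - ⟪w, ν⟫ ^ 2) := by fun_prop
        exact (isClosed_le continuous_const c1).inter
          ((isClosed_le c1 continuous_const).inter (isClosed_le c2 continuous_const))
      have hDb : IsBounded D := by
        refine isBounded_iff_forall_norm_le.2 ⟨√(A / ε + s₂ ^ 2), fun w hw => ?_⟩
        refine Real.le_sqrt_of_sq_le ?_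
        have h1 : ‖w‖ ^ 2 - ⟪w, ν⟫ ^ 2 ≤ A / ε := by rw [le_div_iff₀ hε]; linarith [hw.2.2]
        have h2 := hw.1
        have h3 := hw.2.1
        nlinarith
      have hφe : ∀ w : Euc n, ε * ‖w‖ ^ 2 + (-(ε + n * ε)) * (⟪w, ν⟫ * ⟪w, ν⟫) + ((-m - n * ε * (s₁ + s₂)) * ⟪w, ν⟫ +
          (τ * q s₁ - m * s₁ - n * ε * (s₁ * s₂))) =
          τ * q s₁ + m * (-⟪w, ν⟫ - s₁) + ε * (‖w‖ ^ 2 - ⟪w, ν⟫ ^ 2) + n * ε * ((-⟪w, ν⟫ - s₁) * (s₂ - -⟪w, ν⟫)) :=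
        fun w => by ring
      have hφc : ContDiff ℝ 2 (fun w : Euc n => ε * ‖w‖ ^ 2 + (-(ε + n * ε)) * (⟪w, ν⟫ * ⟪w, ν⟫) +
          ((-m - n * ε * (s₁ + s₂)) * ⟪w, ν⟫ + (τ * q s₁ - m * s₁ - n * ε * (s₁ * s₂)))) := by
        have c1 : ContDiff ℝ 2 (fun w : Euc n => ‖w‖ ^ 2) := contDiff_norm_sq ℝ
        have c2 : ContDiff ℝ 2 (fun w : Euc n => ⟪w, ν⟫) := contDiff_id.inner ℝ contDiff_const
        exact ((contDiff_const.mul c1).add (contDiff_const.mul (c2.mul c2))).add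
          ((contDiff_const.mul c2).add contDiff_const)
      have h1 := h.blow_comparison hx hl hU hτ hDo hDb (fun w hw => by linarith [(hcl hw).1])
        (φ := fun w => ε * ‖w‖ ^ 2 + (-(ε + n * ε)) * (⟪w, ν⟫ * ⟪w, ν⟫) + ((-m - n * ε * (s₁ + s₂)) * ⟪w, ν⟫ +
          (τ * q s₁ - m * s₁ - n * ε * (s₁ * s₂)))) hφc (c := 2 * ε) (by positivity)
        (fun w _ => by rw [lapl_quad hν]; ring_nf; rfl) (fun w hw => by
          rw [hφe]
          obtain ⟨w1, w2, w3⟩ := hcl (frontier_subset_closure hw)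
          have hwD : w ∉ D := by rw [hDo.frontier_eq] at hw; exact hw.2
          rw [hqU w (by linarith)]
          have e1 : 0 ≤ ε * (‖w‖ ^ 2 - ⟪w, ν⟫ ^ 2) := by
            have := abs_real_inner_le_norm w ν
            rw [hν, mul_one] at this
            have := sq_le_sq' (by linarith [abs_le.1 this]) (abs_le.1 this).2
            have : 0 ≤ ‖w‖ ^ 2 - ⟪w, ν⟫ ^ 2 := by linarith
            positivity
          have e2 : 0 ≤ n * ε * ((-⟪w, ν⟫ - s₁) * (s₂ - -⟪w, ν⟫)) := by
            have := mul_nonneg (sub_nonneg.2 w1) (sub_nonneg.2 w2)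
            positivity
          by_cases hc1 : s₁ = -⟪w, ν⟫
          · rw [← hc1] at e2 ⊢; linarith
          by_cases hc2 : -⟪w, ν⟫ = s₂
          · rw [hc2] at e2 ⊢
            linarith
          have hc3 : A ≤ ε * (‖w‖ ^ 2 - ⟪w, ν⟫ ^ 2) := by
            by_contra hcon
            exact hwD ⟨lt_of_le_of_ne w1 hc1, lt_of_le_of_ne w2 hc2, not_le.1 hcon⟩
          have b1 := (abs_le.1 (hbd (-⟪w, ν⟫) (by linarith) w2)).2
          have b2 := (abs_le.1 (hbd s₁ hs₁.le (by linarith))).1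
          have b3 : -(|m| * (s₂ - s₁)) ≤ m * (-⟪w, ν⟫ - s₁) := by
            have : |m * (-⟪w, ν⟫ - s₁)| ≤ |m| * (s₂ - s₁) := by
              rw [abs_mul, abs_of_nonneg (sub_nonneg.2 w1)]
              gcongr
            linarith [(abs_le.1 this).1]
          linarith)
        (-s • ν) (subset_closure ⟨by rw [hin]; linarith, by rw [hin]; linarith, by
          rw [hin, norm_smul, hν]; simpa using hA0⟩)
      rw [hφe, hin, norm_smul, hν] at h1
      simpa [hq] using h1
    have h2 : Tendsto (fun ε : ℝ => τ * q s₁ + m * (s - s₁) + n * ε * ((s - s₁) * (s₂ - s))) (𝓝[>] 0)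
        (𝓝 (τ * q s₁ + m * (s - s₁) + n * 0 * ((s - s₁) * (s₂ - s)))) :=
      tendsto_nhdsWithin_of_tendsto_nhds (Continuous.tendsto (by fun_prop) 0)
    have h3 := ge_of_tendsto h2 (by filter_upwards [self_mem_nhdsWithin] with ε hε using step ε hε)
    have h4 := mul_le_mul_of_nonneg_left h3 h12.le
    calc (s₂ - s₁) * (τ * q s) ≤ _ := h4
      _ = (s₂ - s₁) * (τ * q s₁) + (m * (s₂ - s₁)) * (s - s₁) := by ring
      _ = _ := by rw [hmm]; ring
  have := slope_const_of_affine h0 (fun s₁ s s₂ a b c => by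
    have k1 := key 1 (by simp) s₁ s s₂ a b c
    have k2 := key (-1) (by simp) s₁ s s₂ a b c
    linarith) (-⟪z, ν⟫) (by linarith)
  rw [hqU z hz, this, hq]
  simp

end Tor

end

section

/-- A fixed radial bump function supported in the unit ball. -/
def rbump (z : Euc n) : ℝ := expNegInvGlue (1 - ‖z‖ ^ 2)

lemma rbump_contDiff : ContDiff ℝ 2 (rbump (n := n)) :=
  expNegInvGlue.contDiff.comp (contDiff_const.sub (contDiff_norm_sq ℝ))

lemma rbump_nonneg (z : Euc n) : 0 ≤ rbump z := expNegInvGlue.nonneg _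

lemma rbump_le_one (z : Euc n) : rbump z ≤ 1 := by
  unfold rbump expNegInvGlue
  split_ifs with h
  · exact zero_le_one
  · rw [Real.exp_le_one_iff, neg_nonpos]; exact inv_nonneg.2 (not_le.1 h).le

lemma rbump_zero {z : Euc n} (hz : z ∉ closedBall (0 : Euc n) 1) : rbump z = 0 := by
  refine expNegInvGlue.zero_of_nonpos ?_
  rw [mem_closedBall_zero_iff, not_le] at hz
  nlinarith

lemma rbump_hasCompactSupport : HasCompactSupport (rbump (n := n)) :=
  HasCompactSupport.intro (isCompact_closedBall (0 : Euc n) 1) fun _ => rbump_zero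

lemma lapl_rbump_zero {z : Euc n} (hz : z ∉ closedBall (0 : Euc n) 1) : lapl rbump z = 0 := by
  have : rbump =ᶠ[𝓝 z] fun _ => (0:ℝ) := by
    filter_upwards [isClosed_closedBall.isOpen_compl.mem_nhds hz] with y hy using rbump_zero hy
  rw [lapl_congr this, lapl_const]

/-- The radius of the superlevel sets of `rbump`. -/
def rrad (t : ℝ) : ℝ := if t ∈ Ioo 0 (Real.exp (-1)) then √(1 + (Real.log t)⁻¹) else 0

lemma rbump_superlevel {t : ℝ} (ht : t ∈ Ioo 0 (Real.exp (-1))) : 0 < rrad t ∧ rrad t ≤ 1 ∧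
    {z : Euc n | t ≤ rbump z} = closedBall 0 (rrad t) := by
  have hl : Real.log t < -1 := by rw [Real.log_lt_iff_lt_exp ht.1]; exact ht.2
  have hl1 : (Real.log t)⁻¹ < 0 := inv_lt_zero.2 (by linarith)
  have hl2 : -1 < (Real.log t)⁻¹ := by
    rw [neg_lt, ← inv_neg]
    exact inv_lt_one_of_one_lt₀ (by linarith)
  rw [rrad, if_pos ht]
  refine ⟨Real.sqrt_pos.2 (by linarith), Real.sqrt_le_one.2 (by linarith), ?_⟩
  ext z
  rw [mem_closedBall_zero_iff, Real.le_sqrt (norm_nonneg _) (by linarith)]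
  change t ≤ expNegInvGlue (1 - ‖z‖ ^ 2) ↔ _
  unfold expNegInvGlue
  split_ifs with hz
  · exact ⟨fun h => absurd h (by linarith [ht.1]), fun h => by linarith⟩
  · have hz' : 0 < 1 - ‖z‖ ^ 2 := not_le.1 hz
    rw [← Real.log_le_iff_le_exp ht.1, le_neg]
    have e : (1 - ‖z‖ ^ 2)⁻¹ ≤ - Real.log t ↔ (- Real.log t)⁻¹ ≤ 1 - ‖z‖ ^ 2 :=
      inv_le_comm₀ hz' (by linarith)
    rw [e, inv_neg]
    constructor <;> intro h <;> linarith

lemma rbump_superlevel_empty {t : ℝ} (ht : Real.exp (-1) < t) (z : Euc n) : ¬ t ≤ rbump z := by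
  have ht0 := (Real.exp_pos (-1)).trans ht
  unfold rbump expNegInvGlue
  split_ifs with hz
  · linarith
  · have hz' : 0 < 1 - ‖z‖ ^ 2 := not_le.1 hz
    rw [not_le]
    refine lt_of_le_of_lt (Real.exp_le_exp.2 ?_) ht
    rw [neg_le_neg_iff]
    exact (one_le_inv₀ hz').2 (by nlinarith [sq_nonneg ‖z‖])

lemma measurable_rrad : Measurable rrad :=
  Measurable.ite measurableSet_Ioo (by fun_prop) measurable_const

lemma rrad_mem (t : ℝ) : rrad t ∈ Icc (0:ℝ) 1 := by
  by_cases ht : t ∈ Ioo 0 (Real.exp (-1))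
  · have := rbump_superlevel (n := 0) ht
    exact ⟨this.1.le, this.2.1⟩
  · rw [rrad, if_neg ht]; simp

/-- Auxiliary dimensional constant: normalised mass of `rbump` on hyperplanes. -/
def bumpJ (n : ℕ) : ℝ := ∫ t in Ioi 0, kap n * rrad t ^ (n - 1)

lemma bumpJ_pos (hn : 2 ≤ n) : 0 < bumpJ n := by
  have hk := kap_pos hn
  have hn1 : n - 1 ≠ 0 := by omega
  have h0 : ∀ t, 0 ≤ kap n * rrad t ^ (n - 1) := fun t => mul_nonneg hk.le (pow_nonneg (rrad_mem t).1 _)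
  rw [bumpJ, integral_pos_iff_support_of_nonneg h0]
  · have hsub : Ioo 0 (Real.exp (-1)) ⊆ Function.support fun t => kap n * rrad t ^ (n - 1) := fun t ht =>
      (mul_pos hk (pow_pos (rbump_superlevel (n := 0) ht).1 _)).ne'
    refine lt_of_lt_of_le ?_ (measure_mono hsub)
    rw [Measure.restrict_apply measurableSet_Ioo, inter_eq_left.2 Ioo_subset_Ioi_self]
    simp [Real.exp_pos]
  · have h1 : Integrable (fun t => (Ioo 0 (Real.exp (-1))).indicator (fun _ => kap n) t) (volume.restrict (Ioi 0)) := by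
      refine Integrable.restrict ?_
      rw [integrable_indicator_iff measurableSet_Ioo]
      exact integrableOn_const (by simp)
    refine h1.mono' ((measurable_rrad.pow_const _).const_mul _).aestronglyMeasurable
      (Eventually.of_forall fun t => ?_)
    rw [Real.norm_of_nonneg (h0 t)]
    by_cases ht : t ∈ Ioo 0 (Real.exp (-1))
    · rw [indicator_of_mem ht]
      exact mul_le_of_le_one_right hk.le (pow_le_one₀ (rrad_mem t).1 (rrad_mem t).2)
    · rw [indicator_of_notMem ht, rrad, if_neg ht, zero_pow hn1, mul_zero]

lemma lapl_rbump_eq {z z' : Euc n} (hz : ‖z‖ = ‖z'‖) : lapl rbump z = lapl rbump z' := by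
  have key : ∀ z : Euc n, lapl rbump z = deriv (deriv expNegInvGlue) (1 - ‖z‖ ^ 2) * (4 * ‖z‖ ^ 2)
      + deriv expNegInvGlue (1 - ‖z‖ ^ 2) * (- (2 * n)) := by
    intro z
    have c1 : ContDiffAt ℝ 2 (fun z : Euc n => ‖z‖ ^ 2) z := (contDiff_norm_sq ℝ).contDiffAt
    have h1 : lapl (fun z : Euc n => ‖z‖ ^ 2) z = 2 * n := by simpa using lapl_norm_sq (x := z) (0 : Euc n)
    have h2 : lapl (fun z : Euc n => 1 - ‖z‖ ^ 2) z = - (2 * n) := by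
      rw [lapl_sub contDiffAt_const c1, lapl_const, h1, zero_sub]
    have h3 : fderiv ℝ (fun z : Euc n => 1 - ‖z‖ ^ 2) z = -((2:ℝ) • innerSL ℝ z) := by
      rw [((hasStrictFDerivAt_norm_sq z).hasFDerivAt.const_sub 1).fderiv, two_smul, two_smul]
    have := lapl_comp (θ := expNegInvGlue) expNegInvGlue.contDiff (contDiffAt_const.sub c1 : ContDiffAt ℝ 2 (fun z : Euc n => 1 - ‖z‖ ^ 2) z)
    change lapl (fun z => expNegInvGlue (1 - ‖z‖ ^ 2)) z = _
    rw [this, h2, sum_fderiv_sq, h3, norm_neg, norm_smul, innerSL_apply_norm]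
    norm_num [mul_pow]
  rw [key, key, hz]

/-- The integral of the half-space profile against the Laplacian of `rbump`. -/
def bumpInt (ν : Euc n) : ℝ := ∫ z : Euc n, max (-⟪z, ν⟫) 0 * lapl rbump z

lemma bumpInt_eq {ν ν' : Euc n} (h : ‖ν‖ = ‖ν'‖) : bumpInt ν = bumpInt ν' := by
  set T := (ℝ ∙ (ν - ν'))ᗮ.reflection with hT
  have hTν : T ν = ν' := Submodule.reflection_sub h
  symm
  rw [bumpInt, bumpInt, ← (T.measurePreserving).integral_comp T.toMeasurableEquiv.measurableEmbedding]
  refine integral_congr_ae (Eventually.of_forall fun z => ?_)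
  have h1 : ⟪T z, ν'⟫ = ⟪z, ν⟫ := by rw [← hTν]; exact T.inner_map_map _ _
  simp only [h1, lapl_rbump_eq (T.norm_map z)]

/-- Auxiliary dimensional constant. -/
def bumpI (n : ℕ) : ℝ := if h : ∃ ν : Euc n, ‖ν‖ = 1 then bumpInt h.choose else 0

lemma bumpInt_eq_bumpI {ν : Euc n} (h : ‖ν‖ = 1) : bumpInt ν = bumpI n := by
  have hex : ∃ ν : Euc n, ‖ν‖ = 1 := ⟨ν, h⟩
  rw [bumpI, dif_pos hex]
  exact bumpInt_eq (h.trans hex.choose_spec.symm)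

lemma integral_rescale (g : Euc n → ℝ) (x₀ : Euc n) {r : ℝ} (hr : 0 < r) :
    ∫ z, g (x₀ + r • z) = (r ^ n)⁻¹ * ∫ x, g x := by
  have h1 := Measure.integral_comp_smul (volume : Measure (Euc n)) (fun x => g (x₀ + x)) r
  rw [h1, integral_add_left_eq_self, finrank_euclideanSpace_fin, abs_of_pos (by positivity), smul_eq_mul]

namespace IsTorMeasure

variable {Ω : Set (Euc n)} {u : Euc n → ℝ} {σ : Measure (Euc n)}

/-- `rbump` rescaled to the ball of radius `r` about `x₀`. -/
lemma green_rbump (hσ : IsTorMeasure Ω u σ) (h : Tor Ω u) (x₀ : Euc n) {r : ℝ} (hr : 0 < r) :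
    |(∫ x, rbump (-(r⁻¹ • x₀) + r⁻¹ • x) ∂σ) / r ^ (n - 1) - ∫ z, blow u x₀ r z * lapl rbump z| ≤
      2 * r * volume.real (closedBall (0 : Euc n) 1) := by
  have hn := h.pos_n
  have hr4 : r ^ n = r ^ (n - 1) * r := by rw [← pow_succ]; congr 1; omega
  have harg : ∀ z : Euc n, -(r⁻¹ • x₀) + r⁻¹ • (x₀ + r • z) = z := fun z => by
    rw [smul_add, smul_smul, inv_mul_cancel₀ hr.ne']; simp
  have h1 := hσ.green (fun x => rbump (-(r⁻¹ • x₀) + r⁻¹ • x)) (rbump_contDiff.comp (by fun_prop))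
  have h2 : ∀ x, lapl (fun x => rbump (-(r⁻¹ • x₀) + r⁻¹ • x)) x = (r⁻¹) ^ 2 * lapl rbump (-(r⁻¹ • x₀) + r⁻¹ • x) :=
    fun x => lapl_comp_affine _ _ _ rbump_contDiff.contDiffAt
  simp only [h2] at h1
  have h3 := integral_rescale (fun x => u x * ((r⁻¹) ^ 2 * lapl rbump (-(r⁻¹ • x₀) + r⁻¹ • x))) x₀ hr
  simp only [harg] at h3
  have h4 : ∫ z, u (x₀ + r • z) * ((r⁻¹) ^ 2 * lapl rbump z) = r⁻¹ * ∫ z, blow u x₀ r z * lapl rbump z := by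
    rw [← integral_const_mul]
    congr 1; ext z; rw [blow]; ring
  have h5 := integral_rescale (fun x => rbump (-(r⁻¹ • x₀) + r⁻¹ • x)) x₀ hr
  simp only [harg] at h5
  have h6 : ∫ z : Euc n, rbump z ≤ volume.real (closedBall (0 : Euc n) 1) := by
    rw [← integral_indicator_one measurableSet_closedBall]
    refine integral_mono_of_nonneg (Eventually.of_forall rbump_nonneg) ?_ (Eventually.of_forall fun z => ?_)
    · rw [integrable_indicator_iff measurableSet_closedBall]
      exact integrableOn_const (measure_closedBall_lt_top.ne)
    · by_cases hz : z ∈ closedBall (0 : Euc n) 1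
      · rw [indicator_of_mem hz]; exact rbump_le_one z
      · rw [indicator_of_notMem hz, rbump_zero hz]
  have h7 : 0 ≤ ∫ x in Ω, rbump (-(r⁻¹ • x₀) + r⁻¹ • x) := integral_nonneg fun _ => rbump_nonneg _
  have h8 : ∫ x in Ω, rbump (-(r⁻¹ • x₀) + r⁻¹ • x) ≤ r ^ n * volume.real (closedBall (0 : Euc n) 1) := by
    rw [eq_inv_mul_iff_mul_eq₀ (by positivity)] at h5
    refine (setIntegral_le_integral ?_ (Eventually.of_forall fun z => rbump_nonneg _)).trans ?_
    · refine Continuous.integrable_of_hasCompactSupport (rbump_contDiff.continuous.comp (by fun_prop)) ?_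
      refine HasCompactSupport.intro (isCompact_closedBall x₀ r) fun x hx => rbump_zero ?_
      rw [mem_closedBall_iff_norm, not_le] at hx
      rw [mem_closedBall_zero_iff, not_le, show -(r⁻¹ • x₀) + r⁻¹ • x = r⁻¹ • (x - x₀) by rw [smul_sub]; abel, norm_smul,
        norm_inv, Real.norm_of_nonneg hr.le, ← div_eq_inv_mul, one_lt_div hr]
      exact hx
    · rw [← h5]; gcongr
  rw [h4, eq_inv_mul_iff_mul_eq₀ (by positivity)] at h3
  rw [h1, ← h3, hr4, add_div, show r ^ (n - 1) * r * (r⁻¹ * ∫ z, blow u x₀ r z * lapl rbump z) / r ^ (n - 1) =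
    ∫ z, blow u x₀ r z * lapl rbump z by field_simp, add_sub_cancel_left, abs_of_nonneg (by positivity),
    div_le_iff₀ (by positivity)]
  rw [hr4] at h8
  linarith

lemma tendsto_rbump (hσ : IsTorMeasure Ω u σ) (h : Tor Ω u) {x₀ : Euc n} (hx₀ : x₀ ∉ Ω) {θ : ℝ}
    (hθ : Tendsto (fun r => σ.real (closedBall x₀ r) / r ^ (n - 1)) (𝓝[>] 0) (𝓝 (θ * kap n))) :
    Tendsto (fun r => (∫ x, rbump (-(r⁻¹ • x₀) + r⁻¹ • x) ∂σ) / r ^ (n - 1)) (𝓝[>] 0) (𝓝 (θ * bumpJ n)) := by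
  have := hσ.finite
  obtain ⟨C, hC, hg⟩ := hσ.growth h
  have hn1 : n - 1 ≠ 0 := by have := h.hn; omega
  have hset : ∀ r > 0, ∀ t ∈ Ioo 0 (Real.exp (-1)), {x | t ≤ rbump (-(r⁻¹ • x₀) + r⁻¹ • x)} = closedBall x₀ (r * rrad t) := by
    intro r hr t ht
    ext x
    have h1 := (Set.ext_iff.1 (rbump_superlevel (n := n) ht).2.2) (-(r⁻¹ • x₀) + r⁻¹ • x)
    rw [mem_ofPred_eq] at h1 ⊢
    rw [h1, mem_closedBall_zero_iff, mem_closedBall_iff_norm, show -(r⁻¹ • x₀) + r⁻¹ • x = r⁻¹ • (x - x₀) by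
      rw [smul_sub]; abel, norm_smul, norm_inv, Real.norm_of_nonneg hr.le, inv_mul_le_iff₀ hr]
  have hempty : ∀ r : ℝ, ∀ t, Real.exp (-1) < t → {x | t ≤ rbump (-(r⁻¹ • x₀) + r⁻¹ • x)} = ∅ := by
    intro r t ht
    ext x
    simpa using rbump_superlevel_empty ht _
  have hlc : ∀ r > 0, (∫ x, rbump (-(r⁻¹ • x₀) + r⁻¹ • x) ∂σ) / r ^ (n - 1) =
      ∫ t in Ioi 0, σ.real {x | t ≤ rbump (-(r⁻¹ • x₀) + r⁻¹ • x)} / r ^ (n - 1) := by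
    intro r hr
    rw [Integrable.integral_eq_integral_meas_le, integral_div]
    · refine Integrable.of_bound (rbump_contDiff.continuous.comp (by fun_prop)).aestronglyMeasurable 1
        (Eventually.of_forall fun z => ?_)
      rw [Real.norm_of_nonneg (rbump_nonneg _)]; exact rbump_le_one _
    · exact Eventually.of_forall fun z => rbump_nonneg _
  have hae : ∀ᵐ t ∂(volume.restrict (Ioi (0:ℝ))), t ∈ Ioo 0 (Real.exp (-1)) ∨ Real.exp (-1) < t := by
    have h1 : ∀ᵐ t ∂(volume.restrict (Ioi (0:ℝ))), t ≠ Real.exp (-1) :=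
      ae_restrict_of_ae (by simp [ae_iff])
    filter_upwards [h1, ae_restrict_mem measurableSet_Ioi] with t h1 h2
    rcases lt_or_gt_of_ne h1 with h | h
    exacts [.inl ⟨h2, h⟩, .inr h]
  rw [bumpJ, ← integral_const_mul]
  have hlim : Tendsto (fun r => ∫ t in Ioi 0, σ.real {x | t ≤ rbump (-(r⁻¹ • x₀) + r⁻¹ • x)} / r ^ (n - 1)) (𝓝[>] 0)
      (𝓝 (∫ t in Ioi 0, θ * (kap n * rrad t ^ (n - 1)))) := by
    refine tendsto_integral_filter_of_dominated_convergence
      (fun t => (Ioo 0 (Real.exp (-1))).indicator (fun _ => C) t) ?_ ?_ ?_ ?_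
    · refine Eventually.of_forall fun r => Measurable.aestronglyMeasurable ?_
      refine Measurable.div_const (Measurable.ennreal_toReal ?_) _
      exact Antitone.measurable (fun _ _ hst => measure_mono (fun _ h => le_trans hst h))
    · filter_upwards [Ioo_mem_nhdsGT one_pos] with r hr
      filter_upwards [hae] with t ht
      rw [Real.norm_of_nonneg (div_nonneg measureReal_nonneg (pow_nonneg hr.1.le _))]
      rcases ht with ht | ht
      · rw [indicator_of_mem ht, hset r hr.1 t ht, div_le_iff₀ (pow_pos hr.1 _)]
        obtain ⟨p1, p2, -⟩ := rbump_superlevel (n := n) ht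
        refine (measureReal_mono (closedBall_subset_closedBall ?_)).trans (hg x₀ hx₀ r hr.1 hr.2.le)
        exact mul_le_of_le_one_right hr.1.le p2
      · rw [hempty r t ht, indicator_of_notMem (fun h => by linarith [h.2])]
        simp
    · refine Integrable.restrict ?_
      rw [integrable_indicator_iff measurableSet_Ioo]
      exact integrableOn_const (by simp)
    · filter_upwards [hae] with t ht
      rcases ht with ht | ht
      · obtain ⟨p1, p2, -⟩ := rbump_superlevel (n := n) ht
        have h1 : Tendsto (fun r : ℝ => r * rrad t) (𝓝[>] 0) (𝓝[>] 0) := by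
          refine tendsto_nhdsWithin_iff.2 ⟨tendsto_nhdsWithin_of_tendsto_nhds ?_, ?_⟩
          · simpa using (Continuous.tendsto (f := fun r : ℝ => r * rrad t) (by fun_prop) 0)
          · filter_upwards [self_mem_nhdsWithin] with r hr using mul_pos hr p1
        have h2 := (hθ.comp h1).mul_const (rrad t ^ (n - 1))
        rw [mul_assoc] at h2
        refine h2.congr' ?_
        filter_upwards [self_mem_nhdsWithin] with r hr
        rw [hset r hr t ht, Function.comp_apply, mul_pow]
        have : r ≠ 0 := (mem_Ioi.1 hr).ne'
        field_simp
      · rw [rrad, if_neg (fun h => by linarith [h.2]), zero_pow hn1, mul_zero, mul_zero]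
        simp [hempty _ t ht]
  refine hlim.congr' ?_
  filter_upwards [self_mem_nhdsWithin] with r hr using (hlc r hr).symm

end IsTorMeasure

end

section

/-- The surface measure of the boundary of `Ω`. -/
abbrev bdryMeasure (Ω : Set (Euc n)) : Measure (Euc n) := (μH[(n:ℝ) - 1] : Measure (Euc n)).restrict (frontier Ω)

/-- Auxiliary dimensional constant. -/
def gam (n : ℕ) : ℝ := bumpI n / bumpJ n

namespace IsTorMeasure

variable {Ω : Set (Euc n)} {u : Euc n → ℝ} {σ : Measure (Euc n)} {x₀ ν : Euc n} {U : Euc n → ℝ} {l : Filter ℝ} {θ : ℝ}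

lemma mul_bumpI (hσ : IsTorMeasure Ω u σ) (h : Tor Ω u) (hx : IsUniqueNormal Ω x₀ ν) [l.NeBot] (hl : l ≤ 𝓝[>] 0)
    (hU : ∀ z, Tendsto (fun r => blow u x₀ r z) l (𝓝 (U z)))
    (hθ : Tendsto (fun r => σ.real (closedBall x₀ r) / r ^ (n - 1)) (𝓝[>] 0) (𝓝 (θ * kap n))) :
    U (-ν) * bumpI n = θ * bumpJ n := by
  obtain ⟨C, hC⟩ := h.exists_lipschitz
  have hpos : ∀ᶠ r in l, 0 < r := hl self_mem_nhdsWithin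
  obtain ⟨hUL, hunif⟩ := tendsto_unif_of_lipschitz (hpos.mono fun r hr => blow_lipschitz hC x₀ hr) hU
  have hlc : Continuous (lapl (rbump (n := n))) := continuous_lapl rbump_contDiff
  have hls : HasCompactSupport (lapl (rbump (n := n))) := hasCompactSupport_lapl rbump_hasCompactSupport
  have hInt : ∀ f : Euc n → ℝ, Continuous f → Integrable (fun z => f z * lapl rbump z) := fun f hf =>
    (hf.mul hlc).integrable_of_hasCompactSupport hls.mul_left
  have h1 : Tendsto (fun r => ∫ z, blow u x₀ r z * lapl rbump z) l (𝓝 (∫ z, U z * lapl rbump z)) := by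
    rw [Metric.tendsto_nhds]
    intro ε hε
    set A := ∫ z : Euc n, ‖lapl rbump z‖ with hA
    have hA0 : 0 ≤ A := integral_nonneg fun _ => norm_nonneg _
    filter_upwards [hunif _ (isCompact_closedBall 0 1) (ε / (A + 1)) (by positivity), hpos] with r hr hr0
    rw [dist_eq_norm, ← integral_sub (hInt _ (blow_lipschitz hC x₀ hr0).continuous) (hInt _ hUL.continuous)]
    calc _ ≤ ∫ z, (ε / (A + 1)) * ‖lapl rbump z‖ := by
          refine norm_integral_le_of_norm_le ?_ (Eventually.of_forall fun z => ?_)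
          · exact ((hlc.integrable_of_hasCompactSupport hls).norm).const_mul _
          · rw [← sub_mul, norm_mul]
            by_cases hz : z ∈ closedBall (0 : Euc n) 1
            · have := hr z hz
              rw [← Real.norm_eq_abs] at this
              gcongr
            · rw [lapl_rbump_zero hz]; simp
      _ = ε * (A / (A + 1)) := by rw [integral_const_mul, ← hA]; ring
      _ < ε * 1 := by
          gcongr
          rw [div_lt_one (by positivity)]; linarith
      _ = ε := mul_one _
  have h2 : Tendsto (fun r => (∫ x, rbump (-(r⁻¹ • x₀) + r⁻¹ • x) ∂σ) / r ^ (n - 1)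
      - ∫ z, blow u x₀ r z * lapl rbump z) l (𝓝 0) := by
    have h3 : Tendsto (fun r : ℝ => 2 * r * volume.real (closedBall (0 : Euc n) 1)) l (𝓝 0) := by
      have : Tendsto (fun r : ℝ => 2 * r * volume.real (closedBall (0 : Euc n) 1)) (𝓝 0) (𝓝 (2 * 0 * volume.real (closedBall (0 : Euc n) 1))) :=
        Continuous.tendsto (by fun_prop) 0
      rw [mul_zero, zero_mul] at this
      exact this.mono_left (hl.trans nhdsWithin_le_nhds)
    refine squeeze_zero_norm' ?_ h3
    filter_upwards [hpos] with r hr using hσ.green_rbump h x₀ hr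
  have h3 := ((hσ.tendsto_rbump h (h.frontier_not_mem hx.mem) hθ).mono_left hl).sub h1
  have h4 := tendsto_nhds_unique h3 h2
  have h5 : ∫ z, U z * lapl rbump z = U (-ν) * bumpI n := by
    rw [← bumpInt_eq_bumpI hx.normal.1, bumpInt, ← integral_const_mul]
    congr 1; ext z
    rw [h.blow_eq hx hl hU z, mul_assoc]
  linarith

end IsTorMeasure

namespace Tor

variable {Ω : Set (Euc n)} {u : Euc n → ℝ} {x₀ ν : Euc n}

lemma exists_ultrafilter_blow (h : Tor Ω u) (hx : x₀ ∉ Ω) (𝒰 : Ultrafilter ℝ) (h𝒰 : ↑𝒰 ≤ 𝓝[>] (0:ℝ)) :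
    ∃ U : Euc n → ℝ, ∀ z, Tendsto (fun r => blow u x₀ r z) 𝒰 (𝓝 (U z)) := by
  obtain ⟨C, hC⟩ := h.exists_lipschitz
  have : ∀ z, ∃ a, Tendsto (fun r => blow u x₀ r z) 𝒰 (𝓝 a) := by
    intro z
    obtain ⟨a, -, ha⟩ := (isCompact_Icc (a := -(C * ‖z‖)) (b := C * ‖z‖)).ultrafilter_le_nhds
      (𝒰.map fun r => blow u x₀ r z) (by
        rw [Ultrafilter.coe_map, le_principal_iff, mem_map]
        refine h𝒰 ?_
        filter_upwards [self_mem_nhdsWithin] with r hr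
        have h1 := (blow_lipschitz hC x₀ hr).dist_le_mul z 0
        rw [dist_zero_right, Real.dist_eq, show blow u x₀ r 0 = 0 by simp [blow, h.zero _ hx], sub_zero] at h1
        exact abs_le.1 h1)
    exact ⟨a, ha⟩
  choose U hU using this
  exact ⟨U, hU⟩

lemma isFiniteMeasure_bdry (h : Tor Ω u) : IsFiniteMeasure (bdryMeasure Ω) :=
  ⟨by simpa using h.hausdorff_frontier_lt_top⟩

end Tor

namespace IsTorMeasure

variable {Ω : Set (Euc n)} {u : Euc n → ℝ} {σ : Measure (Euc n)} {x₀ ν : Euc n}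

lemma measure_univ (hσ : IsTorMeasure Ω u σ) : σ.real univ = 2 * volume.real Ω := by
  have := hσ.green (fun _ => 1) contDiff_const
  simpa [lapl_const] using this

lemma absolutelyContinuous (hσ : IsTorMeasure Ω u σ) (h : Tor Ω u) : σ ≪ bdryMeasure Ω := by
  obtain ⟨C, hC⟩ := hσ.le_hausdorff h
  exact (Measure.absolutelyContinuous_of_le hC).trans (Measure.smul_absolutelyContinuous)

lemma ae_density (hσ : IsTorMeasure Ω u σ) (h : Tor Ω u) : ∀ᵐ x₀ ∂bdryMeasure Ω,
    Tendsto (fun r => σ.real (closedBall x₀ r) / r ^ (n - 1)) (𝓝[>] 0)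
      (𝓝 ((σ.rnDeriv (bdryMeasure Ω) x₀).toReal * kap n)) := by
  have := hσ.finite
  have := h.isFiniteMeasure_bdry
  filter_upwards [Besicovitch.ae_tendsto_rnDeriv σ (bdryMeasure Ω), h.exists_uniqueNormal,
    Measure.rnDeriv_lt_top σ (bdryMeasure Ω)] with x₀ h1 ⟨ν, hν⟩ h2
  have h3 := (ENNReal.tendsto_toReal h2.ne).comp h1
  have hk := kap_pos h.hn
  have h4 := h.tendsto_hausdorff_ball hν
  refine (h3.mul h4).congr' ?_
  filter_upwards [h4.eventually (lt_mem_nhds hk), self_mem_nhdsWithin] with r hr hr0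
  have e : (μH[(n:ℝ) - 1] : Measure (Euc n)).real (frontier Ω ∩ closedBall x₀ r) = (bdryMeasure Ω).real (closedBall x₀ r) := by
    rw [measureReal_def, measureReal_def, Measure.restrict_apply measurableSet_closedBall, inter_comm]
  rw [e] at hr ⊢
  have hne : (bdryMeasure Ω).real (closedBall x₀ r) ≠ 0 := fun h0 => by simp [h0] at hr
  have : r ≠ 0 := (mem_Ioi.1 hr0).ne'
  rw [Function.comp_apply, ENNReal.toReal_div]
  change σ.real _ / (bdryMeasure Ω).real _ * _ = _
  field_simp

lemma gam_pos (hσ : IsTorMeasure Ω u σ) (h : Tor Ω u) : 0 < gam n := by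
  have := hσ.finite
  have := h.isFiniteMeasure_bdry
  have hJ := bumpJ_pos h.hn
  rw [gam]
  refine div_pos ?_ hJ
  by_contra hI
  have hz : ∀ᵐ x₀ ∂bdryMeasure Ω, σ.rnDeriv (bdryMeasure Ω) x₀ = 0 := by
    filter_upwards [hσ.ae_density h, h.exists_uniqueNormal, Measure.rnDeriv_lt_top σ (bdryMeasure Ω)] with x₀ h1 ⟨ν, hν⟩ h2
    have hnb : (𝓝[>] (0:ℝ)).NeBot := inferInstance
    obtain ⟨U, hU⟩ := h.exists_ultrafilter_blow (h.frontier_not_mem hν.mem) (Ultrafilter.of (𝓝[>] (0:ℝ))) (Ultrafilter.of_le _)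
    have h3 := hσ.mul_bumpI h hν (Ultrafilter.of_le _) hU h1
    have h4 : 0 ≤ U (-ν) := ge_of_tendsto (hU (-ν)) (by
      have : ∀ᶠ r in 𝓝[>] (0:ℝ), 0 ≤ blow u x₀ r (-ν) := by
        filter_upwards [self_mem_nhdsWithin] with r hr
        exact mul_nonneg (inv_nonneg.2 (le_of_lt hr)) (h.nonneg _)
      exact Ultrafilter.of_le _ this)
    have h5 : (σ.rnDeriv (bdryMeasure Ω) x₀).toReal = 0 := by
      have := ENNReal.toReal_nonneg (a := σ.rnDeriv (bdryMeasure Ω) x₀)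
      nlinarith [mul_nonneg h4 (neg_nonneg.2 (not_lt.1 hI))]
    exact (ENNReal.toReal_eq_zero_iff _).1 h5 |>.resolve_right h2.ne
  have h0 : σ univ = 0 := by
    have : σ.HaveLebesgueDecomposition (bdryMeasure Ω) := Measure.haveLebesgueDecomposition_of_sigmaFinite _ _
    rw [← Measure.withDensity_rnDeriv_eq σ (bdryMeasure Ω) (hσ.absolutelyContinuous h), withDensity_apply _ MeasurableSet.univ,
      lintegral_congr_ae (ae_restrict_of_ae hz)]
    simp
  have h1 := hσ.measure_univ
  rw [measureReal_def, h0] at h1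
  have h2 : 0 < volume.real Ω := ENNReal.toReal_pos (h.isOpen.measure_pos _ h.nonempty).ne' h.bdd.measure_lt_top.ne
  simp at h1
  linarith

/-- At almost every boundary point the blow-ups converge, and the slope is the density of `σ` up to a
universal constant. -/
lemma exists_blow_limit (hσ : IsTorMeasure Ω u σ) (h : Tor Ω u) : ∀ᵐ x₀ ∂bdryMeasure Ω, ∃ ν, IsUniqueNormal Ω x₀ ν ∧
    ∃ c : ℝ, 0 ≤ c ∧ (∀ z, Tendsto (fun r => blow u x₀ r z) (𝓝[>] 0) (𝓝 (c * max (-⟪z, ν⟫) 0))) ∧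
      σ.rnDeriv (bdryMeasure Ω) x₀ = ENNReal.ofReal (gam n * c) := by
  have := hσ.finite
  have := h.isFiniteMeasure_bdry
  have hg := hσ.gam_pos h
  have hJ := bumpJ_pos h.hn
  have hI : bumpI n = gam n * bumpJ n := by rw [gam]; field_simp
  filter_upwards [hσ.ae_density h, h.exists_uniqueNormal, Measure.rnDeriv_lt_top σ (bdryMeasure Ω)] with x₀ h1 ⟨ν, hν⟩ h2
  refine ⟨ν, hν, (σ.rnDeriv (bdryMeasure Ω) x₀).toReal / gam n, by positivity, fun z => ?_, ?_⟩
  · rw [tendsto_iff_ultrafilter]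
    intro 𝒰 h𝒰
    obtain ⟨U, hU⟩ := h.exists_ultrafilter_blow (h.frontier_not_mem hν.mem) 𝒰 h𝒰
    have h3 := hσ.mul_bumpI h hν h𝒰 hU h1
    have h4 : U (-ν) = (σ.rnDeriv (bdryMeasure Ω) x₀).toReal / gam n := by
      rw [hI] at h3
      field_simp at h3 ⊢
      exact h3
    rw [← h4, ← h.blow_eq hν h𝒰 hU z]
    exact hU z
  · rw [mul_div_cancel₀ _ hg.ne', ENNReal.ofReal_toReal h2.ne]

end IsTorMeasure

end

section

lemma infDist_frontier_le {Ω : Set (Euc n)} (ho : IsOpen Ω) {y w : Euc n} (hy : y ∈ Ω) (hw : w ∉ Ω) :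
    infDist y (frontier Ω) ≤ dist y w := by
  obtain ⟨t, ht, hm⟩ := exists_mem_frontier_segment ho (a := w) (d := y - w) zero_le_one hw (by simpa using hy)
  refine (infDist_le_dist_of_mem hm).trans ?_
  rw [dist_eq_norm, dist_eq_norm, show y - (w + t • (y - w)) = (1 - t) • (y - w) by module, norm_smul,
    Real.norm_of_nonneg (by linarith [ht.2])]
  exact mul_le_of_le_one_left (norm_nonneg _) (by linarith [ht.1])

namespace Tor

variable {Ω : Set (Euc n)} {u : Euc n → ℝ} {x₀ ν : Euc n}

lemma grad_ineq (h : Tor Ω u) {y y' : Euc n} (hy : y ∈ Ω) (hy' : y' ∈ closure Ω) :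
    2 * √(u y) * (√(u y') - √(u y)) ≤ fderiv ℝ u y (y' - y) := by
  have h1 := ((h.smooth y hy).differentiableAt (by norm_num)).hasFDerivAt.hasLineDerivAt (y' - y)
  have h2 := h1.tendsto_slope_zero_right
  refine ge_of_tendsto h2 ?_
  filter_upwards [Ioo_mem_nhdsGT one_pos] with t ht
  have h3 := h.concaveOn_sqrt.2 (subset_closure hy) hy' (show (0:ℝ) ≤ 1 - t by linarith [ht.2]) ht.1.le (by ring)
  simp only [smul_eq_mul] at h3
  rw [show (1 - t) • y + t • y' = y + t • (y' - y) by module] at h3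
  set a := √(u y) with ha
  set b := √(u y') with hb
  have ha0 : 0 ≤ a := Real.sqrt_nonneg _
  have hb0 : 0 ≤ b := Real.sqrt_nonneg _
  have hau : u y = a ^ 2 := (Real.sq_sqrt (h.nonneg y)).symm
  have hbu : u (y + t • (y' - y)) = (√(u (y + t • (y' - y)))) ^ 2 := (Real.sq_sqrt (h.nonneg _)).symm
  have h4 : 0 ≤ (1 - t) * a + t * b :=
    add_nonneg (mul_nonneg (by linarith [ht.2]) ha0) (mul_nonneg ht.1.le hb0)
  have h5 := pow_le_pow_left₀ h4 h3 2
  rw [← hbu] at h5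
  rw [smul_eq_mul, hau, ← div_eq_inv_mul, le_div_iff₀ ht.1]
  nlinarith [sq_nonneg (t * (b - a))]

lemma ray_mem_ntCone (h : Tor Ω u) {p : Euc n} {ρ : ℝ} (hρ : 0 < ρ) (hB : ball p ρ ⊆ Ω) (hx : x₀ ∈ frontier Ω)
    {t : ℝ} (ht : t ∈ Ioc (0:ℝ) 1) : x₀ + t • (p - x₀) ∈ ntCone Ω x₀ (‖p - x₀‖ / ρ) := by
  have hball : ball (x₀ + t • (p - x₀)) (t * ρ) ⊆ Ω := by
    intro y hy
    rw [← h.isOpen.interior_eq]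
    have h1 : p + t⁻¹ • (y - (x₀ + t • (p - x₀))) ∈ Ω := hB (by
      rw [mem_ball_iff_norm, add_sub_cancel_left, norm_smul, norm_inv, Real.norm_of_nonneg ht.1.le,
        inv_mul_lt_iff₀ ht.1]
      exact mem_ball_iff_norm.1 hy)
    have := h.convex.combo_closure_interior_mem_interior (frontier_subset_closure hx)
      (by rwa [h.isOpen.interior_eq] : _ ∈ interior Ω) (show (0:ℝ) ≤ 1 - t by linarith [ht.2]) ht.1 (by ring)
    convert this using 1
    rw [smul_add, smul_smul, mul_inv_cancel₀ ht.1.ne']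
    module
  have hmem : x₀ + t • (p - x₀) ∈ Ω := hball (mem_ball_self (mul_pos ht.1 hρ))
  refine ⟨hmem, ?_⟩
  have h2 : t * ρ ≤ infDist (x₀ + t • (p - x₀)) (frontier Ω) := by
    rw [le_infDist ⟨x₀, hx⟩]
    intro y hy
    by_contra hcon
    exact h.frontier_not_mem hy (hball (by rw [mem_ball, dist_comm]; exact not_le.1 hcon))
  rw [dist_eq_norm, add_sub_cancel_left, norm_smul, Real.norm_of_nonneg ht.1.le]
  have h3 : 0 ≤ ‖p - x₀‖ / ρ := by positivity
  calc t * ‖p - x₀‖ = ‖p - x₀‖ / ρ * (t * ρ) := by field_simp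
    _ ≤ (1 + ‖p - x₀‖ / ρ) * infDist (x₀ + t • (p - x₀)) (frontier Ω) := by
      have h4 := mul_pos ht.1 hρ
      exact mul_le_mul (by linarith) h2 h4.le (by linarith)

lemma norm_fderiv_le {C : ℝ≥0} (hC : LipschitzWith C u) (y : Euc n) : ‖fderiv ℝ u y‖ ≤ C :=
  norm_fderiv_le_of_lipschitz ℝ hC

/-- At a boundary point where the blow-ups converge, the gradient has a nontangential limit. -/
lemma hasNTLimit (h : Tor Ω u) (hx : IsUniqueNormal Ω x₀ ν) {c : ℝ} (hc : 0 ≤ c)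
    (hblow : ∀ z, Tendsto (fun r => blow u x₀ r z) (𝓝[>] 0) (𝓝 (c * max (-⟪z, ν⟫) 0))) :
    HasNTLimitAt Ω (gradient u) x₀ (-(c • ν)) := by
  intro α hα
  obtain ⟨C, hC⟩ := h.exists_lipschitz
  have hν := hx.normal.1
  have hx₀ := h.frontier_not_mem hx.mem
  rw [tendsto_iff_ultrafilter]
  intro 𝒰 h𝒰
  have hmem : ∀ᶠ y in (𝒰 : Filter (Euc n)), y ∈ ntCone Ω x₀ α := h𝒰 self_mem_nhdsWithin
  have hx𝒰 : Tendsto (fun y => y) (𝒰 : Filter (Euc n)) (𝓝 x₀) := h𝒰.trans nhdsWithin_le_nhds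
  have hr : Tendsto (fun y => ‖y - x₀‖) (𝒰 : Filter (Euc n)) (𝓝[>] 0) := by
    refine tendsto_nhdsWithin_iff.2 ⟨?_, ?_⟩
    · have := (hx𝒰.sub_const x₀).norm
      simpa using this
    · filter_upwards [hmem] with y hy
      exact norm_pos_iff.2 (sub_ne_zero.2 fun he => hx₀ (he ▸ hy.1))
  have hr0 : ∀ᶠ y in (𝒰 : Filter (Euc n)), 0 < ‖y - x₀‖ := hr self_mem_nhdsWithin
  obtain ⟨z, hz1, hz⟩ : ∃ z ∈ closedBall (0 : Euc n) 1, Tendsto (fun y => ‖y - x₀‖⁻¹ • (y - x₀)) 𝒰 (𝓝 z) :=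
    (isCompact_closedBall (0 : Euc n) 1).ultrafilter_le_nhds (𝒰.map fun y => ‖y - x₀‖⁻¹ • (y - x₀)) (by
      rw [Ultrafilter.coe_map, le_principal_iff, mem_map]
      filter_upwards [hr0] with y hy
      rw [mem_preimage, mem_closedBall_zero_iff, norm_smul, norm_inv, norm_norm, inv_mul_cancel₀ hy.ne'])
  obtain ⟨G, -, hG⟩ : ∃ G ∈ closedBall (0 : Euc n) C, Tendsto (fun y => gradient u y) 𝒰 (𝓝 G) :=
    (isCompact_closedBall (0 : Euc n) C).ultrafilter_le_nhds (𝒰.map fun y => gradient u y) (by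
      rw [Ultrafilter.coe_map, le_principal_iff, mem_map]
      refine Eventually.of_forall fun y => ?_
      change gradient u y ∈ closedBall (0 : Euc n) C
      rw [mem_closedBall_zero_iff, gradient, LinearIsometryEquiv.norm_map]
      exact norm_fderiv_le hC y)
  have hzν : ⟪z, ν⟫ ≤ -(1 + α)⁻¹ := by
    have h1 : Tendsto (fun y => ⟪‖y - x₀‖⁻¹ • (y - x₀), ν⟫) 𝒰 (𝓝 ⟪z, ν⟫) := hz.inner tendsto_const_nhds
    refine le_of_tendsto h1 ?_
    filter_upwards [hmem, hr0] with y hy hy0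
    have h2 := hy.2
    have hw : y + ⟪x₀ - y, ν⟫ • ν ∉ Ω := fun hm => by
      have h4 := h.inner_lt hx.normal hm
      rw [inner_add_left, inner_smul_left, inner_sub_left, real_inner_self_eq_norm_sq, hν] at h4
      simp at h4
    have h3 := infDist_frontier_le h.isOpen hy.1 hw
    have h5 := h.inner_lt hx.normal hy.1
    rw [dist_eq_norm, sub_add_cancel_left, norm_neg, norm_smul, hν, mul_one, inner_sub_left,
      Real.norm_of_nonneg (by linarith)] at h3
    rw [inner_smul_left, inner_sub_left]
    simp only [conj_trivial]
    rw [dist_eq_norm] at h2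
    have h6 : ‖y - x₀‖ ≤ (1 + α) * (⟪x₀, ν⟫ - ⟪y, ν⟫) := h2.trans (by gcongr)
    rw [inv_mul_le_iff₀ hy0]
    have h7 : (1 + α)⁻¹ * ‖y - x₀‖ ≤ ⟪x₀, ν⟫ - ⟪y, ν⟫ := by rwa [inv_mul_le_iff₀ (by positivity)]
    linarith
  set s := -⟪z, ν⟫ with hs
  have hs0 : 0 < s := by have : 0 < (1 + α)⁻¹ := by positivity
                         linarith
  have hblz : Tendsto (fun y => blow u x₀ ‖y - x₀‖ (‖y - x₀‖⁻¹ • (y - x₀))) 𝒰 (𝓝 (c * s)) := by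
    have h1 := (hblow z).comp hr
    rw [max_eq_left hs0.le] at h1
    have h2 : Tendsto (fun y => blow u x₀ ‖y - x₀‖ (‖y - x₀‖⁻¹ • (y - x₀)) - blow u x₀ ‖y - x₀‖ z) 𝒰 (𝓝 0) := by
      have h3 : Tendsto (fun y => (C:ℝ) * dist (‖y - x₀‖⁻¹ • (y - x₀)) z) 𝒰 (𝓝 (C * 0)) :=
        (tendsto_iff_dist_tendsto_zero.1 hz).const_mul _
      rw [mul_zero] at h3
      refine squeeze_zero_norm' ?_ h3
      filter_upwards [hr0] with y hy
      exact (blow_lipschitz hC x₀ hy).dist_le_mul _ _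
    simpa using h2.add h1
  have key : ∀ z' : Euc n, ⟪z', ν⟫ < 0 → 2 * √(c * s) * (√(c * (-⟪z', ν⟫)) - √(c * s)) ≤ ⟪G, z' - z⟫ := by
    intro z' hz'
    obtain ⟨r₀, hr₀, hcone⟩ := h.exists_cone_mem hx (isCompact_singleton (x := z')) (by
      rintro w rfl; exact hz')
    have l1 : Tendsto (fun y => ⟪gradient u y, z' - ‖y - x₀‖⁻¹ • (y - x₀)⟫) 𝒰 (𝓝 ⟪G, z' - z⟫) :=
      hG.inner (tendsto_const_nhds.sub hz)
    have l2 : Tendsto (fun y => √(blow u x₀ ‖y - x₀‖ (‖y - x₀‖⁻¹ • (y - x₀)))) 𝒰 (𝓝 (√(c * s))) :=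
      (Real.continuous_sqrt.tendsto _).comp hblz
    have l3 : Tendsto (fun y => √(blow u x₀ ‖y - x₀‖ z')) 𝒰 (𝓝 (√(c * (-⟪z', ν⟫)))) := by
      have := (hblow z').comp hr
      rw [max_eq_left (by linarith)] at this
      exact (Real.continuous_sqrt.tendsto _).comp this
    refine le_of_tendsto_of_tendsto ((l2.const_mul 2).mul (l3.sub l2)) l1 ?_
    filter_upwards [hmem, hr (Ioc_mem_nhdsGT hr₀)] with y hy hyr
    have hy0 : 0 < ‖y - x₀‖ := hyr.1
    have h1 := h.grad_ineq hy.1 (subset_closure (hcone z' rfl _ hyr))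
    have h2 : x₀ + ‖y - x₀‖ • ‖y - x₀‖⁻¹ • (y - x₀) = y := by
      rw [smul_smul, mul_inv_cancel₀ hy0.ne', one_smul, add_sub_cancel]
    have h3 : x₀ + ‖y - x₀‖ • z' - y = ‖y - x₀‖ • (z' - ‖y - x₀‖⁻¹ • (y - x₀)) := by
      rw [smul_sub, smul_smul, mul_inv_cancel₀ hy0.ne', one_smul]; abel
    have h4 : fderiv ℝ u y (z' - ‖y - x₀‖⁻¹ • (y - x₀)) = ⟪gradient u y, z' - ‖y - x₀‖⁻¹ • (y - x₀)⟫ := by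
      rw [gradient, InnerProductSpace.toDual_symm_apply]
    rw [h3, map_smul, smul_eq_mul, h4] at h1
    simp only [blow, h2, Real.sqrt_mul (inv_nonneg.2 hy0.le)]
    have h5 : √(‖y - x₀‖⁻¹) * √(‖y - x₀‖⁻¹) = ‖y - x₀‖⁻¹ := Real.mul_self_sqrt (inv_nonneg.2 hy0.le)
    calc _ = (√(‖y - x₀‖⁻¹) * √(‖y - x₀‖⁻¹)) * (2 * √(u y) * (√(u (x₀ + ‖y - x₀‖ • z')) - √(u y))) := by ring
      _ ≤ _ := by
        rw [h5, inv_mul_le_iff₀ hy0]; exact h1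
  have key2 : ∀ k : Euc n, ⟪-(c • ν), k⟫ ≤ ⟪G, k⟫ := by
    intro k
    set m := ⟪k, ν⟫ with hm
    have e1 : ⟪-(c • ν), k⟫ = 2 * c * s * (-m) / (2 * s - 0 * m) := by
      rw [inner_neg_left, inner_smul_left, real_inner_comm, ← hm]
      simp only [conj_trivial]
      rw [zero_mul, sub_zero]
      field_simp
    have l1 : Tendsto (fun t : ℝ => 2 * c * s * (-m) / (2 * s - t * m)) (𝓝[>] 0) (𝓝 (2 * c * s * (-m) / (2 * s - 0 * m))) := by
      refine tendsto_nhdsWithin_of_tendsto_nhds ?_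
      refine Tendsto.div tendsto_const_nhds (Continuous.tendsto (by fun_prop) 0) ?_
      simpa using hs0.ne'
    rw [e1]
    refine le_of_tendsto l1 ?_
    have hev : ∀ᶠ t : ℝ in 𝓝[>] 0, t * m < s := by
      have : Tendsto (fun t : ℝ => t * m) (𝓝[>] 0) (𝓝 (0 * m)) :=
        tendsto_nhdsWithin_of_tendsto_nhds (Continuous.tendsto (by fun_prop) 0)
      rw [zero_mul] at this
      exact this.eventually (gt_mem_nhds hs0)
    filter_upwards [hev, self_mem_nhdsWithin] with t ht1 ht0
    have ht0 : 0 < t := ht0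
    have h1 : ⟪z + t • k, ν⟫ = -(s - t * m) := by
      rw [inner_add_left, inner_smul_left, ← hm, hs]; simp; ring
    have h2 := key (z + t • k) (by rw [h1]; linarith)
    rw [h1, neg_neg, add_sub_cancel_left, inner_smul_right, mul_sub, mul_assoc, mul_assoc, Real.mul_self_sqrt (by positivity),
      ← Real.sqrt_mul (by positivity)] at h2
    have hs' : 0 < s - t * m := by linarith
    have h3 : c * (2 * s * (s - t * m) / (2 * s - t * m)) ≤ √(c * s * (c * (s - t * m))) := by
      rw [show c * s * (c * (s - t * m)) = c ^ 2 * (s * (s - t * m)) by ring, Real.sqrt_mul (by positivity), Real.sqrt_sq hc]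
      refine mul_le_mul_of_nonneg_left (Real.le_sqrt_of_sq_le ?_) hc
      rw [div_pow, div_le_iff₀ (by nlinarith)]
      have := mul_pos hs0 hs'
      nlinarith [mul_nonneg this.le (sq_nonneg (t * m))]
    have hd : 0 < 2 * s - t * m := by linarith
    have h4 : 2 * c * s * (-m) / (2 * s - t * m) = (2 * (c * (2 * s * (s - t * m) / (2 * s - t * m))) - 2 * (c * s)) / t := by
      have hd' := hd.ne'
      rw [← mul_div_assoc, ← mul_div_assoc, div_sub' hd', div_div, div_eq_div_iff hd' (mul_ne_zero hd' ht0.ne')]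
      ring
    rw [h4, div_le_iff₀ ht0]
    linarith
  have : G = -(c • ν) := by
    refine ext_inner_right ℝ fun k => le_antisymm ?_ (key2 k)
    have := key2 (-k)
    rw [inner_neg_right, inner_neg_right] at this
    linarith
  rw [← this]
  exact hG

lemma ntGradient_eq (h : Tor Ω u) (hx : IsUniqueNormal Ω x₀ ν) {c : ℝ} (hc : 0 ≤ c)
    (hblow : ∀ z, Tendsto (fun r => blow u x₀ r z) (𝓝[>] 0) (𝓝 (c * max (-⟪z, ν⟫) 0))) :
    ntGradient Ω u x₀ = -(c • ν) := by
  have h1 := h.hasNTLimit hx hc hblow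
  have hex : ∃ L, HasNTLimitAt Ω (gradient u) x₀ L := ⟨_, h1⟩
  rw [ntGradient, dif_pos hex]
  obtain ⟨p, hp⟩ := h.nonempty
  obtain ⟨ρ, hρ, hB⟩ := Metric.isOpen_iff.1 h.isOpen p hp
  have hpx : p ≠ x₀ := fun he => h.frontier_not_mem hx.mem (he ▸ hp)
  have hα : 0 < ‖p - x₀‖ / ρ := div_pos (norm_pos_iff.2 (sub_ne_zero.2 hpx)) hρ
  have hray : Tendsto (fun t : ℝ => x₀ + t • (p - x₀)) (𝓝[>] 0) (𝓝[ntCone Ω x₀ (‖p - x₀‖ / ρ)] x₀) := by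
    refine tendsto_nhdsWithin_iff.2 ⟨tendsto_nhdsWithin_of_tendsto_nhds ?_, ?_⟩
    · simpa using (Continuous.tendsto (f := fun t : ℝ => x₀ + t • (p - x₀)) (by fun_prop) 0)
    · filter_upwards [Ioc_mem_nhdsGT one_pos] with t ht using h.ray_mem_ntCone hρ hB hx.mem ht
  exact tendsto_nhds_unique ((hex.choose_spec _ hα).comp hray) ((h1 _ hα).comp hray)

end Tor

end

section

lemma IsUniqueNormal.gaussMap_eq {Ω : Set (Euc n)} {x ν : Euc n} (hx : IsUniqueNormal Ω x ν) :
    gaussMap (closure Ω) x = ν := by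
  have hex : ∃! X, IsOuterNormalAt (closure Ω) x X := ⟨ν, hx.normal, hx.unique⟩
  rw [gaussMap, dif_pos hex]
  exact hx.unique _ hex.choose_spec.1

lemma continuousOn_gaussMap {Ω : Set (Euc n)} : ContinuousOn (gaussMap (closure Ω)) {x | ∃ ν, IsUniqueNormal Ω x ν} := by
  rintro x₀ ⟨ν, hx⟩
  rw [ContinuousWithinAt, tendsto_iff_ultrafilter]
  intro 𝒰 h𝒰
  have hmem : ∀ᶠ y in (𝒰 : Filter (Euc n)), ∃ ν, IsUniqueNormal Ω y ν := h𝒰 self_mem_nhdsWithin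
  have hx𝒰 : Tendsto (fun y => y) (𝒰 : Filter (Euc n)) (𝓝 x₀) := h𝒰.trans nhdsWithin_le_nhds
  have hn : ∀ᶠ y in (𝒰 : Filter (Euc n)), IsOuterNormalAt (closure Ω) y (gaussMap (closure Ω) y) := by
    filter_upwards [hmem] with y ⟨ν, hy⟩
    rw [hy.gaussMap_eq]; exact hy.normal
  obtain ⟨X, hX1, hX⟩ : ∃ X ∈ sphere (0 : Euc n) 1, Tendsto (gaussMap (closure Ω)) 𝒰 (𝓝 X) :=
    (isCompact_sphere (0 : Euc n) 1).ultrafilter_le_nhds (𝒰.map (gaussMap (closure Ω))) (by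
      rw [Ultrafilter.coe_map, le_principal_iff, mem_map]
      filter_upwards [hn] with y hy
      exact mem_sphere_zero_iff_norm.2 hy.1)
  have : X = ν := hx.unique _ ⟨mem_sphere_zero_iff_norm.1 hX1, fun z hz => by
    refine le_of_tendsto_of_tendsto (tendsto_const_nhds.inner hX) (hx𝒰.inner hX) ?_
    filter_upwards [hn] with y hy using hy.2 z hz⟩
  rw [hx.gaussMap_eq, ← this]
  exact hX

lemma Tor.aemeasurable_gaussMap {Ω : Set (Euc n)} {u : Euc n → ℝ} (h : Tor Ω u) :
    AEMeasurable (gaussMap (closure Ω)) (bdryMeasure Ω) := by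
  have hA : ∀ᵐ x ∂bdryMeasure Ω, x ∈ {x | ∃ ν, IsUniqueNormal Ω x ν} := h.exists_uniqueNormal
  have h1 := continuousOn_gaussMap (Ω := Ω).aemeasurable₀ (μ := bdryMeasure Ω)
    (NullMeasurableSet.of_compl (NullMeasurableSet.of_null hA))
  rwa [Measure.restrict_eq_self_of_ae_mem hA] at h1

namespace IsTorMeasure

variable {Ω : Set (Euc n)} {u : Euc n → ℝ} {σ : Measure (Euc n)}

lemma ae_ntGradient (hσ : IsTorMeasure Ω u σ) (h : Tor Ω u) : ∀ᵐ x ∂bdryMeasure Ω,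
    IsUniqueNormal Ω x (gaussMap (closure Ω) x) ∧
    (∀ α > 0, Tendsto (gradient u) (𝓝[ntCone Ω x α] x) (𝓝 (ntGradient Ω u x))) ∧
    ntGradient Ω u x = -(‖ntGradient Ω u x‖ • gaussMap (closure Ω) x) ∧
    σ.rnDeriv (bdryMeasure Ω) x = ENNReal.ofReal (gam n * ‖ntGradient Ω u x‖) := by
  filter_upwards [hσ.exists_blow_limit h] with x ⟨ν, hν, c, hc, hbl, hd⟩
  have h1 := h.ntGradient_eq hν hc hbl
  have h2 : ‖ntGradient Ω u x‖ = c := by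
    rw [h1, norm_neg, norm_smul, hν.normal.1, mul_one, Real.norm_of_nonneg hc]
  rw [h2, hν.gaussMap_eq]
  refine ⟨hν, ?_, h1, hd⟩
  rw [h1]
  exact h.hasNTLimit hν hc hbl

/-- Integrals against the torsion measure of positively homogeneous functions. -/
lemma integral_torsionMeasure (hσ : IsTorMeasure Ω u σ) (h : Tor Ω u) {μ : Measure (Euc n)}
    (hμ : ∀ η : Set (Euc n), MeasurableSet η → μ η = torsionMeasure Ω u η) {k : Euc n → ℝ} (hk : Continuous k)
    (hkh : ∀ c ≥ (0:ℝ), ∀ X, k (c • X) = c * k X) :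
    gam n * ∫ X, k X ∂μ = ∫ x, k (-ntGradient Ω u x) ∂σ := by
  have := hσ.finite
  have := h.isFiniteMeasure_bdry
  have hg := hσ.gam_pos h
  have : σ.HaveLebesgueDecomposition (bdryMeasure Ω) := Measure.haveLebesgueDecomposition_of_sigmaFinite _ _
  set G := gaussMap (closure Ω) with hG
  have hGm := h.aemeasurable_gaussMap
  set c : Euc n → ℝ := fun x => (σ.rnDeriv (bdryMeasure Ω) x).toReal / gam n with hc
  have hcm : Measurable c := (Measure.measurable_rnDeriv _ _).ennreal_toReal.div_const _
  have hae : ∀ᵐ x ∂bdryMeasure Ω, ‖ntGradient Ω u x‖ = c x := by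
    filter_upwards [hσ.ae_ntGradient h] with x hx
    rw [hc]
    simp only
    rw [hx.2.2.2, ENNReal.toReal_ofReal (by positivity), mul_div_cancel_left₀ _ hg.ne']
  have hdm : Measurable fun x => ENNReal.ofReal (c x ^ 2) := (hcm.pow_const 2).ennreal_ofReal
  set ρ' := (bdryMeasure Ω).withDensity fun x => ENNReal.ofReal (c x ^ 2) with hρ
  have hGm' : AEMeasurable G ρ' := hGm.mono_ac (withDensity_absolutelyContinuous _ _)
  have hμe : μ = ρ'.map G := by
    ext η hη
    rw [hμ η hη, Measure.map_apply_of_aemeasurable hGm' hη, torsionMeasure, inter_comm,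
      ← Measure.restrict_restrict' isClosed_frontier.measurableSet, withDensity_apply']
    refine lintegral_congr_ae (ae_restrict_of_ae ?_)
    filter_upwards [hae] with x hx
    rw [hx]
  rw [hμe, integral_map hGm' hk.aestronglyMeasurable, hρ, integral_withDensity_eq_integral_toReal_smul hdm
    (Eventually.of_forall fun _ => ENNReal.ofReal_lt_top), ← integral_const_mul,
    ← integral_toReal_rnDeriv_mul (hσ.absolutelyContinuous h)]
  refine integral_congr_ae ?_
  filter_upwards [hσ.ae_ntGradient h, hae] with x hx hx'
  have h0 : 0 ≤ c x := hx' ▸ norm_nonneg _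
  rw [hx.2.2.1, neg_neg, hkh _ (norm_nonneg _), hx.2.2.2, hx', ENNReal.toReal_ofReal (by positivity),
    ENNReal.toReal_ofReal (by positivity), smul_eq_mul]
  ring

end IsTorMeasure

/-- The extension by zero of a torsion function. -/
lemma IsTorsionFunction.tor {Ω : Set (Euc n)} {u : Euc n → ℝ} (hu : IsTorsionFunction Ω u) (hn : 2 ≤ n) (ho : IsOpen Ω)
    (hb : IsBounded Ω) (hc : Convex ℝ Ω) (hne : Ω.Nonempty) : Tor Ω (Ω.indicator u) := by
  have heq : ∀ x ∈ Ω, Ω.indicator u =ᶠ[𝓝 x] u := fun x hx => by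
    filter_upwards [ho.mem_nhds hx] with y hy using indicator_of_mem hy u
  refine ⟨hn, ho, hb, hc, hne, ?_, fun x hx => indicator_of_notMem hx u, fun x hx => ?_, ?_, fun x hx => ?_⟩
  · have h1 : Ω.indicator u = (closure Ω).indicator u := by
      ext x
      by_cases hx : x ∈ Ω
      · rw [indicator_of_mem hx, indicator_of_mem (subset_closure hx)]
      · rw [indicator_of_notMem hx]
        by_cases hx' : x ∈ closure Ω
        · rw [indicator_of_mem hx', hu.boundary_zero x (by rw [ho.frontier_eq]; exact ⟨hx', hx⟩)]
        · rw [indicator_of_notMem hx']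
    rw [h1]
    refine continuous_indicator (fun x hx => hu.boundary_zero x (frontier_closure_subset hx)) ?_
    rw [closure_closure]; exact hu.continuousOn
  · exact (((hu.smooth x hx).contDiffAt (ho.mem_nhds hx)).of_le (WithTop.coe_le_coe.2 le_top)).congr_of_eventuallyEq (heq x hx)
  · exact hu.smooth.congr fun x hx => indicator_of_mem hx u
  · rw [lapl_congr (heq x hx), hu.lapl_eq x hx]

lemma torsionMeasure_indicator {Ω : Set (Euc n)} {u : Euc n → ℝ} (ho : IsOpen Ω) (η : Set (Euc n)) :
    torsionMeasure Ω (Ω.indicator u) η = torsionMeasure Ω u η := by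
  have h1 : ∀ x ∈ Ω, gradient (Ω.indicator u) x = gradient u x := fun x hx => by
    have : Ω.indicator u =ᶠ[𝓝 x] u := by
      filter_upwards [ho.mem_nhds hx] with y hy using indicator_of_mem hy u
    rw [gradient, gradient, this.fderiv_eq]
  have h2 : HasNTLimitAt Ω (gradient (Ω.indicator u)) = HasNTLimitAt Ω (gradient u) := by
    ext x L
    refine forall₂_congr fun α _ => tendsto_congr' ?_
    filter_upwards [self_mem_nhdsWithin] with y hy using h1 y hy.1
  have h3 : ntGradient Ω (Ω.indicator u) = ntGradient Ω u := by
    ext x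
    simp only [ntGradient, h2]
  rw [torsionMeasure, torsionMeasure, h3]

end

section

/-- The symmetric second difference. -/
def secDiff (f : Euc n → ℝ) (x w : Euc n) (s : ℝ) : ℝ := f (x + s • w) + f (x - s • w) - 2 * f x

lemma continuous_secDiff {f : Euc n → ℝ} (hf : Continuous f) (w : Euc n) (s : ℝ) : Continuous fun x => secDiff f x w s := by
  unfold secDiff; fun_prop

/-- Second differences of a `C²` function are locally uniformly quadratically small. -/
lemma eventually_abs_secDiff_le {f : Euc n → ℝ} {x : Euc n} (hf : ContDiffAt ℝ 2 f x) :
    ∃ C ≥ 0, ∃ s₀ > 0, ∀ᶠ y in 𝓝 x, ∀ s ∈ Ioo 0 s₀, ∀ i, |secDiff f y (stdv i) s| ≤ C * s ^ 2 := by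
  obtain ⟨L, t, ht, hL⟩ := (hf.fderiv_right (m := 1) (by norm_num)).exists_lipschitzOnWith
  obtain ⟨δ, hδ, hB⟩ := Metric.mem_nhds_iff.1 (inter_mem ht (eventually_differentiableAt hf))
  refine ⟨2 * L, by positivity, δ / 2, by positivity, ?_⟩
  filter_upwards [ball_mem_nhds x (half_pos hδ)] with y hy s hs i
  have hin : ∀ r : ℝ, |r| ≤ s → y + r • stdv i ∈ ball x δ := fun r hr => by
    have h1 : dist (y + r • stdv i) y ≤ s := by
      rw [dist_eq_norm, add_sub_cancel_left, norm_smul]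
      simpa using hr
    have h2 := mem_ball.1 hy
    have h3 := dist_triangle (y + r • stdv i) y x
    rw [mem_ball]; linarith [hs.2]
  set F : ℝ → ℝ := fun r => secDiff f y (stdv i) r with hF
  have hd : ∀ r ∈ Icc 0 s, HasDerivWithinAt F
      (fderiv ℝ f (y + r • stdv i) (stdv i) - fderiv ℝ f (y - r • stdv i) (stdv i)) (Icc 0 s) r := by
    intro r hr
    have hr' : |r| ≤ s := by rw [abs_of_nonneg hr.1]; exact hr.2
    have h1 : HasDerivAt (fun r : ℝ => y + r • stdv i) (stdv i) r := by
      simpa using ((hasDerivAt_id r).smul_const (stdv i)).const_add y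
    have h2 : HasDerivAt (fun r : ℝ => y - r • stdv i) (-stdv i) r := by
      simpa using ((hasDerivAt_id r).smul_const (stdv i)).const_sub y
    have h3 := (hB (hin r hr')).2.hasFDerivAt.comp_hasDerivAt r h1
    have h4' : y - r • stdv i ∈ ball x δ := by
      have := hin (-r) (by rwa [abs_neg])
      rwa [neg_smul, ← sub_eq_add_neg] at this
    have h4 := (hB h4').2.hasFDerivAt.comp_hasDerivAt r h2
    have h5 := ((h3.add h4).sub_const (2 * f y)).hasDerivWithinAt (s := Icc 0 s)
    rw [map_neg, ← sub_eq_add_neg] at h5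
    exact h5
  have hb : ∀ r ∈ Icc 0 s, ‖fderiv ℝ f (y + r • stdv i) (stdv i) - fderiv ℝ f (y - r • stdv i) (stdv i)‖ ≤ 2 * L * s := by
    intro r hr
    have hr' : |r| ≤ s := by rw [abs_of_nonneg hr.1]; exact hr.2
    have h4' : y - r • stdv i ∈ ball x δ := by
      have := hin (-r) (by rwa [abs_neg])
      rwa [neg_smul, ← sub_eq_add_neg] at this
    have h1 := hL.dist_le_mul _ (hB (hin r hr')).1 _ (hB h4').1
    rw [dist_eq_norm, dist_eq_norm, show y + r • stdv i - (y - r • stdv i) = (2 * r) • stdv i by module, norm_smul] at h1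
    have h2 := (fderiv ℝ f (y + r • stdv i) - fderiv ℝ f (y - r • stdv i)).le_opNorm (stdv i)
    simp only [_root_.sub_apply] at h2
    have hn1 : ‖(stdv i : Euc n)‖ = 1 := by simp
    rw [hn1, mul_one] at h1 h2
    rw [Real.norm_of_nonneg (by linarith [hr.1])] at h1
    have hL0 : (0:ℝ) ≤ L := L.2
    nlinarith [mul_le_mul_of_nonneg_left hr.2 hL0]
  have := (convex_Icc (0:ℝ) s).norm_image_sub_le_of_norm_hasDerivWithin_le hd hb (left_mem_Icc.2 hs.1.le)
    (right_mem_Icc.2 hs.1.le)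
  have h0 : F 0 = 0 := by simp [hF, secDiff]; ring
  rw [h0, sub_zero, sub_zero, Real.norm_eq_abs, Real.norm_of_nonneg hs.1.le] at this
  calc _ ≤ _ := this
    _ = _ := by ring

/-- Local subharmonicity at a point, in the form of a lower bound for second differences together with the
existence of a `C²` function with nonnegative Laplacian touching from below. -/
structure LocSub (W : Euc n → ℝ) (x : Euc n) : Prop where
  semi : ∃ C ≥ 0, ∃ s₀ > 0, ∀ᶠ y in 𝓝 x, ∀ s ∈ Ioo 0 s₀, ∀ i, -(C * s ^ 2) ≤ secDiff W y (stdv i) s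
  touch : ∃ m : Euc n → ℝ, ContDiffAt ℝ 2 m x ∧ 0 ≤ lapl m x ∧ m x = W x ∧ ∀ᶠ y in 𝓝 x, m y ≤ W y

lemma LocSub.of_contDiffAt {f : Euc n → ℝ} {x : Euc n} (hf : ContDiffAt ℝ 2 f x) (hl : 0 ≤ lapl f x) : LocSub f x := by
  refine ⟨?_, f, hf, hl, rfl, Eventually.of_forall fun _ => le_rfl⟩
  obtain ⟨C, hC, s₀, hs₀, h⟩ := eventually_abs_secDiff_le hf
  exact ⟨C, hC, s₀, hs₀, h.mono fun y hy s hs i => (abs_le.1 (hy s hs i)).1⟩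

lemma LocSub.congr {W W' : Euc n → ℝ} {x : Euc n} (h : LocSub W x) (he : W' =ᶠ[𝓝 x] W) : LocSub W' x := by
  obtain ⟨⟨C, hC, s₀, hs₀, hs⟩, m, hm, hl, hx, hle⟩ := h
  refine ⟨?_, m, hm, hl, by rw [hx, he.eq_of_nhds], by filter_upwards [hle, he] with y h1 h2; rwa [h2]⟩
  obtain ⟨δ, hδ, hB⟩ := Metric.eventually_nhds_iff_ball.1 he
  refine ⟨C, hC, min s₀ (δ / 2), by positivity, ?_⟩
  filter_upwards [hs, ball_mem_nhds x (half_pos hδ)] with y hy hyB s hsI i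
  have hin : ∀ r : ℝ, |r| ≤ s → W' (y + r • stdv i) = W (y + r • stdv i) := fun r hr => by
    refine hB _ ?_
    have h1 : dist (y + r • stdv i) y ≤ s := by
      rw [dist_eq_norm, add_sub_cancel_left, norm_smul]
      simpa using hr
    have h2 := mem_ball.1 hyB
    have h3 := dist_triangle (y + r • stdv i) y x
    have h4 := hsI.2.trans_le (min_le_right _ _)
    rw [mem_ball]; linarith
  have h1 := hin s (abs_of_pos hsI.1).le
  have h2 := hin (-s) (by rw [abs_neg, abs_of_pos hsI.1])
  have h3 := hin 0 (by rw [abs_zero]; exact hsI.1.le)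
  rw [neg_smul, ← sub_eq_add_neg] at h2
  rw [zero_smul, add_zero] at h3
  have := hy s ⟨hsI.1, hsI.2.trans_le (min_le_left _ _)⟩ i
  rwa [secDiff, h1, h2, h3]

lemma LocSub.comp_affine {W : Euc n → ℝ} {p x : Euc n} {r : ℝ} (hr : 0 < r) (h : LocSub W (p + r • x)) :
    LocSub (fun z => W (p + r • z)) x := by
  obtain ⟨⟨C, hC, s₀, hs₀, hs⟩, m, hm, hl, hx, hle⟩ := h
  have ht : Tendsto (fun z : Euc n => p + r • z) (𝓝 x) (𝓝 (p + r • x)) := Continuous.tendsto (by fun_prop) x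
  refine ⟨⟨C * r ^ 2, by positivity, s₀ / r, by positivity, ?_⟩, fun z => m (p + r • z), ?_, ?_, hx, ht hle⟩
  · filter_upwards [ht hs] with y hy s hsI i
    have := hy (r * s) ⟨mul_pos hr hsI.1, by rw [mul_comm]; exact (lt_div_iff₀ hr).1 hsI.2⟩ i
    rw [secDiff] at this ⊢
    rw [smul_add, smul_sub, smul_smul, ← add_assoc, add_sub_assoc'] 
    calc _ = -(C * (r * s) ^ 2) := by ring
      _ ≤ _ := this
  · exact contDiffAt_comp_affine hm
  · rw [lapl_comp_affine r p x hm]; positivity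

/-- A continuous function satisfying the local conditions at all points of the support of a test function
is subharmonic in the sense of distributions. -/
theorem integral_mul_lapl_nonneg {W ζ : Euc n → ℝ} (hW : Continuous W) (hζ : ContDiff ℝ 2 ζ) (hc : HasCompactSupport ζ)
    (h0 : ∀ x, 0 ≤ ζ x) (hs : ∀ x ∈ tsupport ζ, LocSub W x) : 0 ≤ ∫ x, W x * lapl ζ x := by
  set S := tsupport ζ with hS
  have hSc : IsCompact S := hc
  set K := cthickening 1 S with hK
  have hKc : IsCompact K := hSc.cthickening
  have hKout : ∀ x ∉ K, ∀ w : Euc n, ‖w‖ ≤ 1 → ζ (x + w) = 0 := fun x hx w hw => by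
    refine image_eq_zero_of_notMem_tsupport fun hm => hx ?_
    refine mem_cthickening_of_dist_le x (x + w) 1 S hm ?_
    rwa [dist_eq_norm, sub_add_cancel_left, norm_neg]
  obtain ⟨C₁, hC₁, s₁, hs₁, hb₁⟩ : ∃ C ≥ 0, ∃ s₀ > 0, ∀ y ∈ K, ∀ s ∈ Ioo 0 s₀, ∀ i, |secDiff ζ y (stdv i) s| ≤ C * s ^ 2 := by
    refine hKc.induction_on (p := fun A => ∃ C ≥ 0, ∃ s₀ > 0, ∀ y ∈ A, ∀ s ∈ Ioo 0 s₀, ∀ i, |secDiff ζ y (stdv i) s| ≤ C * s ^ 2)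
      ⟨0, le_rfl, 1, one_pos, by simp⟩ ?_ ?_ ?_
    · rintro A B hAB ⟨C, hC, s₀, hs₀, hB⟩
      exact ⟨C, hC, s₀, hs₀, fun y hy => hB y (hAB hy)⟩
    · rintro A B ⟨C, hC, s₀, hs₀, hA⟩ ⟨C', hC', s₀', hs₀', hB⟩
      refine ⟨max C C', by positivity, min s₀ s₀', by positivity, ?_⟩
      rintro y (hy | hy) s hs i
      · exact (hA y hy s ⟨hs.1, hs.2.trans_le (min_le_left _ _)⟩ i).trans (by gcongr; exact le_max_left _ _)
      · exact (hB y hy s ⟨hs.1, hs.2.trans_le (min_le_right _ _)⟩ i).trans (by gcongr; exact le_max_right _ _)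
    · intro x _
      obtain ⟨C, hC, s₀, hs₀, h⟩ := eventually_abs_secDiff_le (hζ.contDiffAt (x := x))
      exact ⟨_, mem_nhdsWithin_of_mem_nhds h, C, hC, s₀, hs₀, fun y hy => hy⟩
  obtain ⟨C₂, hC₂, s₂, hs₂, hb₂⟩ : ∃ C ≥ 0, ∃ s₀ > 0, ∀ y ∈ S, ∀ s ∈ Ioo 0 s₀, ∀ i, -(C * s ^ 2) ≤ secDiff W y (stdv i) s := by
    refine hSc.induction_on (p := fun A => ∃ C ≥ 0, ∃ s₀ > 0, ∀ y ∈ A, ∀ s ∈ Ioo 0 s₀, ∀ i, -(C * s ^ 2) ≤ secDiff W y (stdv i) s)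
      ⟨0, le_rfl, 1, one_pos, by simp⟩ ?_ ?_ ?_
    · rintro A B hAB ⟨C, hC, s₀, hs₀, hB⟩
      exact ⟨C, hC, s₀, hs₀, fun y hy => hB y (hAB hy)⟩
    · rintro A B ⟨C, hC, s₀, hs₀, hA⟩ ⟨C', hC', s₀', hs₀', hB⟩
      refine ⟨max C C', by positivity, min s₀ s₀', by positivity, ?_⟩
      rintro y (hy | hy) s hs i
      · refine le_trans ?_ (hA y hy s ⟨hs.1, hs.2.trans_le (min_le_left _ _)⟩ i)
        gcongr; exact le_max_left _ _
      · refine le_trans ?_ (hB y hy s ⟨hs.1, hs.2.trans_le (min_le_right _ _)⟩ i)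
        gcongr; exact le_max_right _ _
    · intro x hx
      obtain ⟨C, hC, s₀, hs₀, h⟩ := (hs x hx).semi
      exact ⟨_, mem_nhdsWithin_of_mem_nhds h, C, hC, s₀, hs₀, fun y hy => hy⟩
  have hev : ∀ᶠ s : ℝ in 𝓝[>] 0, s ∈ Ioo 0 (min 1 (min s₁ s₂)) := Ioo_mem_nhdsGT (by positivity)
  have hne : 𝓝[>] (0:ℝ) ≤ 𝓝[≠] 0 := nhdsWithin_mono _ fun x hx => ne_of_gt hx
  have hsum : ∀ s : ℝ, ∀ f : Euc n → ℝ, Continuous f → Continuous fun x => ∑ i, secDiff f x (stdv i) s / s ^ 2 := fun s f hf =>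
    continuous_finsetSum _ fun i _ => (continuous_secDiff hf _ _).div_const _
  -- convergence of the discrete Laplacians of the test function
  have lim1 : Tendsto (fun s : ℝ => ∫ x, W x * ∑ i, secDiff ζ x (stdv i) s / s ^ 2) (𝓝[>] 0) (𝓝 (∫ x, W x * lapl ζ x)) := by
    refine tendsto_integral_filter_of_dominated_convergence (fun x => K.indicator (fun x => |W x| * (n * C₁)) x) ?_ ?_ ?_ ?_
    · exact Eventually.of_forall fun s => (hW.mul (hsum s ζ hζ.continuous)).aestronglyMeasurable
    · filter_upwards [hev] with s hs
      have hs1 : s < 1 := hs.2.trans_le (min_le_left _ _)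
      have hs2 : s < s₁ := hs.2.trans_le ((min_le_right _ _).trans (min_le_left _ _))
      refine Eventually.of_forall fun x => ?_
      by_cases hx : x ∈ K
      · rw [indicator_of_mem hx, norm_mul, Real.norm_eq_abs]
        gcongr
        calc _ ≤ ∑ i : Fin n, ‖secDiff ζ x (stdv i) s / s ^ 2‖ := norm_sum_le _ _
          _ ≤ ∑ i : Fin n, C₁ := by
              refine Finset.sum_le_sum fun i _ => ?_
              rw [norm_div, Real.norm_eq_abs, Real.norm_of_nonneg (sq_nonneg s), div_le_iff₀ (pow_pos hs.1 2)]
              exact hb₁ x hx s ⟨hs.1, hs2⟩ i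
          _ = _ := by simp
      · rw [indicator_of_notMem hx]
        have : ∀ i, secDiff ζ x (stdv i) s = 0 := fun i => by
          have hn1 : ‖s • (stdv i : Euc n)‖ ≤ 1 := by
            rw [norm_smul, Real.norm_of_nonneg hs.1.le]; simpa using hs1.le
          have e1 := hKout x hx _ hn1
          have e2 := hKout x hx (-(s • stdv i)) (by rwa [norm_neg])
          have e3 := hKout x hx 0 (by simp)
          rw [← sub_eq_add_neg] at e2
          rw [add_zero] at e3
          rw [secDiff, e1, e2, e3]; simp
        simp [this]
    · exact ((hW.abs.mul continuous_const).continuousOn.integrableOn_compact hKc).integrable_indicator hKc.measurableSet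
    · refine Eventually.of_forall fun x => Tendsto.const_mul _ ?_
      rw [lapl_eq_sum_hess]
      exact tendsto_finsetSum _ fun i _ => (tendsto_second_difference hζ.contDiffAt (stdv i)).mono_left hne
  have key : ∀ s : ℝ, ∫ x, W x * ∑ i, secDiff ζ x (stdv i) s / s ^ 2 = ∫ x, ζ x * ∑ i, secDiff W x (stdv i) s / s ^ 2 := by
    intro s
    have hInt : ∀ (f : Euc n → ℝ), Continuous f → ∀ w : Euc n, Integrable fun x => f x * ζ (x + w) := fun f hf w => by
      have h1 : HasCompactSupport fun x => ζ (x + w) := hc.comp_homeomorph (Homeomorph.addRight w)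
      exact (hf.mul (hζ.continuous.comp (continuous_id.add continuous_const))).integrable_of_hasCompactSupport h1.mul_left
    have hInt' : ∀ (f : Euc n → ℝ), Continuous f → Integrable fun x => f x * ζ x := fun f hf => by simpa using hInt f hf 0
    have hshift : ∀ w : Euc n, ∫ x, W x * ζ (x + w) = ∫ x, W (x - w) * ζ x := fun w => by
      rw [← integral_add_right_eq_self (fun x => W (x - w) * ζ x) w]
      simp
    simp only [Finset.mul_sum]
    have hcW : ∀ w : Euc n, Continuous fun x => W (x + w) := fun w => hW.comp (continuous_id.add continuous_const)
    have hcW' : ∀ w : Euc n, Continuous fun x => W (x - w) := fun w => hW.comp (continuous_id.sub continuous_const)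
    have hi1 : ∀ i, Integrable fun x => W x * (secDiff ζ x (stdv i) s / s ^ 2) := fun i => by
      have := (((hInt W hW (s • stdv i)).add (hInt W hW (-(s • stdv i)))).sub ((hInt' W hW).const_mul 2)).div_const (s ^ 2)
      refine this.congr (Eventually.of_forall fun x => ?_)
      simp only [secDiff, Pi.add_apply, Pi.sub_apply, ← sub_eq_add_neg]
      ring
    have hi2 : ∀ i, Integrable fun x => ζ x * (secDiff W x (stdv i) s / s ^ 2) := fun i => by
      have := hInt' (fun x => secDiff W x (stdv i) s / s ^ 2) ((continuous_secDiff hW _ _).div_const _)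
      simpa only [mul_comm] using this
    rw [integral_finsetSum _ fun i _ => hi1 i, integral_finsetSum _ fun i _ => hi2 i]
    refine Finset.sum_congr rfl fun i _ => ?_
    have e1 : ∫ x, W x * (secDiff ζ x (stdv i) s / s ^ 2) =
        ((∫ x, W x * ζ (x + s • stdv i)) + (∫ x, W x * ζ (x + -(s • stdv i))) - 2 * ∫ x, W x * ζ x) / s ^ 2 := by
      have hA : Integrable fun x => W x * ζ (x + s • stdv i) + W x * ζ (x + -(s • stdv i)) := (hInt W hW _).add (hInt W hW _)
      rw [← integral_add (hInt W hW _) (hInt W hW _), ← integral_const_mul, ← integral_sub hA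
        ((hInt' W hW).const_mul 2), ← integral_div]
      refine integral_congr_ae (Eventually.of_forall fun x => ?_)
      simp only [secDiff, ← sub_eq_add_neg]
      ring
    have e2 : ∫ x, ζ x * (secDiff W x (stdv i) s / s ^ 2) =
        ((∫ x, W (x - s • stdv i) * ζ x) + (∫ x, W (x - -(s • stdv i)) * ζ x) - 2 * ∫ x, W x * ζ x) / s ^ 2 := by
      have hA : Integrable fun x => W (x - s • stdv i) * ζ x + W (x - -(s • stdv i)) * ζ x :=
        (hInt' _ (hcW' _)).add (hInt' _ (hcW' _))
      rw [← integral_add (hInt' _ (hcW' _)) (hInt' _ (hcW' _)), ← integral_const_mul,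
        ← integral_sub hA ((hInt' W hW).const_mul 2), ← integral_div]
      refine integral_congr_ae (Eventually.of_forall fun x => ?_)
      simp only [secDiff, sub_neg_eq_add]
      ring
    rw [e1, e2, hshift, hshift]
  have lim2 : Tendsto (fun s : ℝ => ∫ x, ζ x * min (∑ i, secDiff W x (stdv i) s / s ^ 2) 0) (𝓝[>] 0) (𝓝 (∫ x : Euc n, (0:ℝ))) := by
    refine tendsto_integral_filter_of_dominated_convergence (fun x => ζ x * (n * C₂)) ?_ ?_ ?_ ?_
    · exact Eventually.of_forall fun s => (hζ.continuous.mul ((hsum s W hW).min continuous_const)).aestronglyMeasurable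
    · filter_upwards [hev] with s hs
      have hs2 : s < s₂ := hs.2.trans_le ((min_le_right _ _).trans (min_le_right _ _))
      refine Eventually.of_forall fun x => ?_
      rw [norm_mul, Real.norm_of_nonneg (h0 x)]
      by_cases hx : x ∈ S
      · refine mul_le_mul_of_nonneg_left ?_ (h0 x)
        rw [Real.norm_of_nonpos (min_le_right _ _), neg_le, le_min_iff]
        refine ⟨?_, neg_nonpos.2 (by positivity)⟩
        calc -(n * C₂) = ∑ i : Fin n, -C₂ := by simp
          _ ≤ _ := by
            refine Finset.sum_le_sum fun i _ => ?_
            rw [le_div_iff₀ (pow_pos hs.1 2), neg_mul]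
            exact hb₂ x hx s ⟨hs.1, hs2⟩ i
      · rw [image_eq_zero_of_notMem_tsupport hx]; simp
    · exact (hζ.continuous.integrable_of_hasCompactSupport hc).mul_const _
    · refine Eventually.of_forall fun x => ?_
      by_cases hx : x ∈ S
      · suffices hh : Tendsto (fun s : ℝ => min (∑ i, secDiff W x (stdv i) s / s ^ 2) 0) (𝓝[>] 0) (𝓝 0) by
          have := hh.const_mul (ζ x)
          rwa [mul_zero] at this
        obtain ⟨m, hm, hl, hmx, hle⟩ := (hs x hx).touch
        have l1 : Tendsto (fun s : ℝ => ∑ i, secDiff m x (stdv i) s / s ^ 2) (𝓝[>] 0) (𝓝 (lapl m x)) := by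
          rw [lapl_eq_sum_hess]
          exact tendsto_finsetSum _ fun i _ => (tendsto_second_difference hm (stdv i)).mono_left hne
        have l2 := l1.min (tendsto_const_nhds (x := (0:ℝ)))
        rw [min_eq_right hl] at l2
        have hcl : ∀ i, ∀ᶠ s : ℝ in 𝓝[>] 0, m (x + s • stdv i) ≤ W (x + s • stdv i) := fun i => by
          have : Tendsto (fun s : ℝ => x + s • stdv i) (𝓝[>] 0) (𝓝 x) :=
            tendsto_nhdsWithin_of_tendsto_nhds (by simpa using (Continuous.tendsto (f := fun s : ℝ => x + s • stdv i) (by fun_prop) 0))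
          exact this hle
        have hcl' : ∀ i, ∀ᶠ s : ℝ in 𝓝[>] 0, m (x - s • stdv i) ≤ W (x - s • stdv i) := fun i => by
          have : Tendsto (fun s : ℝ => x - s • stdv i) (𝓝[>] 0) (𝓝 x) :=
            tendsto_nhdsWithin_of_tendsto_nhds (by simpa using (Continuous.tendsto (f := fun s : ℝ => x - s • stdv i) (by fun_prop) 0))
          exact this hle
        refine tendsto_of_tendsto_of_tendsto_of_le_of_le' l2 tendsto_const_nhds ?_ (Eventually.of_forall fun _ => min_le_right _ _)
        filter_upwards [eventually_all.2 hcl, eventually_all.2 hcl'] with s h1 h2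
        refine min_le_min_right _ (Finset.sum_le_sum fun i _ => ?_)
        have := h1 i
        have := h2 i
        refine div_le_div_of_nonneg_right ?_ (sq_nonneg s)
        rw [secDiff, secDiff, hmx]
        linarith
      · rw [image_eq_zero_of_notMem_tsupport hx]; simp
  rw [integral_zero] at lim2
  refine le_of_tendsto_of_tendsto lim2 lim1 ?_
  filter_upwards [] with s
  rw [key]
  refine integral_mono_ae ?_ ?_ (Eventually.of_forall fun x => mul_le_mul_of_nonneg_left (min_le_left _ _) (h0 x))
  · exact (hζ.continuous.mul ((hsum s W hW).min continuous_const)).integrable_of_hasCompactSupport hc.mul_right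
  · exact (hζ.continuous.mul (hsum s W hW)).integrable_of_hasCompactSupport hc.mul_right

end

section

lemma hess_swap {f : Euc n → ℝ} {x : Euc n} (hf : ContDiffAt ℝ 2 f x) (v w : Euc n) :
    fderiv ℝ (fun z => fderiv ℝ f z w) x v = fderiv ℝ (fun z => fderiv ℝ f z v) x w := by
  rw [(hasFDerivAt_fderiv_apply hf w).fderiv, (hasFDerivAt_fderiv_apply hf v).fderiv]
  exact (hf.isSymmSndFDerivAt (by simp)) v w

lemma contDiffAt_fderiv_apply {f : Euc n → ℝ} {x : Euc n} {k m : WithTop ℕ∞} (hf : ContDiffAt ℝ k f x) (hm : m + 1 ≤ k) (w : Euc n) :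
    ContDiffAt ℝ m (fun z => fderiv ℝ f z w) x :=
  (hf.fderiv_right hm).clm_apply contDiffAt_const

lemma lapl_eq_sum_fderiv_at {f : Euc n → ℝ} {x : Euc n} (hf : ContDiffAt ℝ 2 f x) :
    lapl f x = ∑ i, fderiv ℝ (fun z => fderiv ℝ f z (stdv i)) x (stdv i) := by
  rw [lapl_eq_sum_hess]
  exact Finset.sum_congr rfl fun i _ => hess_eq hf _

/-- The Laplacian commutes with directional derivatives. -/
lemma lapl_fderiv {f : Euc n → ℝ} {x : Euc n} (hf : ContDiffAt ℝ 3 f x) (w : Euc n) :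
    lapl (fun z => fderiv ℝ f z w) x = fderiv ℝ (lapl f) x w := by
  have h2 : ∀ᶠ z in 𝓝 x, ContDiffAt ℝ 3 f z := hf.eventually (by simp)
  have hle : (2 : WithTop ℕ∞) ≤ 3 := by norm_num
  have h1 : lapl f =ᶠ[𝓝 x] fun z => ∑ i, fderiv ℝ (fun y => fderiv ℝ f y (stdv i)) z (stdv i) :=
    h2.mono fun z hz => lapl_eq_sum_fderiv_at (hz.of_le hle)
  have hc : ∀ v, ContDiffAt ℝ 2 (fun z => fderiv ℝ f z v) x := fun v =>
    contDiffAt_fderiv_apply hf (by norm_num) v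
  rw [h1.fderiv_eq, fderiv_fun_sum, lapl_eq_sum_fderiv_at (hc w), _root_.sum_apply]
  · refine Finset.sum_congr rfl fun i _ => ?_
    rw [hess_swap (hc _) w]
    refine congrArg (fun l : Euc n →L[ℝ] ℝ => l (stdv i)) (Filter.EventuallyEq.fderiv_eq ?_)
    exact h2.mono fun z hz => hess_swap (hz.of_le hle) _ _
  · intro i _
    exact (hasFDerivAt_fderiv_apply (hc _) _).differentiableAt

lemma lapl_fun_sum {ι : Type*} (s : Finset ι) {f : ι → Euc n → ℝ} {x : Euc n} (hf : ∀ i ∈ s, ContDiffAt ℝ 2 (f i) x) :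
    lapl (fun z => ∑ i ∈ s, f i z) x = ∑ i ∈ s, lapl (f i) x := by
  induction s using Finset.induction_on with
  | empty => simpa using lapl_const (x := x) 0
  | insert a s ha ih =>
    simp only [Finset.sum_insert ha]
    rw [lapl_add (hf _ (Finset.mem_insert_self _ _))
      (ContDiffAt.sum fun i hi => hf i (Finset.mem_insert_of_mem hi)),
      ih fun i hi => hf i (Finset.mem_insert_of_mem hi)]

lemma sum_coord_stdv (x : Euc n) : ∑ j, x j • (stdv j : Euc n) = x := by
  have := (EuclideanSpace.basisFun (Fin n) ℝ).sum_repr x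
  simpa using this

/-- `Δ(∇f(z)·(z-c)) = 2 * Δf` when `f` has constant Laplacian. -/
lemma lapl_fderiv_radial {f : Euc n → ℝ} {x : Euc n} (hf : ContDiffAt ℝ 3 f x) {a : ℝ} (hl : lapl f =ᶠ[𝓝 x] fun _ => a)
    (c : Euc n) : lapl (fun z => fderiv ℝ f z (z - c)) x = 2 * a := by
  have he : (fun z => fderiv ℝ f z (z - c)) = fun z => ∑ j, (z j - c j) * fderiv ℝ f z (stdv j) := by
    ext z
    conv_lhs => rw [← sum_coord_stdv (z - c)]
    simp
  have hc : ∀ v, ContDiffAt ℝ 2 (fun z => fderiv ℝ f z v) x := fun v =>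
    contDiffAt_fderiv_apply hf (by norm_num) v
  have hd : ∀ j : Fin n, (fun z : Euc n => z j - c j) = fun z => (EuclideanSpace.proj j : Euc n →L[ℝ] ℝ) z - c j := fun j => rfl
  have hcd : ∀ j : Fin n, ContDiffAt ℝ 2 (fun z : Euc n => z j - c j) x := fun j => by
    rw [hd]; exact (ContinuousLinearMap.contDiff _).contDiffAt.sub contDiffAt_const
  have hD : ∀ j : Fin n, fderiv ℝ (fun z : Euc n => z j - c j) x = (EuclideanSpace.proj j : Euc n →L[ℝ] ℝ) := fun j => by
    rw [hd, fderiv_sub_const, ContinuousLinearMap.fderiv]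
  have hL : ∀ j : Fin n, lapl (fun z : Euc n => z j - c j) x = 0 := fun j => by
    rw [hd, lapl_sub (ContinuousLinearMap.contDiff _).contDiffAt contDiffAt_const, lapl_clm, lapl_const, sub_zero]
  have hz : ∀ v, lapl (fun z => fderiv ℝ f z v) x = 0 := fun v => by
    rw [lapl_fderiv hf, hl.fderiv_eq]; simp
  rw [he, lapl_fun_sum _ fun j _ => (hcd j).mul (hc _), ← hl.eq_of_nhds,
    lapl_eq_sum_fderiv_at (hf.of_le (by norm_num)), Finset.mul_sum]
  refine Finset.sum_congr rfl fun j _ => ?_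
  rw [lapl_mul (hcd j) (hc _), hL, hz, hD]
  simp only [zero_mul, mul_zero, add_zero, zero_add]
  congr 1
  rw [Finset.sum_eq_single j]
  · simp
  · intro i _ hij
    simp [hij.symm]
  · simp

namespace Tor

variable {Ω : Set (Euc n)} {u : Euc n → ℝ}

lemma contDiffAt (h : Tor Ω u) {x : Euc n} (hx : x ∈ Ω) : ContDiffAt ℝ 3 u x :=
  (h.smooth'.contDiffAt (h.isOpen.mem_nhds hx)).of_le (WithTop.coe_le_coe.2 le_top)

lemma lapl_eventually (h : Tor Ω u) {x : Euc n} (hx : x ∈ Ω) : lapl u =ᶠ[𝓝 x] fun _ => -2 :=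
  mem_of_superset (h.isOpen.mem_nhds hx) h.lapl_eq

end Tor

/-- The ray limits of a bounded subsolution on `Ω` dominate its integral. -/
theorem IsTorMeasure.le_integral_of_locSub {Ω : Set (Euc n)} {u : Euc n → ℝ} {σ : Measure (Euc n)} (hσ : IsTorMeasure Ω u σ)
    (h : Tor Ω u) {Q b : Euc n → ℝ} {M : ℝ} {p : Euc n} (hQc : ContinuousOn Q Ω) (hQs : ∀ x ∈ Ω, LocSub Q x)
    (hQb : ∀ x ∈ Ω, |Q x| ≤ M) (hp : p ∈ Ω)
    (hb : ∀ᵐ x ∂σ, Tendsto (fun t : ℝ => Q (x + t • (p - x))) (𝓝[>] 0) (𝓝 (b x))) :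
    2 * ∫ x in Ω, Q x ≤ ∫ x, b x ∂σ := by
  have := hσ.finite
  have hmem : ∀ t ∈ Ioo (0:ℝ) 1, ∀ x ∈ closure Ω, x + t • (p - x) ∈ Ω := fun t ht x hx => by
    have := h.combo_mem ht.1 ht.2 hx hp
    convert this using 1; module
  have hW : ∀ t : ℝ, ∃ W : C(Euc n, ℝ), t ∈ Ioo (0:ℝ) 1 → ∀ x ∈ closure Ω, W x = Q (x + t • (p - x)) := fun t => by
    by_cases ht : t ∈ Ioo (0:ℝ) 1
    · have hc : ContinuousOn (fun x => Q (x + t • (p - x))) (closure Ω) :=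
        hQc.comp (by fun_prop) fun x hx => hmem t ht x hx
      obtain ⟨W, hW⟩ := ContinuousMap.exists_restrict_eq isClosed_closure ⟨_, hc.domRestrict⟩
      refine ⟨W, fun _ x hx => ?_⟩
      exact DFunLike.congr_fun hW ⟨x, hx⟩
    · exact ⟨0, fun h => absurd h ht⟩
  choose W hW using hW
  have hev : ∀ᶠ t : ℝ in 𝓝[>] 0, t ∈ Ioo (0:ℝ) 1 := Ioo_mem_nhdsGT one_pos
  have hkey : ∀ t ∈ Ioo (0:ℝ) 1, 2 * ∫ x in Ω, W t x ≤ ∫ x, W t x ∂σ := fun t ht => by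
    refine hσ.super _ (W t).continuous fun ε hε => ?_
    refine integral_mul_lapl_nonneg (W t).continuous (h.cutTor_contDiff hε) (h.cutTor_compact hε) h.cutTor_nonneg fun x hx => ?_
    have hx := h.cutTor_tsupport hε hx
    have h1 : LocSub (fun z => Q (t • p + (1 - t) • z)) x := by
      refine LocSub.comp_affine (by linarith [ht.2]) (hQs _ ?_)
      have := hmem t ht x (subset_closure hx)
      convert this using 1; module
    refine h1.congr ?_
    filter_upwards [h.isOpen.mem_nhds hx] with z hz
    rw [hW t ht z (subset_closure hz)]
    congr 1; module
  have hσΩ : ∀ᵐ x ∂σ, x ∈ closure Ω := by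
    have : ∀ᵐ x ∂σ, x ∈ frontier Ω := hσ.null
    exact this.mono fun x hx => frontier_subset_closure hx
  have l1 : Tendsto (fun t => ∫ x, W t x ∂σ) (𝓝[>] 0) (𝓝 (∫ x, b x ∂σ)) := by
    refine tendsto_integral_filter_of_dominated_convergence (fun _ => M) ?_ ?_ (integrable_const _) ?_
    · exact Eventually.of_forall fun t => (W t).continuous.aestronglyMeasurable
    · filter_upwards [hev] with t ht
      filter_upwards [hσΩ] with x hx
      rw [hW t ht x hx]
      exact hQb _ (hmem t ht x hx)
    · filter_upwards [hb, hσΩ] with x hx hxΩ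
      refine hx.congr' ?_
      filter_upwards [hev] with t ht
      rw [hW t ht x hxΩ]
  have l2 : Tendsto (fun t => ∫ x in Ω, W t x) (𝓝[>] 0) (𝓝 (∫ x in Ω, Q x)) := by
    refine tendsto_integral_filter_of_dominated_convergence (fun _ => M) ?_ ?_ ?_ ?_
    · exact Eventually.of_forall fun t => (W t).continuous.aestronglyMeasurable
    · filter_upwards [hev] with t ht
      filter_upwards [ae_restrict_mem h.isOpen.measurableSet] with x hx
      rw [hW t ht x (subset_closure hx)]
      exact hQb _ (hmem t ht x (subset_closure hx))
    · exact integrableOn_const h.bdd.measure_lt_top.ne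
    · filter_upwards [ae_restrict_mem h.isOpen.measurableSet] with x hx
      have hcont : ContinuousAt (fun t : ℝ => Q (x + t • (p - x))) 0 := by
        refine ContinuousAt.comp (g := Q) (by simpa using hQc.continuousAt (h.isOpen.mem_nhds hx)) (by fun_prop)
      have := hcont.tendsto.mono_left (nhdsWithin_le_nhds (s := Ioi 0))
      simp only [zero_smul, add_zero] at this
      refine this.congr' ?_
      filter_upwards [hev] with t ht
      rw [hW t ht x (subset_closure hx)]
  refine le_of_tendsto_of_tendsto (l2.const_mul 2) l1 ?_
  filter_upwards [hev] with t ht using hkey t ht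

end

section

section SuppFn

variable {K : Set (Euc n)}

lemma bddAbove_inner (hK : IsBounded K) (X : Euc n) : BddAbove ((fun y => ⟪y, X⟫) '' K) := by
  obtain ⟨R, hR⟩ := hK.exists_norm_le
  refine ⟨R * ‖X‖, ?_⟩
  rintro _ ⟨y, hy, rfl⟩
  exact (real_inner_le_norm _ _).trans (mul_le_mul_of_nonneg_right (hR y hy) (norm_nonneg _))

lemma inner_le_suppFn (hK : IsBounded K) {y : Euc n} (hy : y ∈ K) (X : Euc n) : ⟪y, X⟫ ≤ suppFn K X :=
  le_csSup (bddAbove_inner hK X) ⟨y, hy, rfl⟩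

lemma suppFn_le (hne : K.Nonempty) {X : Euc n} {c : ℝ} (hc : ∀ y ∈ K, ⟪y, X⟫ ≤ c) : suppFn K X ≤ c :=
  csSup_le (hne.image _) (by rintro _ ⟨y, hy, rfl⟩; exact hc y hy)

lemma suppFn_smul (hK : IsBounded K) (hne : K.Nonempty) {c : ℝ} (hc : 0 ≤ c) (X : Euc n) :
    suppFn K (c • X) = c * suppFn K X := by
  rcases hc.eq_or_lt with rfl | hc
  · refine le_antisymm (suppFn_le hne fun y _ => by simp) ?_
    obtain ⟨y, hy⟩ := hne
    simpa using inner_le_suppFn hK hy ((0:ℝ) • X)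
  refine le_antisymm (suppFn_le hne fun y hy => ?_) ?_
  · rw [inner_smul_right]
    exact mul_le_mul_of_nonneg_left (inner_le_suppFn hK hy X) hc.le
  · rw [← le_div_iff₀' hc]
    refine suppFn_le hne fun y hy => ?_
    rw [le_div_iff₀' hc, ← inner_smul_right]
    exact inner_le_suppFn hK hy _

lemma continuous_suppFn (hK : IsBounded K) (hne : K.Nonempty) : Continuous (suppFn K) := by
  obtain ⟨R, hR⟩ := hK.exists_norm_le
  have hR0 : 0 ≤ R := by obtain ⟨y, hy⟩ := hne; exact (norm_nonneg y).trans (hR y hy)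
  have : LipschitzWith R.toNNReal (suppFn K) := by
    refine LipschitzWith.of_le_add_mul _ fun X Y => suppFn_le hne fun y hy => ?_
    have h1 : ⟪y, X⟫ = ⟪y, Y⟫ + ⟪y, X - Y⟫ := by rw [inner_sub_right]; ring
    have h2 := inner_le_suppFn hK hy Y
    have h3 := real_inner_le_norm y (X - Y)
    have h4 := mul_le_mul_of_nonneg_right (hR y hy) (norm_nonneg (X - Y))
    rw [h1, Real.coe_toNNReal _ hR0, dist_eq_norm]
    linarith
  exact this.continuous

end SuppFn

namespace Tor

variable {Ω : Set (Euc n)} {u : Euc n → ℝ}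

lemma lineDeriv_eq_zero (h : Tor Ω u) {x : Euc n} (hx : x ∉ closure Ω) (w : Euc n) : lineDeriv ℝ u x w = 0 := by
  have : u =ᶠ[𝓝 x] fun _ => 0 := by
    filter_upwards [isClosed_closure.isOpen_compl.mem_nhds hx] with z hz
    exact h.zero z fun hc => hz (subset_closure hc)
  rw [this.lineDeriv_eq]; simp [lineDeriv]

lemma integrableOn_fderiv (h : Tor Ω u) (k : Euc n → Euc n) (hk : Continuous k) :
    IntegrableOn (fun x => fderiv ℝ u x (k x)) Ω := by
  obtain ⟨C, hC⟩ := h.exists_lipschitz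
  have hm : ContinuousOn (fun x => fderiv ℝ u x (k x)) Ω :=
    ContinuousOn.clm_apply (fun x hx => ((h.smooth x hx).fderiv_right (m := 1) (by norm_num)).continuousAt.continuousWithinAt)
      hk.continuousOn
  have hd : IntegrableOn (fun x => C * ‖k x‖) Ω := h.integrableOn_of_continuous (by fun_prop)
  refine Integrable.mono' hd (hm.aestronglyMeasurable h.isOpen.measurableSet) (Eventually.of_forall fun x => ?_)
  exact ((fderiv ℝ u x).le_opNorm _).trans (mul_le_mul_of_nonneg_right (norm_fderiv_le hC x) (norm_nonneg _))

lemma integral_fderiv_coord (h : Tor Ω u) (i : Fin n) :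
    ∫ x in Ω, fderiv ℝ u x (stdv i) * x i = - ∫ x, u x := by
  obtain ⟨C, hC⟩ := h.exists_lipschitz
  obtain ⟨D, hD⟩ : ∃ D, LipschitzWith D fun x : Euc n => x i :=
    ⟨_, (EuclideanSpace.proj i : Euc n →L[ℝ] ℝ).lipschitz⟩
  have h1 := LipschitzWith.integral_lineDeriv_mul_eq (μ := volume) hD hC h.compactSupport (stdv i)
  have h2 : ∀ x : Euc n, lineDeriv ℝ (fun x : Euc n => x i) x (stdv i) = 1 := fun x => by
    have h3 : HasFDerivAt (fun x : Euc n => x i) (EuclideanSpace.proj i : Euc n →L[ℝ] ℝ) x :=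
      (EuclideanSpace.proj i : Euc n →L[ℝ] ℝ).hasFDerivAt
    rw [(h3.hasLineDerivAt _).lineDeriv]; simp
  simp only [h2, one_mul] at h1
  rw [h1, ← integral_neg, ← integral_indicator h.isOpen.measurableSet]
  refine integral_congr_ae ?_
  have hfr : ∀ᵐ x : Euc n, x ∉ frontier Ω := measure_eq_zero_iff_ae_notMem.1 (h.convex.addHaar_frontier volume)
  filter_upwards [hfr] with x hx
  by_cases hxΩ : x ∈ Ω
  · rw [indicator_of_mem hxΩ, lineDeriv_neg,
      (((h.smooth x hxΩ).differentiableAt (by norm_num)).hasFDerivAt.hasLineDerivAt _).lineDeriv]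
    ring
  · rw [indicator_of_notMem hxΩ, h.lineDeriv_eq_zero, zero_mul, neg_zero]
    intro hc
    exact hx ⟨hc, by rwa [h.isOpen.interior_eq]⟩

lemma integral_fderiv_self (h : Tor Ω u) : ∫ x in Ω, fderiv ℝ u x x = - (n * ∫ x, u x) := by
  have he : ∀ x : Euc n, fderiv ℝ u x x = ∑ i, fderiv ℝ u x (stdv i) * x i := fun x => by
    conv_lhs => rw [← sum_coord_stdv x]
    rw [map_sum, sum_coord_stdv]
    exact Finset.sum_congr rfl fun i _ => by rw [map_smul, smul_eq_mul, mul_comm]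
  simp only [he]
  rw [integral_finsetSum]
  · simp [h.integral_fderiv_coord]
  · intro i _
    have := h.integrableOn_fderiv (fun x => x i • stdv i) (by fun_prop)
    refine this.congr (Eventually.of_forall fun x => ?_)
    simp only [map_smul, smul_eq_mul, mul_comm]

lemma integral_eq (h : Tor Ω u) : ∫ x in Ω, u x = ∫ x, u x :=
  setIntegral_eq_integral_of_forall_compl_eq_zero fun x hx => h.zero x hx

/-- The gradient converges along rays wherever nontangential limits exist. -/
lemma tendsto_fderiv_ray (h : Tor Ω u) {p x : Euc n} (hp : p ∈ Ω) (hx : x ∈ frontier Ω)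
    (hlim : ∀ α > 0, Tendsto (gradient u) (𝓝[ntCone Ω x α] x) (𝓝 (ntGradient Ω u x))) :
    Tendsto (fun t : ℝ => gradient u (x + t • (p - x))) (𝓝[>] 0) (𝓝 (ntGradient Ω u x)) := by
  obtain ⟨ρ, hρ, hB⟩ := Metric.isOpen_iff.1 h.isOpen p hp
  have hpx : 0 < ‖p - x‖ := norm_pos_iff.2 (sub_ne_zero.2 fun he => h.frontier_not_mem hx (he ▸ hp))
  refine (hlim (‖p - x‖ / ρ) (by positivity)).comp (tendsto_nhdsWithin_iff.2 ⟨?_, ?_⟩)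
  · have : Continuous fun t : ℝ => x + t • (p - x) := by fun_prop
    have := (this.tendsto 0).mono_left (nhdsWithin_le_nhds (s := Ioi 0))
    simpa using this
  · filter_upwards [Ioc_mem_nhdsGT (one_pos (α := ℝ))] with t ht
    exact h.ray_mem_ntCone hρ hB hx ht

end Tor

lemma fderiv_apply_eq_inner_gradient (f : Euc n → ℝ) (x w : Euc n) : fderiv ℝ f x w = ⟪gradient f x, w⟫ := by
  rw [gradient, InnerProductSpace.toDual_symm_apply]

/-- One inequality in the representation of the torsional rigidity by the support function. -/
theorem IsTorMeasure.integral_suppFn_le {Ω : Set (Euc n)} {u : Euc n → ℝ} {σ : Measure (Euc n)} (hσ : IsTorMeasure Ω u σ)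
    (h : Tor Ω u) {μ : Measure (Euc n)} (hμ : ∀ η : Set (Euc n), MeasurableSet η → μ η = torsionMeasure Ω u η) :
    gam n * ∫ X, suppFn (closure Ω) X ∂μ ≤ 2 * (n + 2) * ∫ x, u x := by
  have hK := h.bdd.closure
  have hne := h.nonempty.closure
  obtain ⟨p, hp⟩ := h.nonempty
  obtain ⟨C, hC⟩ := h.exists_lipschitz
  obtain ⟨R, hR⟩ := hK.exists_norm_le
  obtain ⟨M, hM⟩ := h.bdd.isCompact_closure.exists_bound_of_continuousOn h.cont.continuousOn
  rw [hσ.integral_torsionMeasure h hμ (continuous_suppFn hK hne) fun c hc X => suppFn_smul hK hne hc X]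
  have hInt : ∫ x in Ω, (fderiv ℝ u x x - 2 * u x) = -((n + 2) * ∫ x, u x) := by
    have h1 : Integrable (fun x => fderiv ℝ u x x) (volume.restrict Ω) := h.integrableOn_fderiv (fun x => x) continuous_id
    have h2 : Integrable (fun x => 2 * u x) (volume.restrict Ω) := (h.integrableOn_of_continuous h.cont).const_mul 2
    rw [integral_sub h1 h2, h.integral_fderiv_self, integral_const_mul, h.integral_eq]; ring
  have key := hσ.le_integral_of_locSub h (Q := fun x => fderiv ℝ u x x - 2 * u x)
    (b := fun x => - suppFn (closure Ω) (-ntGradient Ω u x)) (M := C * R + 2 * M) (p := p) ?_ ?_ ?_ hp ?_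
  · rw [hInt, integral_neg] at key
    linarith
  · intro x hx
    have h1 := ((h.smooth x hx).fderiv_right (m := 1) (by norm_num)).continuousAt.clm_apply continuousAt_id
    exact (h1.sub (continuousAt_const.mul h.cont.continuousAt)).continuousWithinAt
  · intro x hx
    have h3 := h.contDiffAt hx
    have c1 : ContDiffAt ℝ 2 (fun z => fderiv ℝ u z z) x := (h3.fderiv_right (m := 2) (by norm_num)).clm_apply contDiffAt_id
    have c2 : ContDiffAt ℝ 2 (fun z => 2 * u z) x := contDiffAt_const.mul (h.smooth x hx)
    refine LocSub.of_contDiffAt (c1.sub c2) ?_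
    have h4 := lapl_fderiv_radial h3 (h.lapl_eventually hx) 0
    simp only [sub_zero] at h4
    rw [lapl_sub c1 c2, lapl_const_mul _ (h.smooth x hx), h4, h.lapl_eq x hx]
    norm_num
  · intro x hx
    have hxc := subset_closure hx
    have h1 : |fderiv ℝ u x x| ≤ C * R := ((fderiv ℝ u x).le_opNorm x).trans
      (mul_le_mul (Tor.norm_fderiv_le hC x) (hR x hxc) (norm_nonneg _) C.2)
    have h2 := hM x hxc
    rw [Real.norm_eq_abs] at h2
    calc |fderiv ℝ u x x - 2 * u x| ≤ |fderiv ℝ u x x| + |2 * u x| := abs_sub _ _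
      _ ≤ _ := by rw [abs_mul, abs_two]; linarith
  · have hae := (hσ.absolutelyContinuous h).ae_le (hσ.ae_ntGradient h)
    have hσf : ∀ᵐ x ∂σ, x ∈ frontier Ω := hσ.null
    filter_upwards [hae, hσf] with x hx hxf
    obtain ⟨hun, hlim, hG, -⟩ := hx
    have hray := h.tendsto_fderiv_ray hp hxf hlim
    have hsupp : suppFn (closure Ω) (-ntGradient Ω u x) = ⟪x, -ntGradient Ω u x⟫ := by
      refine le_antisymm (suppFn_le hne fun y hy => ?_) (inner_le_suppFn hK (frontier_subset_closure hxf) _)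
      rw [hG, neg_neg, inner_smul_right, inner_smul_right]
      exact mul_le_mul_of_nonneg_left (hun.normal.2 y hy) (norm_nonneg _)
    rw [hsupp, inner_neg_right, neg_neg]
    have hpt : Tendsto (fun t : ℝ => x + t • (p - x)) (𝓝[>] 0) (𝓝 x) := by
      have : Continuous fun t : ℝ => x + t • (p - x) := by fun_prop
      have := (this.tendsto 0).mono_left (nhdsWithin_le_nhds (s := Ioi 0))
      simpa using this
    have l1 := hpt.inner (𝕜 := ℝ) hray
    have l2 := ((h.cont.tendsto x).comp hpt).const_mul 2
    rw [h.zero x (h.frontier_not_mem hxf), mul_zero] at l2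
    have l3 := l1.sub l2
    rw [sub_zero] at l3
    refine l3.congr fun t => ?_
    rw [fderiv_apply_eq_inner_gradient, real_inner_comm]; rfl

end

section

/-- The kernel whose supremum over `y` couples two torsion functions. -/
def coup (u v : Euc n → ℝ) (x y : Euc n) : ℝ := 2 * √(u x) * √(v y) - fderiv ℝ u x y

/-- The supremum of the coupling kernel over a set. -/
def coupSup (u v : Euc n → ℝ) (K : Set (Euc n)) (x : Euc n) : ℝ := sSup (coup u v x '' K)

section Coupling

variable {Ω Ω' : Set (Euc n)} {u v : Euc n → ℝ}

lemma continuous_coup (hv : Continuous v) (x : Euc n) : Continuous (coup u v x) := by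
  unfold coup; fun_prop

lemma coup_le_coupSup (hv : Continuous v) {K : Set (Euc n)} (hK : IsCompact K) (x : Euc n) {y : Euc n} (hy : y ∈ K) :
    coup u v x y ≤ coupSup u v K x :=
  le_csSup (hK.image (continuous_coup hv x)).bddAbove ⟨y, hy, rfl⟩

lemma exists_coupSup_eq (hv : Continuous v) {K : Set (Euc n)} (hK : IsCompact K) (hne : K.Nonempty) (x : Euc n) :
    ∃ y ∈ K, coupSup u v K x = coup u v x y := by
  obtain ⟨y, hy, hm⟩ := hK.exists_isMaxOn hne (continuous_coup (u := u) hv x).continuousOn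
  refine ⟨y, hy, le_antisymm (csSup_le (hne.image _) ?_) (coup_le_coupSup hv hK x hy)⟩
  rintro _ ⟨z, hz, rfl⟩
  exact hm hz

lemma Tor.continuousOn_coupSup (h : Tor Ω u) (hv : Continuous v) {K : Set (Euc n)} (hK : IsCompact K) (hne : K.Nonempty) :
    ContinuousOn (coupSup u v K) Ω := by
  obtain ⟨G, hG⟩ := hK.exists_bound_of_continuousOn (f := fun y => √(v y)) (by fun_prop)
  obtain ⟨R, hR⟩ := hK.isBounded.exists_norm_le
  have hle : ∀ x x', coupSup u v K x' - coupSup u v K x ≤ 2 * |√(u x') - √(u x)| * G + ‖fderiv ℝ u x' - fderiv ℝ u x‖ * R := by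
    intro x x'
    obtain ⟨y, hy, he⟩ := exists_coupSup_eq (u := u) hv hK hne x'
    have h1 := coup_le_coupSup (u := u) hv hK x hy
    have h2 : coup u v x' y - coup u v x y = 2 * ((√(u x') - √(u x)) * √(v y)) - (fderiv ℝ u x' - fderiv ℝ u x) y := by
      simp only [coup, _root_.sub_apply]; ring
    have h3 : (√(u x') - √(u x)) * √(v y) ≤ |√(u x') - √(u x)| * G := by
      have := hG y hy
      rw [Real.norm_of_nonneg (Real.sqrt_nonneg _)] at this
      exact (mul_le_mul_of_nonneg_right (le_abs_self _) (Real.sqrt_nonneg _)).trans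
        (mul_le_mul_of_nonneg_left this (abs_nonneg _))
    have h4 : -((fderiv ℝ u x' - fderiv ℝ u x) y) ≤ ‖fderiv ℝ u x' - fderiv ℝ u x‖ * R :=
      (neg_le_abs _).trans (((fderiv ℝ u x' - fderiv ℝ u x).le_opNorm y).trans
        (mul_le_mul_of_nonneg_left (hR y hy) (norm_nonneg _)))
    rw [he]
    linarith
  intro x hx
  refine ContinuousAt.continuousWithinAt ?_
  have c1 : ContinuousAt (fun z => √(u z)) x := (h.cont.sqrt).continuousAt
  have c2 : ContinuousAt (fderiv ℝ u) x := ((h.smooth x hx).fderiv_right (m := 1) (by norm_num)).continuousAt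
  have c3 : ContinuousAt (fun z => 2 * |√(u z) - √(u x)| * G + ‖fderiv ℝ u z - fderiv ℝ u x‖ * R) x := by fun_prop
  have l3 := c3.tendsto
  simp only [sub_self, abs_zero, norm_zero, mul_zero, zero_mul, add_zero] at l3
  rw [ContinuousAt, tendsto_iff_dist_tendsto_zero]
  refine squeeze_zero (fun _ => dist_nonneg) (fun z => ?_) l3
  rw [Real.dist_eq, abs_le]
  have h1 := hle z x
  rw [abs_sub_comm, norm_sub_rev] at h1
  exact ⟨by linarith, hle x z⟩

lemma secDiff_coup (x w y : Euc n) (s : ℝ) : secDiff (fun z => coup u v z y) x w s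
    = 2 * √(v y) * secDiff (fun z => √(u z)) x w s - ∑ j, y j * secDiff (fun z => fderiv ℝ u z (stdv j)) x w s := by
  have he : ∀ z : Euc n, fderiv ℝ u z y = ∑ j, y j * fderiv ℝ u z (stdv j) := fun z => by
    conv_lhs => rw [← sum_coord_stdv y]
    simp
  simp only [secDiff, coup, he, mul_sub, mul_add, Finset.sum_add_distrib, Finset.sum_sub_distrib, Finset.mul_sum]
  simp only [mul_left_comm _ (2:ℝ)]
  ring

lemma Tor.coupSup_semi (h : Tor Ω u) (hv : Continuous v) {K : Set (Euc n)} (hK : IsCompact K) (hne : K.Nonempty) {x : Euc n}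
    (hx : x ∈ Ω) :
    ∃ C ≥ 0, ∃ s₀ > 0, ∀ᶠ y in 𝓝 x, ∀ s ∈ Ioo 0 s₀, ∀ i, -(C * s ^ 2) ≤ secDiff (coupSup u v K) y (stdv i) s := by
  obtain ⟨G, hG⟩ := hK.exists_bound_of_continuousOn (f := fun y => √(v y)) (by fun_prop)
  obtain ⟨R, hR⟩ := hK.isBounded.exists_norm_le
  have hG0 : 0 ≤ G := by obtain ⟨y, hy⟩ := hne; exact (norm_nonneg _).trans (hG y hy)
  have hR0 : 0 ≤ R := by obtain ⟨y, hy⟩ := hne; exact (norm_nonneg y).trans (hR y hy)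
  obtain ⟨C₀, hC₀, s₀, hs₀, h₀⟩ := eventually_abs_secDiff_le (h.contDiffAt_sqrt hx)
  have hj : ∀ j : Fin n, ∃ C ≥ 0, ∃ s₀ > 0, ∀ᶠ y in 𝓝 x, ∀ s ∈ Ioo 0 s₀, ∀ i,
      |secDiff (fun z => fderiv ℝ u z (stdv j)) y (stdv i) s| ≤ C * s ^ 2 := fun j =>
    eventually_abs_secDiff_le (contDiffAt_fderiv_apply (h.contDiffAt hx) (by norm_num) _)
  choose C hC r hr hb using hj
  have : Nonempty (Fin n) := ⟨⟨0, h.pos_n⟩⟩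
  obtain ⟨j₀, hj₀⟩ := Finite.exists_min r
  refine ⟨2 * G * C₀ + ∑ j, R * C j, add_nonneg (by positivity) (Finset.sum_nonneg fun j _ => mul_nonneg hR0 (hC j)),
    min s₀ (r j₀), lt_min hs₀ (hr _), ?_⟩
  filter_upwards [h₀, eventually_all.2 hb] with y h1 h2 s hs i
  obtain ⟨z, hz, he⟩ := exists_coupSup_eq (u := u) hv hK hne y
  have h3 : secDiff (fun q => coup u v q z) y (stdv i) s ≤ secDiff (coupSup u v K) y (stdv i) s := by
    have e1 := coup_le_coupSup (u := u) hv hK (y + s • stdv i) hz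
    have e2 := coup_le_coupSup (u := u) hv hK (y - s • stdv i) hz
    simp only [secDiff, he]; linarith
  refine le_trans ?_ h3
  rw [secDiff_coup, add_mul, Finset.sum_mul]
  have h4 : -(2 * G * C₀ * s ^ 2) ≤ 2 * √(v z) * secDiff (fun z => √(u z)) y (stdv i) s := by
    have e1 := h1 s ⟨hs.1, hs.2.trans_le (min_le_left _ _)⟩ i
    have e2 := hG z hz
    rw [Real.norm_of_nonneg (Real.sqrt_nonneg _)] at e2
    have e3 : |√(v z) * secDiff (fun z => √(u z)) y (stdv i) s| ≤ G * (C₀ * s ^ 2) := by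
      rw [abs_mul, abs_of_nonneg (Real.sqrt_nonneg _)]
      exact mul_le_mul e2 e1 (abs_nonneg _) hG0
    have := (abs_le.1 e3).1
    linarith
  have h5 : ∑ j, z j * secDiff (fun z => fderiv ℝ u z (stdv j)) y (stdv i) s ≤ ∑ j, R * C j * s ^ 2 := by
    refine Finset.sum_le_sum fun j _ => ?_
    have e1 := h2 j s ⟨hs.1, hs.2.trans_le ((min_le_right _ _).trans (hj₀ j))⟩ i
    have e2 : |z j| ≤ R := by
      rw [← Real.norm_eq_abs]; exact (PiLp.norm_apply_le z j).trans (hR z hz)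
    calc _ ≤ |z j * secDiff (fun z => fderiv ℝ u z (stdv j)) y (stdv i) s| := le_abs_self _
      _ ≤ R * (C j * s ^ 2) := by rw [abs_mul]; exact mul_le_mul e2 e1 (abs_nonneg _) hR0
      _ = _ := by ring
  linarith

lemma Tor.lapl_fderiv_const (h : Tor Ω u) {x : Euc n} (hx : x ∈ Ω) (w : Euc n) : lapl (fun z => fderiv ℝ u z w) x = 0 := by
  rw [lapl_fderiv (h.contDiffAt hx), (h.lapl_eventually hx).fderiv_eq]; simp

lemma Tor.fderiv_eq_sqrt (h : Tor Ω u) {x : Euc n} (hx : x ∈ Ω) (w : Euc n) :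
    fderiv ℝ u x w = 2 * √(u x) * fderiv ℝ (fun z => √(u z)) x w := by
  have h1 : u =ᶠ[𝓝 x] fun z => √(u z) * √(u z) := Eventually.of_forall fun z => (Real.mul_self_sqrt (h.nonneg z)).symm
  have d := (h.contDiffAt_sqrt hx).differentiableAt (by norm_num)
  rw [h1.fderiv_eq, fderiv_fun_mul d d]
  simp; ring

lemma Tor.coupSup_touch (h : Tor Ω u) (h' : Tor Ω' v) {x : Euc n} (hx : x ∈ Ω) :
    ∃ m : Euc n → ℝ, ContDiffAt ℝ 2 m x ∧ 0 ≤ lapl m x ∧ m x = coupSup u v (closure Ω') x ∧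
      ∀ᶠ y in 𝓝 x, m y ≤ coupSup u v (closure Ω') y := by
  have hK := h'.bdd.isCompact_closure
  obtain ⟨y, hy, he⟩ := exists_coupSup_eq (u := u) h'.cont hK h'.nonempty.closure x
  have hcd : ∀ w, ContDiffAt ℝ 2 (fun z => fderiv ℝ u z w) x := fun w =>
    contDiffAt_fderiv_apply (h.contDiffAt hx) (by norm_num) w
  by_cases hyΩ : y ∈ Ω'
  swap
  · refine ⟨fun z => - fderiv ℝ u z y, (hcd y).neg, ?_, ?_, Eventually.of_forall fun z => ?_⟩
    · rw [lapl_neg, h.lapl_fderiv_const hx, neg_zero]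
    · rw [he, coup, h'.sqrt_zero hyΩ]; ring
    · have := coup_le_coupSup (u := u) h'.cont hK z hy
      rw [coup, h'.sqrt_zero hyΩ] at this
      linarith
  have hf := h.sqrt_pos hx
  have hg := h'.sqrt_pos hyΩ
  set β := √(v y) / √(u x) with hβ
  set q := y - β • x with hq
  have hqx : q + β • x = y := by rw [hq]; abel
  have cf := h.contDiffAt_sqrt hx
  have cg := h'.contDiffAt_sqrt hyΩ
  have cg' : ContDiffAt ℝ 2 (fun z => √(v (q + β • z))) x := by
    refine contDiffAt_comp_affine (f := fun z => √(v z)) ?_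
    rwa [hqx]
  have c1 : ContDiffAt ℝ 2 (fun z => √(u z) * √(v (q + β • z))) x := cf.mul cg'
  have c2 : ContDiffAt ℝ 2 (fun z => fderiv ℝ u z (z - x)) x :=
    ((h.contDiffAt hx).fderiv_right (m := 2) (by norm_num)).clm_apply (contDiffAt_id.sub contDiffAt_const)
  have c3 : ContDiffAt ℝ 2 (fun z => 2 * (√(u z) * √(v (q + β • z)))) x := contDiffAt_const.mul c1
  have c4 : ContDiffAt ℝ 2 (fun z => β * fderiv ℝ u z (z - x)) x := contDiffAt_const.mul c2
  have hopt : fderiv ℝ (fun z => √(v z)) y = fderiv ℝ (fun z => √(u z)) x := by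
    have hmax : IsLocalMax (coup u v x) y := by
      filter_upwards [h'.isOpen.mem_nhds hyΩ] with z hz
      rw [← he]
      exact coup_le_coupSup h'.cont hK x (subset_closure hz)
    have d1 : HasFDerivAt (coup u v x) ((2 * √(u x)) • fderiv ℝ (fun z => √(v z)) y - fderiv ℝ u x) y :=
      ((cg.differentiableAt (by norm_num)).hasFDerivAt.const_mul (2 * √(u x))).sub (fderiv ℝ u x).hasFDerivAt
    have d2 := hmax.hasFDerivAt_eq_zero d1
    ext w
    have d3 := DFunLike.congr_fun d2 w
    simp only [_root_.sub_apply, _root_.smul_apply, _root_.zero_apply, smul_eq_mul, h.fderiv_eq_sqrt hx] at d3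
    have d4 : (2 * √(u x)) * (fderiv ℝ (fun z => √(v z)) y w - fderiv ℝ (fun z => √(u z)) x w) = 0 := by linarith
    have := (mul_eq_zero.1 d4).resolve_left (by positivity)
    linarith
  refine ⟨fun z => 2 * (√(u z) * √(v (q + β • z))) - fderiv ℝ u z y - β * fderiv ℝ u z (z - x),
    (c3.sub (hcd y)).sub c4, ?_, ?_, ?_⟩
  · have hD : ∀ i, fderiv ℝ (fun z => √(v (q + β • z))) x (stdv i) = β * fderiv ℝ (fun z => √(u z)) x (stdv i) := fun i => by
      have d0 : HasFDerivAt (fun z => √(v z)) (fderiv ℝ (fun z => √(v z)) y) (q + β • x) := by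
        rw [hqx]; exact (cg.differentiableAt (by norm_num)).hasFDerivAt
      have d1 : HasFDerivAt (fun z : Euc n => q + β • z) (β • ContinuousLinearMap.id ℝ (Euc n)) x :=
        ((hasFDerivAt_id x).const_smul β).const_add q
      have d2 : HasFDerivAt (fun z => √(v (q + β • z)))
          ((fderiv ℝ (fun z => √(v z)) y).comp (β • ContinuousLinearMap.id ℝ (Euc n))) x := HasFDerivAt.comp (g := fun z => √(v z)) x d0 d1
      rw [d2.fderiv, hopt]
      simp
    rw [lapl_sub (c3.sub (hcd y)) c4, lapl_sub c3 (hcd y), lapl_const_mul _ c1, lapl_const_mul _ c2, lapl_mul cf cg',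
      h.lapl_fderiv_const hx, lapl_fderiv_radial (h.contDiffAt hx) (h.lapl_eventually hx),
      lapl_comp_affine (f := fun z => √(v z)) β q x (by rwa [hqx]), hqx]
    have hs : ∑ i, fderiv ℝ (fun z => √(u z)) x (stdv i) * fderiv ℝ (fun z => √(v (q + β • z))) x (stdv i)
        = β * ‖fderiv ℝ (fun z => √(u z)) x‖ ^ 2 := by
      rw [← sum_fderiv_sq, Finset.mul_sum]
      exact Finset.sum_congr rfl fun i _ => by rw [hD]; ring
    rw [hs]
    have e1 := h.sqrt_lapl hx
    have e2 := h'.sqrt_lapl hyΩ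
    rw [hopt] at e2
    have hβf : √(v y) = β * √(u x) := by rw [hβ]; field_simp
    have e3 : lapl (fun z => √(u z)) x * √(v y) = -β * (1 + ‖fderiv ℝ (fun z => √(u z)) x‖ ^ 2) := by
      rw [hβf]; linear_combination β * e1
    have e4 : √(u x) * (β ^ 2 * lapl (fun z => √(v z)) y) = -β * (1 + ‖fderiv ℝ (fun z => √(u z)) x‖ ^ 2) := by
      rw [hβf] at e2; linear_combination β * e2
    rw [e3, e4]
    apply le_of_eq; ring
  · simp only [hqx, he, coup, sub_self, map_zero]; ring
  · have hc : Continuous fun z : Euc n => q + β • z := by fun_prop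
    have hev : ∀ᶠ z in 𝓝 x, q + β • z ∈ Ω' := hc.continuousAt.eventually_mem (by rw [hqx]; exact h'.isOpen.mem_nhds hyΩ)
    filter_upwards [hev] with z hz
    refine le_of_eq_of_le ?_ (coup_le_coupSup (u := u) h'.cont hK z (subset_closure hz))
    have : q + β • z = y + β • (z - x) := by rw [hq]; module
    rw [coup, this, map_add, map_smul, smul_eq_mul]; ring

/-- The mixed inequality between two torsion functions. -/
theorem IsTorMeasure.integral_coupSup_le {σ : Measure (Euc n)} (hσ : IsTorMeasure Ω u σ)
    (h : Tor Ω u) {μ : Measure (Euc n)} (hμ : ∀ η : Set (Euc n), MeasurableSet η → μ η = torsionMeasure Ω u η) (h' : Tor Ω' v) :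
    2 * ∫ x in Ω, coupSup u v (closure Ω') x ≤ gam n * ∫ X, suppFn (closure Ω') X ∂μ := by
  have hKc := h'.bdd.isCompact_closure
  have hK := h'.bdd.closure
  have hne := h'.nonempty.closure
  obtain ⟨p, hp⟩ := h.nonempty
  obtain ⟨C, hC⟩ := h.exists_lipschitz
  obtain ⟨R, hR⟩ := hK.exists_norm_le
  obtain ⟨F, hF⟩ := h.bdd.isCompact_closure.exists_bound_of_continuousOn (h.cont.sqrt).continuousOn
  obtain ⟨G, hG⟩ := hKc.exists_bound_of_continuousOn (h'.cont.sqrt).continuousOn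
  rw [hσ.integral_torsionMeasure h hμ (continuous_suppFn hK hne) fun c hc X => suppFn_smul hK hne hc X]
  refine hσ.le_integral_of_locSub h (M := 2 * F * G + C * R) (h.continuousOn_coupSup h'.cont hKc hne)
    (fun x hx => ⟨h.coupSup_semi h'.cont hKc hne hx, h.coupSup_touch h' hx⟩) ?_ hp ?_
  · intro x hx
    obtain ⟨y, hy, he⟩ := exists_coupSup_eq (u := u) h'.cont hKc hne x
    have h1 : |fderiv ℝ u x y| ≤ C * R := ((fderiv ℝ u x).le_opNorm y).trans
      (mul_le_mul (Tor.norm_fderiv_le hC x) (hR y hy) (norm_nonneg _) C.2)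
    have h2 := hF x (subset_closure hx)
    have h3 := hG y hy
    rw [Real.norm_of_nonneg (Real.sqrt_nonneg _)] at h2 h3
    have h4 : |2 * √(u x) * √(v y)| ≤ 2 * F * G := by
      rw [abs_of_nonneg (by positivity), mul_assoc, mul_assoc]
      have := mul_le_mul h2 h3 (Real.sqrt_nonneg _) ((Real.sqrt_nonneg _).trans h2)
      linarith
    rw [he, coup]
    exact (abs_sub _ _).trans (add_le_add h4 h1)
  · have hae := (hσ.absolutelyContinuous h).ae_le (hσ.ae_ntGradient h)
    have hσf : ∀ᵐ x ∂σ, x ∈ frontier Ω := hσ.null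
    filter_upwards [hae, hσf] with x hx hxf
    have hray := h.tendsto_fderiv_ray hp hxf hx.2.1
    have l1 := ((continuous_suppFn hK hne).tendsto _).comp hray.neg
    have hpt : Tendsto (fun t : ℝ => x + t • (p - x)) (𝓝[>] 0) (𝓝 x) := by
      have : Continuous fun t : ℝ => x + t • (p - x) := by fun_prop
      have := (this.tendsto 0).mono_left (nhdsWithin_le_nhds (s := Ioi 0))
      simpa using this
    have l2 := ((h.cont.sqrt.tendsto x).comp hpt).const_mul (2 * G)
    rw [h.sqrt_zero (h.frontier_not_mem hxf), mul_zero] at l2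
    have l3 := l1.add l2
    rw [add_zero] at l3
    refine tendsto_of_tendsto_of_tendsto_of_le_of_le l1 l3 (fun t => ?_) fun t => ?_
    · refine suppFn_le hne fun y hy => ?_
      have h1 := coup_le_coupSup (u := u) h'.cont hKc (x + t • (p - x)) hy
      rw [coup, fderiv_apply_eq_inner_gradient] at h1
      rw [inner_neg_right, real_inner_comm]
      have h2 : 0 ≤ 2 * √(u (x + t • (p - x))) * √(v y) := by positivity
      linarith
    · obtain ⟨y, hy, he⟩ := exists_coupSup_eq (u := u) h'.cont hKc hne (x + t • (p - x))
      have h1 := inner_le_suppFn hK hy (-gradient u (x + t • (p - x)))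
      have h3 := hG y hy
      rw [Real.norm_of_nonneg (Real.sqrt_nonneg _)] at h3
      rw [inner_neg_right, real_inner_comm] at h1
      have h4 := mul_le_mul_of_nonneg_left h3 (Real.sqrt_nonneg (u (x + t • (p - x))))
      simp only [Function.comp_apply]
      rw [he, coup, fderiv_apply_eq_inner_gradient]
      linarith

end Coupling

end

section

section Transport

variable {A B : ℝ → ℝ}

/-- The distribution function of a compactly supported density with interval support. -/
lemma exists_cdf (hc : Continuous B) (h0 : ∀ t, 0 ≤ B t) (hs : HasCompactSupport B) (hJ : OrdConnected {t | 0 < B t}) :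
    ∃ N : ℝ → ℝ, (∀ t, HasDerivAt N (B t) t) ∧ Monotone N ∧ (∀ t, 0 < B t ↔ 0 < N t ∧ N t < ∫ s, B s) ∧
      ∀ w ∈ Ioo 0 (∫ s, B s), ∃ t, N t = w := by
  obtain ⟨R, hR0, hR⟩ : ∃ R > 0, ∀ t, 0 < B t → t ∈ Ioo (-R) R := by
    obtain ⟨R, hR⟩ := hs.isCompact.isBounded.exists_norm_le
    refine ⟨|R| + 1, by positivity, fun t ht => ?_⟩
    have h1 := hR t (subset_tsupport _ ht.ne')
    rw [Real.norm_eq_abs] at h1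
    exact abs_lt.1 (h1.trans_lt ((le_abs_self R).trans_lt (lt_add_one _)))
  have hi : ∀ a b, IntervalIntegrable B volume a b := fun a b => hc.intervalIntegrable a b
  set N : ℝ → ℝ := fun t => ∫ s in (-R)..t, B s with hN
  have hd : ∀ t, HasDerivAt N (B t) t := fun t =>
    intervalIntegral.integral_hasDerivAt_right (hi _ _) (hc.stronglyMeasurableAtFilter _ _) hc.continuousAt
  have hm : Monotone N := monotone_of_deriv_nonneg (fun t => (hd t).differentiableAt) fun t => by
    rw [(hd t).deriv]; exact h0 t
  have hsub : ∀ a b, N b - N a = ∫ s in a..b, B s := fun a b =>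
    intervalIntegral.integral_interval_sub_left (hi _ _) (hi _ _)
  have hNl : N (-R) = 0 := intervalIntegral.integral_same
  have hNr : N R = ∫ s, B s := by
    refine intervalIntegral.integral_eq_integral_of_support_subset fun t ht => ?_
    exact Ioo_subset_Ioc_self (hR t ((h0 t).lt_of_ne' ht))
  have hpos : ∀ t, 0 < B t → (∃ t₁ < t, 0 < B t₁ ∧ N t₁ < N t) ∧ ∃ t₂ > t, 0 < B t₂ ∧ N t < N t₂ := by
    intro t ht
    obtain ⟨δ, hδ, hB⟩ := Metric.isOpen_iff.1 (isOpen_lt continuous_const hc) t ht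
    rw [Real.ball_eq_Ioo] at hB
    refine ⟨⟨t - δ / 2, by linarith, hB ⟨by linarith, by linarith⟩, ?_⟩, t + δ / 2, by linarith, hB ⟨by linarith, by linarith⟩, ?_⟩
    · rw [← sub_pos, hsub]
      exact intervalIntegral.intervalIntegral_pos_of_pos_on (hi _ _) (fun x hx => hB ⟨by linarith [hx.1], by linarith [hx.2]⟩) (by linarith)
    · rw [← sub_pos, hsub]
      exact intervalIntegral.intervalIntegral_pos_of_pos_on (hi _ _) (fun x hx => hB ⟨by linarith [hx.1], by linarith [hx.2]⟩) (by linarith)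
  refine ⟨N, hd, hm, fun t => ⟨fun ht => ?_, fun ht => ?_⟩, fun w hw => ?_⟩
  · obtain ⟨⟨t₁, -, hB₁, h₁⟩, t₂, -, hB₂, h₂⟩ := hpos t ht
    have e1 := hm (hR t₁ hB₁).1.le
    have e2 := hm (hR t₂ hB₂).2.le
    rw [hNl] at e1
    rw [hNr] at e2
    exact ⟨by linarith, by linarith⟩
  · by_contra hn
    have hBt : B t = 0 := le_antisymm (not_lt.1 hn) (h0 t)
    have hzero : ∀ a b, a ≤ b → (∀ s ∈ Icc a b, B s = 0) → N b = N a := fun a b hab hz => by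
      have := hsub a b
      rw [intervalIntegral.integral_congr (g := fun _ => 0) (fun s hs => hz s (by rwa [uIcc_of_le hab] at hs))] at this
      simp at this; linarith
    by_cases hl : ∃ t₁ < t, 0 < B t₁
    · obtain ⟨t₁, ht₁, hB₁⟩ := hl
      have hz : ∀ s ∈ Icc t R, B s = 0 := fun s hs => by
        by_contra hne
        exact hn (hJ.out hB₁ ((h0 s).lt_of_ne' hne) ⟨ht₁.le, hs.1⟩)
      rcases le_total t R with htR | htR
      · have := hzero t R htR hz
        rw [hNr] at this; linarith [ht.2]
      · have := hm htR
        rw [hNr] at this; linarith [ht.2]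
    · push Not at hl
      rcases le_total (-R) t with htR | htR
      · have := hzero (-R) t htR fun s hs => by
          rcases hs.2.eq_or_lt with rfl | hlt
          · exact hBt
          · exact le_antisymm (hl s hlt) (h0 s)
        rw [hNl] at this; linarith [ht.1]
      · have := hm htR
        rw [hNl] at this; linarith [ht.1]
  · have hcN : Continuous N := continuous_iff_continuousAt.2 fun t => (hd t).continuousAt
    have := intermediate_value_Icc (by linarith : -R ≤ R) hcN.continuousOn
    rw [hNl, hNr] at this
    obtain ⟨t, -, ht⟩ := this (Ioo_subset_Icc_self hw)
    exact ⟨t, ht⟩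

/-- Monotone transport between two densities on the line. -/
lemma exists_transport (hAc : Continuous A) (hA0 : ∀ t, 0 ≤ A t) (hAs : HasCompactSupport A) (hI : OrdConnected {t | 0 < A t})
    (hBc : Continuous B) (hB0 : ∀ t, 0 ≤ B t) (hBs : HasCompactSupport B) (hJ : OrdConnected {t | 0 < B t})
    {τ : ℝ} (hτ : 0 < τ) (hAB : τ * ∫ s, A s = ∫ s, B s) :
    ∃ y : ℝ → ℝ, (∀ x, 0 < A x → 0 < B (y x) ∧ HasDerivAt y (τ * A x / B (y x)) x) ∧
      ∀ t, 0 < B t → ∃ x, 0 < A x ∧ y x = t := by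
  obtain ⟨F, hFd, hFm, hFI, hFs⟩ := exists_cdf hAc hA0 hAs hI
  obtain ⟨N, hNd, hNm, hNJ, hNs⟩ := exists_cdf hBc hB0 hBs hJ
  have hw : ∀ x, 0 < A x → τ * F x ∈ Ioo 0 (∫ s, B s) := fun x hx => by
    obtain ⟨h1, h2⟩ := (hFI x).1 hx
    rw [← hAB]
    exact ⟨mul_pos hτ h1, mul_lt_mul_of_pos_left h2 hτ⟩
  have hex : ∀ x, ∃ t, 0 < A x → N t = τ * F x := fun x => by
    by_cases hx : 0 < A x
    · obtain ⟨t, ht⟩ := hNs _ (hw x hx)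
      exact ⟨t, fun _ => ht⟩
    · exact ⟨0, fun h => absurd h hx⟩
  choose y hy using hex
  have hyJ : ∀ x, 0 < A x → 0 < B (y x) := fun x hx => by
    rw [hNJ, hy x hx]; exact hw x hx
  have hmono : StrictMonoOn N {t | 0 < B t} :=
    strictMonoOn_of_deriv_pos hJ.convex (fun t _ => (hNd t).continuousAt.continuousWithinAt) fun t ht => by
      have ht' : t ∈ {t | 0 < B t} := interior_subset ht
      rw [(hNd t).deriv]; exact ht'
  refine ⟨y, fun x hx => ⟨hyJ x hx, ?_⟩, fun t ht => ?_⟩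
  · have hopen : IsOpen {t | 0 < B t} := isOpen_lt continuous_const hBc
    have hAev : ∀ᶠ z in 𝓝 x, 0 < A z := (isOpen_lt continuous_const hAc).mem_nhds hx
    have hFc : ContinuousAt (fun z => τ * F z) x := (hFd x).continuousAt.const_mul τ
    have hyc : ContinuousAt y x := by
      rw [Metric.continuousAt_iff']
      intro ε hε
      obtain ⟨δ, hδ, hB⟩ := Metric.isOpen_iff.1 hopen (y x) (hyJ x hx)
      set r := min (δ / 2) (ε / 2) with hr
      have hr0 : 0 < r := lt_min (by positivity) (by positivity)
      have hrδ : r < δ := (min_le_left _ _).trans_lt (by linarith)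
      have hrε : r < ε := (min_le_right _ _).trans_lt (by linarith)
      rw [Real.ball_eq_Ioo] at hB
      have h1 : N (y x - r) < τ * F x := by
        rw [← hy x hx]; exact hmono (hB ⟨by linarith, by linarith⟩) (hyJ x hx) (by linarith)
      have h2 : τ * F x < N (y x + r) := by
        rw [← hy x hx]; exact hmono (hyJ x hx) (hB ⟨by linarith, by linarith⟩) (by linarith)
      filter_upwards [hAev, hFc.eventually (lt_mem_nhds h1), hFc.eventually (gt_mem_nhds h2)] with z hz h3 h4
      rw [← hy z hz] at h3 h4
      have h5 := hNm.reflect_lt h3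
      have h6 := hNm.reflect_lt h4
      rw [Real.dist_eq, abs_lt]
      exact ⟨by linarith, by linarith⟩
    have hne := (hyJ x hx).ne'
    have hsl : Tendsto (fun z => dslope N (y x) (y z)) (𝓝 x) (𝓝 (B (y x))) := by
      have h1 : ContinuousAt (dslope N (y x)) (y x) := continuousAt_dslope_same.2 (hNd _).differentiableAt
      have h2 := h1.tendsto.comp hyc
      rw [dslope_same, (hNd _).deriv] at h2
      exact h2
    rw [hasDerivAt_iff_tendsto_slope]
    have h3 := (hasDerivAt_iff_tendsto_slope.1 ((hFd x).const_mul τ)).div (hsl.mono_left nhdsWithin_le_nhds) hne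
    refine h3.congr' ?_
    filter_upwards [nhdsWithin_le_nhds hAev, self_mem_nhdsWithin] with z hz hzx
    have hzx : z - x ≠ 0 := sub_ne_zero.2 hzx
    by_cases he : y z = y x
    · have h4 : τ * F z = τ * F x := by rw [← hy z hz, ← hy x hx, he]
      simp [slope_def_field, he, h4]
    · have he' := sub_ne_zero.2 he
      simp only [Pi.div_apply]
      rw [dslope_of_ne _ he, slope_def_field, slope_def_field, slope_def_field, ← hy z hz, ← hy x hx]
      have h5 : N (y z) - N (y x) ≠ 0 := by
        rw [sub_ne_zero]
        exact fun hc => he (hmono.injOn (hyJ z hz) (hyJ x hx) hc)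
      field_simp
  · obtain ⟨h1, h2⟩ := (hNJ t).1 ht
    have hwt : N t / τ ∈ Ioo 0 (∫ s, A s) := by
      refine ⟨by positivity, ?_⟩
      rw [div_lt_iff₀' hτ, hAB]; exact h2
    obtain ⟨x, hx⟩ := hFs _ hwt
    have hxI : 0 < A x := by rw [hFI, hx]; exact hwt
    refine ⟨x, hxI, hmono.injOn (hyJ x hxI) ht ?_⟩
    rw [hy x hxI, hx]; field_simp

end Transport

end

section

/-- Weighted Bernoulli inequality with its equality case. -/
lemma bernoulli_weighted {k : ℕ} (hk : 1 ≤ k) {s C : ℝ} (hs : 0 < s) (hC : 0 < C) :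
    (k + 1) * C ≤ C ^ (k + 1) / s ^ k + k * s ∧ ((k + 1) * C = C ^ (k + 1) / s ^ k + k * s → s = C) := by
  have key : C ^ (k + 1) / s ^ k = s * (C / s) ^ (k + 1) := by
    rw [div_pow, pow_succ s k]
    field_simp
  have hz : -1 ≤ C / s - 1 := by linarith [div_pos hC hs]
  have hp : (1 : ℝ) < ((k + 1 : ℕ) : ℝ) := by
    have : (1 : ℝ) ≤ k := by exact_mod_cast hk
    push_cast; linarith
  have hmul : s * (C / s) = C := by field_simp
  have hstrict : C / s - 1 ≠ 0 → (k + 1) * C < C ^ (k + 1) / s ^ k + k * s := fun h => by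
    have h1 := one_add_mul_self_lt_rpow_one_add hz h hp
    rw [Real.rpow_natCast, add_sub_cancel, Nat.cast_add_one] at h1
    rw [key]
    nlinarith [mul_lt_mul_of_pos_left h1 hs]
  by_cases h : C / s - 1 = 0
  · have hsC : C = s := by
      rw [sub_eq_zero, div_eq_one_iff_eq hs.ne'] at h; exact h
    subst hsC
    refine ⟨le_of_eq ?_, fun _ => rfl⟩
    rw [key, div_self hs.ne']; ring
  · exact ⟨(hstrict h).le, fun he => absurd he (hstrict h).ne⟩

/-- A nonempty bounded open order-connected set of reals is an open interval. -/
lemma exists_eq_Ioo {I : Set ℝ} (ho : IsOpen I) (hb : IsBounded I) (hI : OrdConnected I) (hne : I.Nonempty) :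
    ∃ α β, α < β ∧ I = Ioo α β := by
  obtain ⟨hbb, hba⟩ := isBounded_iff_bddBelow_bddAbove.1 hb
  have hsub : Ioo (sInf I) (sSup I) ⊆ I := IsConnected.Ioo_csInf_csSup_subset ⟨hne, hI.isPreconnected⟩ hbb hba
  have hsup : I ⊆ Ioo (sInf I) (sSup I) := fun x hx => by
    obtain ⟨ε, hε, h⟩ := Metric.isOpen_iff.1 ho x hx
    have h1 : x - ε / 2 ∈ I := h (by rw [mem_ball, Real.dist_eq, abs_lt]; constructor <;> linarith)
    have h2 : x + ε / 2 ∈ I := h (by rw [mem_ball, Real.dist_eq, abs_lt]; constructor <;> linarith)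
    exact ⟨by linarith [csInf_le hbb h1], by linarith [le_csSup hba h2]⟩
  obtain ⟨x, hx⟩ := hne
  exact ⟨_, _, (hsup hx).1.trans (hsup hx).2, hsup.antisymm hsub⟩

/-- The one-dimensional transport inequality, with its equality case for equal masses. -/
theorem transport_inequality {A B H : ℝ → ℝ} {K : ℝ≥0} (hAL : LipschitzWith K A) (hA0 : ∀ t, 0 ≤ A t)
    (hAs : HasCompactSupport A) (hI : OrdConnected {t | 0 < A t}) (hAne : ∃ t, 0 < A t)
    (hBc : Continuous B) (hB0 : ∀ t, 0 ≤ B t) (hBs : HasCompactSupport B) (hJ : OrdConnected {t | 0 < B t})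
    (hH : Integrable H) (hH0 : ∀ t, A t = 0 → H t = 0) {k : ℕ} (hk : 1 ≤ k)
    (hle : ∀ᵐ x, 0 < A x → ∀ y, 0 < B y → ∀ s > 0, s ^ k * A x = B y → k * s * A x - y * deriv A x ≤ H x)
    {C : ℝ} (hC : 0 < C) (hAB : C ^ (k + 1) * ∫ t, A t = ∫ t, B t) :
    (k + 1) * C * ∫ t, A t ≤ ∫ t, H t ∧
      (C = 1 → (k + 1) * C * ∫ t, A t = ∫ t, H t → ∃ c, ∀ x, B (x + c) = A x) := by
  have hAc := hAL.continuous
  have hτ : 0 < C ^ (k + 1) := pow_pos hC _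
  obtain ⟨y, hy, hysurj⟩ := exists_transport hAc hA0 hAs hI hBc hB0 hBs hJ hτ hAB
  have hIo : IsOpen {t | 0 < A t} := isOpen_lt continuous_const hAc
  have hIb : IsBounded {t | 0 < A t} :=
    hAs.isCompact.isBounded.subset fun t ht => subset_tsupport _ (ne_of_gt ht)
  obtain ⟨α, β, hαβ, hIeq⟩ := exists_eq_Ioo hIo hIb hI hAne
  have hmem : ∀ x, x ∈ Ioo α β ↔ 0 < A x := fun x => by rw [← hIeq]; rfl
  have hyc : ∀ x, 0 < A x → ContinuousAt y x := fun x hx => (hy x hx).2.continuousAt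
  set y' : ℝ → ℝ := fun x => C ^ (k + 1) * A x / B (y x) with hy'def
  have hy'c : ∀ x, 0 < A x → ContinuousAt y' x := fun x hx =>
    (continuousAt_const.mul hAc.continuousAt).div (hBc.continuousAt.comp (hyc x hx)) (hy x hx).1.ne'
  set S : ℝ → ℝ := fun x => (B (y x) / A x) ^ ((k : ℝ)⁻¹) with hSdef
  have hSpos : ∀ x, 0 < A x → 0 < S x := fun x hx => Real.rpow_pos_of_pos (div_pos (hy x hx).1 hx) _
  have hSk : ∀ x, 0 < A x → S x ^ k * A x = B (y x) := fun x hx => by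
    rw [hSdef]
    simp only
    rw [Real.rpow_inv_natCast_pow (div_pos (hy x hx).1 hx).le (by omega), div_mul_cancel₀ _ hx.ne']
  have hSc : ∀ x, 0 < A x → ContinuousAt S x := fun x hx =>
    ((hBc.continuousAt.comp (hyc x hx)).div hAc.continuousAt hx.ne').rpow_const
      (Or.inl (div_pos (hy x hx).1 hx).ne')
  have hy'S : ∀ x, 0 < A x → y' x = C ^ (k + 1) / S x ^ k := fun x hx => by
    rw [hy'def]
    simp only
    rw [← hSk x hx, mul_div_mul_right _ _ hx.ne']
  set D : ℝ → ℝ := fun x => A x * (y' x + k * S x - (k + 1) * C) with hDdef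
  have hDc : ∀ x, 0 < A x → ContinuousAt D x := fun x hx =>
    hAc.continuousAt.mul (((hy'c x hx).add (continuousAt_const.mul (hSc x hx))).sub continuousAt_const)
  have hD0 : ∀ x, 0 < A x → 0 ≤ D x := fun x hx => by
    refine mul_nonneg hx.le ?_
    rw [hy'S x hx]
    linarith [(bernoulli_weighted hk (hSpos x hx) hC).1]
  obtain ⟨M, hM0, hM⟩ : ∃ M, 0 ≤ M ∧ ∀ t, 0 < B t → |t| ≤ M := by
    obtain ⟨M, hM⟩ := hBs.isCompact.isBounded.exists_norm_le
    exact ⟨max M 0, le_max_right _ _, fun t ht =>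
      (hM t (subset_tsupport _ (ne_of_gt ht))).trans (le_max_left _ _)⟩
  have hHi : ∀ a b : ℝ, IntervalIntegrable H volume a b := fun a b => hH.intervalIntegrable
  have hAi : ∀ a b : ℝ, IntervalIntegrable A volume a b := fun a b => hAc.intervalIntegrable a b
  -- the estimate on compact subintervals
  have hpq : ∀ p q, p ≤ q → 0 < A p → 0 < A q →
      (∫ x in p..q, D x) + (k + 1) * C * (∫ x in p..q, A x) - M * (A p + A q) ≤ ∫ x in p..q, H x := by
    intro p q hpq hp hq
    have hsub : ∀ x ∈ Icc p q, 0 < A x := fun x hx => hI.out hp hq hx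
    have hsub' : ∀ x ∈ uIcc p q, 0 < A x := fun x hx => hsub x (by rwa [uIcc_of_le hpq] at hx)
    have hy'on : ContinuousOn y' (uIcc p q) := fun x hx => (hy'c x (hsub' x hx)).continuousWithinAt
    have hSon : ContinuousOn S (uIcc p q) := fun x hx => (hSc x (hsub' x hx)).continuousWithinAt
    have hDon : ContinuousOn D (uIcc p q) := fun x hx => (hDc x (hsub' x hx)).continuousWithinAt
    have hyon : ContinuousOn y (uIcc p q) := fun x hx => (hyc x (hsub' x hx)).continuousWithinAt
    obtain ⟨Ly, hLy⟩ := (isCompact_uIcc.image_of_continuousOn hy'on).isBounded.exists_norm_le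
    have hylip : LipschitzOnWith (Real.toNNReal Ly) y (uIcc p q) := by
      refine (convex_uIcc p q).lipschitzOnWith_of_nnnorm_hasDerivWithin_le (f' := y')
        (fun x hx => (hy x (hsub' x hx)).2.hasDerivWithinAt) fun x hx => ?_
      rw [← NNReal.coe_le_coe, coe_nnnorm]
      exact (hLy _ (mem_image_of_mem _ hx)).trans (Real.le_coe_toNNReal _)
    have hAac : AbsolutelyContinuousOnInterval A p q := (hAL.lipschitzOnWith (s := uIcc p q)).absolutelyContinuousOnInterval
    have hyac : AbsolutelyContinuousOnInterval y p q := hylip.absolutelyContinuousOnInterval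
    have hibp := hAac.integral_mul_deriv_eq_deriv_mul hyac
    have hcongr : ∫ x in p..q, A x * deriv y x = ∫ x in p..q, A x * y' x :=
      intervalIntegral.integral_congr fun x hx => by
        show A x * deriv y x = A x * y' x
        rw [(hy x (hsub' x hx)).2.deriv]
    rw [hcongr] at hibp
    have hi1 : IntervalIntegrable (fun x => A x * y' x) volume p q :=
      (hAc.continuousOn.mul hy'on).intervalIntegrable
    have hi2 : IntervalIntegrable (fun x => k * S x * A x) volume p q :=
      ((continuousOn_const.mul hSon).mul hAc.continuousOn).intervalIntegrable
    have hi3 : IntervalIntegrable (fun x => deriv A x * y x) volume p q :=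
      hAac.intervalIntegrable_deriv.mul_continuousOn hyon
    have hmain : ∫ x in p..q, (k * S x * A x - deriv A x * y x) ≤ ∫ x in p..q, H x := by
      refine intervalIntegral.integral_mono_ae_restrict hpq (hi2.sub hi3) (hHi p q)
        ((ae_restrict_iff' measurableSet_Icc).2 ?_)
      filter_upwards [hle] with x hx hxI
      have hA := hsub x hxI
      have := hx hA (y x) (hy x hA).1 (S x) (hSpos x hA) (hSk x hA)
      linarith
    rw [intervalIntegral.integral_sub hi2 hi3] at hmain
    have hDint : ∫ x in p..q, D x = (∫ x in p..q, A x * y' x) + (∫ x in p..q, k * S x * A x) -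
        (k + 1) * C * ∫ x in p..q, A x := by
      rw [← intervalIntegral.integral_const_mul, ← intervalIntegral.integral_add hi1 hi2,
        ← intervalIntegral.integral_sub (hi1.add hi2) ((hAi p q).const_mul _)]
      exact intervalIntegral.integral_congr fun x _ => by simp only [hDdef]; ring
    have b1 := abs_le.1 (hM _ (hy p hp).1)
    have b2 := abs_le.1 (hM _ (hy q hq).1)
    nlinarith
  -- passage to the limit
  have hlim : ∀ p₀ q₀, p₀ ≤ q₀ → 0 < A p₀ → 0 < A q₀ →
      (∫ x in p₀..q₀, D x) + (k + 1) * C * (∫ x, A x) ≤ ∫ x, H x := by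
    intro p₀ q₀ hpq₀ hp₀ hq₀
    have hp₀I := (hmem p₀).2 hp₀
    have hq₀I := (hmem q₀).2 hq₀
    have h1 : ∀ p ∈ Ioc α p₀, ∀ q ∈ Ico q₀ β, (∫ x in p₀..q₀, D x) + (k + 1) * C * (∫ x in p..q, A x) -
        M * (A p + A q) ≤ ∫ x in p..q, H x := by
      intro p hp q hq
      have hpA : 0 < A p := (hmem p).1 ⟨hp.1, hp.2.trans_lt hp₀I.2⟩
      have hqA : 0 < A q := (hmem q).1 ⟨hq₀I.1.trans_le hq.1, hq.2⟩
      have hle' : p ≤ q := hp.2.trans (hpq₀.trans hq.1)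
      have h := hpq p q hle' hpA hqA
      have hsub : ∀ x ∈ Icc p q, 0 < A x := fun x hx => hI.out hpA hqA hx
      have hmono : ∫ x in p₀..q₀, D x ≤ ∫ x in p..q, D x := by
        refine intervalIntegral.integral_mono_interval hp.2 hpq₀ hq.1 ?_ ?_
        · refine (ae_restrict_iff' measurableSet_Ioc).2 (Eventually.of_forall fun x hx => ?_)
          exact hD0 x (hsub x (Ioc_subset_Icc_self hx))
        · refine ContinuousOn.intervalIntegrable fun x hx => ?_
          rw [uIcc_of_le hle'] at hx
          exact (hDc x (hsub x hx)).continuousWithinAt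
      linarith
    have hprim : ∀ {f : ℝ → ℝ}, (∀ a b, IntervalIntegrable f volume a b) → ∀ q, Continuous fun p => ∫ x in p..q, f x := by
      intro f hf q
      have : (fun p => ∫ x in p..q, f x) = fun p => -∫ x in q..p, f x :=
        funext fun p => intervalIntegral.integral_symm _ _
      rw [this]
      exact (intervalIntegral.continuous_primitive hf q).neg
    have h2 : ∀ q ∈ Ico q₀ β, (∫ x in p₀..q₀, D x) + (k + 1) * C * (∫ x in α..q, A x) -
        M * (A α + A q) ≤ ∫ x in α..q, H x := by
      intro q hq
      refine le_of_tendsto_of_tendsto (b := 𝓝[>] α)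
        (f := fun p => (∫ x in p₀..q₀, D x) + (k + 1) * C * (∫ x in p..q, A x) - M * (A p + A q))
        (g := fun p => ∫ x in p..q, H x) ?_ ?_ ?_
      · refine (Continuous.tendsto ?_ α).mono_left nhdsWithin_le_nhds
        exact (continuous_const.add (continuous_const.mul (hprim hAi q))).sub
          (continuous_const.mul (hAc.add continuous_const))
      · exact ((hprim hHi q).tendsto α).mono_left nhdsWithin_le_nhds
      · filter_upwards [Ioc_mem_nhdsGT hp₀I.1] with p hp
        exact h1 p hp q hq
    have h3 : (∫ x in p₀..q₀, D x) + (k + 1) * C * (∫ x in α..β, A x) -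
        M * (A α + A β) ≤ ∫ x in α..β, H x := by
      refine le_of_tendsto_of_tendsto (b := 𝓝[<] β)
        (f := fun q => (∫ x in p₀..q₀, D x) + (k + 1) * C * (∫ x in α..q, A x) - M * (A α + A q))
        (g := fun q => ∫ x in α..q, H x) ?_ ?_ ?_
      · refine (Continuous.tendsto ?_ β).mono_left nhdsWithin_le_nhds
        exact (continuous_const.add (continuous_const.mul (intervalIntegral.continuous_primitive hAi α))).sub
          (continuous_const.mul (continuous_const.add hAc))
      · exact ((intervalIntegral.continuous_primitive hHi α).tendsto β).mono_left nhdsWithin_le_nhds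
      · filter_upwards [Ico_mem_nhdsLT hq₀I.2] with q hq
        exact h2 q hq
    have hzero : ∀ x, x ∉ Ioo α β → A x = 0 := fun x hx =>
      le_antisymm (not_lt.1 fun h => hx ((hmem x).2 h)) (hA0 x)
    have hsA : ∫ x in α..β, A x = ∫ x, A x :=
      intervalIntegral.integral_eq_integral_of_support_subset fun x hx => by
        by_contra hx'
        exact hx (hzero x fun h => hx' (Ioo_subset_Ioc_self h))
    have hsH : ∫ x in α..β, H x = ∫ x, H x :=
      intervalIntegral.integral_eq_integral_of_support_subset fun x hx => by
        by_contra hx'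
        exact hx (hH0 x (hzero x fun h => hx' (Ioo_subset_Ioc_self h)))
    rw [hsA, hsH, hzero α (by simp), hzero β (by simp)] at h3
    linarith
  obtain ⟨t₀, ht₀⟩ := hAne
  refine ⟨by simpa using hlim t₀ t₀ le_rfl ht₀ ht₀, fun hC1 heq => ?_⟩
  have hDzero : ∀ x, 0 < A x → D x = 0 := by
    intro x hx
    by_contra hne
    have hpos : 0 < D x := lt_of_le_of_ne (hD0 x hx) (Ne.symm hne)
    obtain ⟨q, hxq, hq⟩ : ∃ q, x < q ∧ 0 < A q := by
      have hxI := (hmem x).2 hx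
      obtain ⟨q, hq1, hq2⟩ := exists_between hxI.2
      exact ⟨q, hq1, (hmem q).1 ⟨hxI.1.trans hq1, hq2⟩⟩
    have hsub : ∀ z ∈ Icc x q, 0 < A z := fun z hz => hI.out hx hq hz
    have := intervalIntegral.integral_pos hxq
      (fun z hz => (hDc z (hsub z hz)).continuousWithinAt)
      (fun z hz => hD0 z (hsub z (Ioc_subset_Icc_self hz))) ⟨x, left_mem_Icc.2 hxq.le, hpos⟩
    linarith [hlim x q hxq.le hx hq]
  have hS1 : ∀ x, 0 < A x → S x = 1 := fun x hx => by
    have h0 := (mul_eq_zero.1 (hDzero x hx)).resolve_left hx.ne'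
    rw [← hC1]
    refine (bernoulli_weighted hk (hSpos x hx) hC).2 ?_
    rw [← hy'S x hx]; linarith
  have hBA : ∀ x, 0 < A x → B (y x) = A x := fun x hx => by
    rw [← hSk x hx, hS1 x hx]; simp
  have hder : ∀ x, 0 < A x → HasDerivAt y 1 x := fun x hx => by
    have h := (hy x hx).2
    rw [hBA x hx, hC1, one_pow, one_mul, div_self hx.ne'] at h
    exact h
  have hconst : ∀ x, 0 < A x → y x - x = y t₀ - t₀ := fun x hx => by
    refine hIo.is_const_of_deriv_eq_zero (f := fun x => y x - x) hI.isPreconnected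
      (fun z hz => ((hder z hz).sub (hasDerivAt_id' z)).differentiableAt.differentiableWithinAt)
      (fun z hz => ?_) hx ht₀
    exact (((hder z hz).sub (hasDerivAt_id' z)).deriv).trans (sub_self 1)
  refine ⟨y t₀ - t₀, fun x => ?_⟩
  by_cases hx : 0 < A x
  · rw [← hconst x hx, add_sub_cancel, hBA x hx]
  · have hA : A x = 0 := le_antisymm (not_lt.1 hx) (hA0 x)
    rw [hA]
    by_contra hne
    obtain ⟨z, hz, hyz⟩ := hysurj _ (lt_of_le_of_ne (hB0 _) (Ne.symm hne))
    have : z = x := by linarith [hconst z hz]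
    exact hx (this ▸ hz)

end

section

section Marginals

variable {E F : Type*} [NormedAddCommGroup E] [NormedSpace ℝ E] [NormedAddCommGroup F] [NormedSpace ℝ F]

/-- The densities to which the Knothe induction applies. -/
structure IsDensity (a : E → ℝ) : Prop where
  lip : ∃ K : ℝ≥0, LipschitzWith K a
  nonneg : ∀ x, 0 ≤ a x
  supp : HasCompactSupport a
  conv : Convex ℝ {x | 0 < a x}
  diff : ∀ x, 0 < a x → DifferentiableAt ℝ a x

lemma IsDensity.continuous {a : E → ℝ} (ha : IsDensity a) : Continuous a := by
  obtain ⟨K, hK⟩ := ha.lip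
  exact hK.continuous

lemma IsDensity.comp_equiv {a : F → ℝ} (ha : IsDensity a) (L : E ≃L[ℝ] F) : IsDensity (fun x => a (L x)) where
  lip := by
    obtain ⟨K, hK⟩ := ha.lip
    exact ⟨K * ‖(L : E →L[ℝ] F)‖₊, hK.comp L.lipschitz⟩
  nonneg x := ha.nonneg _
  supp := ha.supp.comp_homeomorph L.toHomeomorph
  conv := ha.conv.linear_preimage (L : E →ₗ[ℝ] F)
  diff x hx := (ha.diff _ hx).comp x L.differentiableAt

lemma IsDensity.slice {a : ℝ × E → ℝ} (ha : IsDensity a) (s : ℝ) : IsDensity (fun x => a (s, x)) where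
  lip := by
    obtain ⟨K, hK⟩ := ha.lip
    refine ⟨K, LipschitzWith.of_dist_le_mul fun x y => (hK.dist_le_mul _ _).trans (le_of_eq ?_)⟩
    simp [Prod.dist_eq]
  nonneg x := ha.nonneg _
  supp := by
    refine HasCompactSupport.intro (ha.supp.isCompact.image continuous_snd) fun x hx => ?_
    by_contra h
    exact hx ⟨(s, x), subset_tsupport _ h, rfl⟩
  conv x hx y hy t r ht hr htr := by
    have := ha.conv (x := (s, x)) hx (y := (s, y)) hy ht hr htr
    simpa [← add_mul, htr] using this
  diff x hx := (ha.diff (s, x) hx).comp x ((differentiableAt_const s).prodMk differentiableAt_id)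

lemma IsDensity.fderiv_slice {a : ℝ × E → ℝ} (ha : IsDensity a) {s : ℝ} {x : E} (hx : 0 < a (s, x)) (v : E) :
    fderiv ℝ (fun x => a (s, x)) x v = fderiv ℝ a (s, x) (0, v) := by
  have h1 : HasFDerivAt (fun x : E => (s, x)) (ContinuousLinearMap.inr ℝ ℝ E) x := hasFDerivAt_prodMk_right s x
  have h2 : HasFDerivAt (fun x => a (s, x)) _ x := HasFDerivAt.comp (g := a) x (ha.diff _ hx).hasFDerivAt h1
  rw [h2.fderiv]
  simp

variable [MeasureSpace E]

/-- The marginal of `a` in the first variable. -/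
def marginal (a : ℝ × E → ℝ) (s : ℝ) : ℝ := ∫ x, a (s, x)

lemma IsDensity.marginal_nonneg {a : ℝ × E → ℝ} (ha : IsDensity a) (s : ℝ) : 0 ≤ marginal a s :=
  integral_nonneg fun _ => ha.nonneg _

lemma IsDensity.marginal_supp {a : ℝ × E → ℝ} (ha : IsDensity a) : HasCompactSupport (marginal a) := by
  refine HasCompactSupport.intro (ha.supp.isCompact.image continuous_fst) fun s hs => ?_
  have : (fun x => a (s, x)) = fun _ => 0 := funext fun x => by
    by_contra h
    exact hs ⟨(s, x), subset_tsupport _ h, rfl⟩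
  rw [marginal, this, integral_zero]

variable [BorelSpace E]

/-- The partial derivative in the first variable, on the support. -/
def partialFst (a : ℝ × E → ℝ) : ℝ × E → ℝ := {z | 0 < a z}.indicator fun z => fderiv ℝ a z (1, 0)

lemma IsDensity.measurable_partialFst [FiniteDimensional ℝ E] {a : ℝ × E → ℝ} (ha : IsDensity a) : Measurable (partialFst a) :=
  (measurable_fderiv_apply_const ℝ a (1, 0)).indicator (isOpen_lt continuous_const ha.continuous).measurableSet

variable [(volume : Measure E).IsAddHaarMeasure]

lemma IsDensity.integrable {a : E → ℝ} (ha : IsDensity a) : Integrable a :=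
  ha.continuous.integrable_of_hasCompactSupport ha.supp

lemma IsDensity.integral_pos_iff {a : E → ℝ} (ha : IsDensity a) : 0 < ∫ x, a x ↔ ∃ x, 0 < a x := by
  constructor
  · intro h
    by_contra hne
    push Not at hne
    have : a = fun _ => 0 := funext fun x => le_antisymm (hne x) (ha.nonneg x)
    rw [this] at h
    simp at h
  · rintro ⟨x, hx⟩
    exact ha.continuous.integral_pos_of_hasCompactSupport_nonneg_nonzero ha.supp ha.nonneg hx.ne'

lemma IsDensity.marginal_lipschitz {a : ℝ × E → ℝ} (ha : IsDensity a) : ∃ K : ℝ≥0, LipschitzWith K (marginal a) := by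
  obtain ⟨K, hK⟩ := ha.lip
  have hQ : IsCompact (Prod.snd '' tsupport a) := ha.supp.isCompact.image continuous_snd
  set Q := Prod.snd '' tsupport a with hQdef
  have hout : ∀ s x, x ∉ Q → a (s, x) = 0 := fun s x hx => by
    by_contra h
    exact hx ⟨(s, x), subset_tsupport _ h, rfl⟩
  refine ⟨K * (volume.real Q).toNNReal, LipschitzWith.of_dist_le_mul fun s t => ?_⟩
  have hsub : marginal a s - marginal a t = ∫ x in Q, (a (s, x) - a (t, x)) := by
    rw [setIntegral_eq_integral_of_forall_compl_eq_zero fun x hx => by rw [hout s x hx, hout t x hx, sub_zero]]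
    exact (integral_sub (ha.slice s).integrable (ha.slice t).integrable).symm
  rw [Real.dist_eq, hsub, ← Real.norm_eq_abs]
  refine (norm_setIntegral_le_of_norm_le_const (C := K * dist s t) hQ.measure_lt_top fun x _ => ?_).trans (le_of_eq ?_)
  · rw [← dist_eq_norm]
    refine (hK.dist_le_mul _ _).trans (le_of_eq ?_)
    simp [Prod.dist_eq]
  · rw [NNReal.coe_mul, Real.coe_toNNReal _ measureReal_nonneg]; ring

lemma IsDensity.marginal_pos_iff {a : ℝ × E → ℝ} (ha : IsDensity a) (s : ℝ) : 0 < marginal a s ↔ ∃ x, 0 < a (s, x) :=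
  (ha.slice s).integral_pos_iff

lemma IsDensity.eq_zero_of_marginal {a : ℝ × E → ℝ} (ha : IsDensity a) {s : ℝ} (hs : marginal a s = 0) (x : E) :
    a (s, x) = 0 := by
  by_contra h
  exact ((ha.marginal_pos_iff s).2 ⟨x, lt_of_le_of_ne (ha.nonneg _) (Ne.symm h)⟩).ne' hs

lemma IsDensity.marginal_ordConnected {a : ℝ × E → ℝ} (ha : IsDensity a) : OrdConnected {s | 0 < marginal a s} := by
  have : {s | 0 < marginal a s} = (LinearMap.fst ℝ ℝ E) '' {z | 0 < a z} := by
    ext s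
    rw [mem_ofPred_eq, ha.marginal_pos_iff]
    constructor
    · rintro ⟨x, hx⟩
      exact ⟨(s, x), hx, rfl⟩
    · rintro ⟨⟨s', x⟩, hx, rfl⟩
      exact ⟨x, hx⟩
  rw [this]
  exact (ha.conv.linear_image _).ordConnected

variable [FiniteDimensional ℝ E]
  [FiniteDimensional ℝ F] [MeasureSpace F] [BorelSpace F] [(volume : Measure F).IsAddHaarMeasure]

instance isAddHaarMeasure_volume_prod : (volume : Measure (ℝ × E)).IsAddHaarMeasure :=
  Measure.prod.instIsAddHaarMeasure _ _

lemma IsDensity.integral_marginal {a : ℝ × E → ℝ} (ha : IsDensity a) : ∫ s, marginal a s = ∫ z, a z :=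
  (integral_prod a ha.integrable).symm

lemma IsDensity.integrable_partialFst {a : ℝ × E → ℝ} (ha : IsDensity a) (s : ℝ) :
    Integrable fun x => partialFst a (s, x) := by
  obtain ⟨K, hK⟩ := ha.lip
  have hQ : IsCompact (tsupport fun x => a (s, x)) := (ha.slice s).supp
  have h : IntegrableOn (fun x => partialFst a (s, x)) (tsupport fun x => a (s, x)) := by
    refine Measure.integrableOn_of_bounded (M := K * ‖((1 : ℝ), (0 : E))‖) hQ.measure_lt_top.ne
      (ha.measurable_partialFst.comp measurable_prodMk_left).aestronglyMeasurable
      (Eventually.of_forall fun x => ?_)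
    rw [partialFst]
    refine (norm_indicator_le_norm_self _ _).trans ?_
    exact ((fderiv ℝ a (s, x)).le_opNorm _).trans
      (mul_le_mul_of_nonneg_right (norm_fderiv_le_of_lipschitz ℝ hK) (norm_nonneg _))
  refine (integrableOn_iff_integrable_of_support_subset fun x hx => ?_).1 h
  have hx' : 0 < a (s, x) := by
    by_contra hn
    exact hx (indicator_of_notMem (s := {z : ℝ × E | 0 < a z}) hn _)
  exact subset_tsupport (fun x => a (s, x)) hx'.ne'

lemma IsDensity.ae_hasDerivAt_marginal {a : ℝ × E → ℝ} (ha : IsDensity a) :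
    ∀ᵐ s, HasDerivAt (marginal a) (∫ x, partialFst a (s, x)) s := by
  obtain ⟨K, hK⟩ := ha.lip
  have hfr : ∀ᵐ z : ℝ × E, z ∉ frontier {z | 0 < a z} :=
    measure_eq_zero_iff_ae_notMem.1 (ha.conv.addHaar_frontier volume)
  filter_upwards [Measure.ae_ae_of_ae_prod hfr] with s hs
  have hQ : IsCompact (Prod.snd '' tsupport a) := ha.supp.isCompact.image continuous_snd
  set Q := Prod.snd '' tsupport a with hQdef
  have hout : ∀ s x, x ∉ Q → a (s, x) = 0 := fun s x hx => by
    by_contra h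
    exact hx ⟨(s, x), subset_tsupport _ h, rfl⟩
  refine (hasDerivAt_integral_of_dominated_loc_of_lip (F := fun t x => a (t, x)) (bound := Q.indicator fun _ => (K : ℝ))
    (s := univ) univ_mem
    (Eventually.of_forall fun t => (ha.slice t).continuous.aestronglyMeasurable) (ha.slice s).integrable
    (F' := fun x => partialFst a (s, x)) (ha.measurable_partialFst.comp measurable_prodMk_left).aestronglyMeasurable
    (Eventually.of_forall fun x => ?_)
    ((integrable_indicator_iff hQ.measurableSet).2 (integrableOn_const hQ.measure_lt_top.ne)) ?_).2
  · refine LipschitzOnWith.of_dist_le_mul fun t _ t' _ => ?_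
    by_cases hx : x ∈ Q
    · rw [indicator_of_mem hx]
      refine (hK.dist_le_mul _ _).trans (le_of_eq ?_)
      simp [Prod.dist_eq]
    · rw [hout t x hx, hout t' x hx, dist_self]; positivity
  · filter_upwards [hs] with x hx
    by_cases hpos : 0 < a (s, x)
    · have h1 : HasDerivAt (fun t : ℝ => (t, x)) ((1 : ℝ), (0 : E)) s := (hasDerivAt_id' s).prodMk (hasDerivAt_const s x)
      have := HasFDerivAt.comp_hasDerivAt (l := a) s (ha.diff _ hpos).hasFDerivAt h1
      rw [partialFst, indicator_of_mem (by exact hpos)]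
      exact this
    · rw [partialFst, indicator_of_notMem (by exact hpos)]
      have hcl : (s, x) ∉ closure {z | 0 < a z} := fun h => hx ⟨h, fun h' => hpos (interior_subset h' : (s, x) ∈ {z | 0 < a z})⟩
      have hev : ∀ᶠ z in 𝓝 (s, x), a z = 0 := by
        filter_upwards [isClosed_closure.isOpen_compl.mem_nhds hcl] with z hz
        exact le_antisymm (not_lt.1 fun h => hz (subset_closure h)) (ha.nonneg z)
      have hcont : ContinuousAt (fun t : ℝ => (t, x)) s := by fun_prop
      exact (hasDerivAt_const s (0 : ℝ)).congr_of_eventuallyEq (hcont.eventually hev)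

end Marginals

end

section

section Knothe

variable {E F : Type*} [NormedAddCommGroup E] [NormedSpace ℝ E] [NormedAddCommGroup F] [NormedSpace ℝ F]
variable [MeasureSpace E] [MeasureSpace F]

/-- `Ψ` is integrable, carried by `{a > 0}`, and dominates the coupling function of `a` and `b`. -/
structure DominatesCoupling (a b Ψ : E → ℝ) : Prop where
  integrable : Integrable Ψ
  zero : ∀ x, a x = 0 → Ψ x = 0
  le : ∀ x y, 0 < a x → 0 < b y → 2 * √(a x) * √(b y) - fderiv ℝ a x y ≤ Ψ x

variable (E) in
/-- The functional inequality propagated by the Knothe induction. -/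
def CouplingInequality (k : ℕ) : Prop :=
  ∀ a b Ψ : E → ℝ, IsDensity a → IsDensity b → (∃ x, 0 < a x) → DominatesCoupling a b Ψ →
    ∀ c : ℝ, 0 < c → c ^ k * ∫ x, a x = ∫ x, b x → k * c * ∫ x, a x ≤ ∫ x, Ψ x

lemma DominatesCoupling.comp_equiv [BorelSpace E] [BorelSpace F] {a b Ψ : F → ℝ} (h : DominatesCoupling a b Ψ) (ha : IsDensity a)
    (L : E ≃L[ℝ] F) (hL : MeasurePreserving L) :
    DominatesCoupling (fun x => a (L x)) (fun x => b (L x)) (fun x => Ψ (L x)) where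
  integrable := (hL.integrable_comp_emb L.toHomeomorph.measurableEmbedding).2 h.integrable
  zero x hx := h.zero _ hx
  le x y hx hy := by
    have h1 : HasFDerivAt (fun x => a (L x)) _ x :=
      HasFDerivAt.comp (g := a) x (ha.diff _ hx).hasFDerivAt L.hasFDerivAt
    have := h.le _ _ hx hy
    simpa [h1.fderiv] using this

lemma CouplingInequality.of_equiv [BorelSpace E] [BorelSpace F] {k : ℕ} (h : CouplingInequality E k) (L : E ≃L[ℝ] F)
    (hL : MeasurePreserving L) : CouplingInequality F k := by
  intro a b Ψ ha hb hne hΨ c hc hab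
  have hInt : ∀ f : F → ℝ, ∫ x, f (L x) = ∫ y, f y := fun f =>
    hL.integral_comp L.toHomeomorph.measurableEmbedding f
  obtain ⟨y, hy⟩ := hne
  have := h _ _ _ (ha.comp_equiv L) (hb.comp_equiv L) ⟨L.symm y, by simpa using hy⟩ (hΨ.comp_equiv ha L hL) c hc
    (by rw [hInt, hInt, hab])
  rwa [hInt, hInt] at this

lemma couplingInequality_zero : CouplingInequality (Fin 0 → ℝ) 2 := by
  intro a b Ψ ha hb hne hΨ c hc hab
  have hInt : ∀ f : (Fin 0 → ℝ) → ℝ, ∫ x, f x = f 0 := fun f => by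
    rw [Measure.volume_pi_eq_dirac (0 : Fin 0 → ℝ), integral_dirac]
  rw [hInt, hInt] at hab
  rw [hInt, hInt]
  obtain ⟨x, hx⟩ := hne
  rw [Subsingleton.elim x 0] at hx
  have hb0 : 0 < b 0 := hab ▸ mul_pos (pow_pos hc 2) hx
  have := hΨ.le 0 0 hx hb0
  have hs : √(b 0) = c * √(a 0) := by
    rw [← hab, Real.sqrt_mul (by positivity), Real.sqrt_sq hc.le]
  rw [map_zero, sub_zero, hs] at this
  have h2 := Real.mul_self_sqrt hx.le
  push_cast
  nlinarith

variable [FiniteDimensional ℝ E] [BorelSpace E] [(volume : Measure E).IsAddHaarMeasure]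

/-- The induction step of the Knothe argument, with its equality case for equal masses. -/
theorem CouplingInequality.prod {k : ℕ} (hk : 1 ≤ k) (h : CouplingInequality E k) {a b Ψ : ℝ × E → ℝ}
    (ha : IsDensity a) (hb : IsDensity b) (hne : ∃ x, 0 < a x) (hΨ : DominatesCoupling a b Ψ)
    {c : ℝ} (hc : 0 < c) (hab : c ^ (k + 1) * ∫ x, a x = ∫ x, b x) :
    (k + 1) * c * ∫ x, a x ≤ ∫ x, Ψ x ∧
      (c = 1 → (k + 1) * c * ∫ x, a x = ∫ x, Ψ x → ∃ d, ∀ s, marginal b (s + d) = marginal a s) := by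
  obtain ⟨K, hK⟩ := ha.marginal_lipschitz
  obtain ⟨_, hK'⟩ := hb.marginal_lipschitz
  have hslice : ∀ᵐ s, Integrable fun x => Ψ (s, x) := hΨ.integrable.prod_right_ae
  have key := transport_inequality (H := fun s => ∫ x, Ψ (s, x)) (C := c) (k := k) hK ha.marginal_nonneg ha.marginal_supp
    ha.marginal_ordConnected ?_ hK'.continuous hb.marginal_nonneg hb.marginal_supp hb.marginal_ordConnected
    hΨ.integrable.integral_prod_left ?_ hk ?_ hc ?_
  · rw [ha.integral_marginal, ← integral_prod Ψ hΨ.integrable] at key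
    exact key
  · obtain ⟨⟨s, x⟩, hx⟩ := hne
    exact ⟨s, (ha.marginal_pos_iff s).2 ⟨x, hx⟩⟩
  · intro s hs
    simp only [hΨ.zero _ (ha.eq_zero_of_marginal hs _), integral_zero]
  · filter_upwards [hslice, ha.ae_hasDerivAt_marginal] with s hInt hder hs y hy t ht hty
    have hG := ha.integrable_partialFst s
    have := h (fun x => a (s, x)) (fun x => b (y, x)) (fun x => Ψ (s, x) + y * partialFst a (s, x))
      (ha.slice s) (hb.slice y) ((ha.marginal_pos_iff s).1 hs)
      ⟨hInt.add (hG.const_mul y), fun x hx => ?_, fun x z hx hz => ?_⟩ t ht hty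
    · rw [integral_add hInt (hG.const_mul y), integral_const_mul, ← hder.deriv] at this
      rw [sub_le_iff_le_add]
      exact this
    · rw [hΨ.zero _ hx, partialFst, indicator_of_notMem (by simp [hx]), mul_zero, add_zero]
    · have h1 := hΨ.le (s, x) (y, z) hx hz
      have h2 : fderiv ℝ a (s, x) (y, z) = y * fderiv ℝ a (s, x) (1, 0) + fderiv ℝ a (s, x) (0, z) := by
        rw [← smul_eq_mul, ← map_smul, ← map_add]
        simp
      rw [h2] at h1
      rw [ha.fderiv_slice hx, partialFst, indicator_of_mem (by exact hx)]
      linarith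
  · rw [ha.integral_marginal, hb.integral_marginal, hab]

end Knothe

lemma measurePreserving_consEquivL (m : ℕ) : MeasurePreserving (Fin.consEquivL ℝ fun _ : Fin (m + 1) => ℝ) := by
  convert (volume_preserving_piFinSuccAbove (fun _ : Fin (m + 1) => ℝ) 0).symm using 1
  ext z i
  refine Fin.cases ?_ (fun j => ?_) i <;> rfl

lemma couplingInequality_pi (m : ℕ) : CouplingInequality (Fin m → ℝ) (m + 2) := by
  induction m with
  | zero => exact couplingInequality_zero
  | succ m ih =>
    have h : CouplingInequality (ℝ × (Fin m → ℝ)) (m + 2 + 1) := fun a b Ψ ha hb hne hΨ c hc hab => by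
      have := (ih.prod (by omega) ha hb hne hΨ hc hab).1
      push_cast at this ⊢
      exact this
    refine h.of_equiv (Fin.consEquivL ℝ fun _ => ℝ) ?_
    exact measurePreserving_consEquivL m

end

section

section Rigidity

variable {m : ℕ}

/-- A measure-preserving splitting of Euclidean space adapted to a unit vector. -/
lemma exists_adapted_equiv {e : Euc (m + 1)} (he : ‖e‖ = 1) :
    ∃ L : (ℝ × (Fin m → ℝ)) ≃L[ℝ] Euc (m + 1), MeasurePreserving L ∧ ∀ z, ⟪L z, e⟫ = z.1 := by
  obtain ⟨b, hb⟩ := Orthonormal.exists_orthonormalBasis_extension_of_card_eq (𝕜 := ℝ) (ι := Fin (m + 1)) (E := Euc (m + 1))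
    (by simp) (v := fun _ => e) (s := {0}) ⟨fun _ => he, fun i j hij => absurd (Subsingleton.elim i j) hij⟩
  have hb0 : b 0 = e := hb 0 rfl
  refine ⟨(Fin.consEquivL ℝ fun _ : Fin (m + 1) => ℝ).trans
    ((EuclideanSpace.equiv (Fin (m + 1)) ℝ).symm.trans b.repr.symm.toContinuousLinearEquiv), ?_, fun z => ?_⟩
  · exact b.measurePreserving_repr_symm.comp
      ((PiLp.volume_preserving_toLp (Fin (m + 1))).comp (measurePreserving_consEquivL m))
  · rw [← hb0, real_inner_comm, ← b.repr_apply_apply]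
    simp

lemma Tor.pos_iff {n : ℕ} {Ω : Set (Euc n)} {u : Euc n → ℝ} (h : Tor Ω u) (x : Euc n) : 0 < u x ↔ x ∈ Ω := by
  refine ⟨fun hx => ?_, fun hx => h.pos hx⟩
  by_contra hn
  exact hx.ne' (h.zero x hn)

lemma Tor.isDensity {n : ℕ} {Ω : Set (Euc n)} {u : Euc n → ℝ} (h : Tor Ω u) : IsDensity u where
  lip := h.exists_lipschitz
  nonneg := h.nonneg
  supp := h.compactSupport
  conv := by
    have : {x | 0 < u x} = Ω := Set.ext h.pos_iff
    rw [this]; exact h.convex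
  diff x hx := (h.contDiffAt ((h.pos_iff x).1 hx)).differentiableAt (by norm_num)

lemma Tor.dominatesCoupling {n : ℕ} {Ω Ω' : Set (Euc n)} {u v : Euc n → ℝ} (h : Tor Ω u) (h' : Tor Ω' v) :
    DominatesCoupling u v (Ω.indicator (coupSup u v (closure Ω'))) where
  integrable := by
    have hKc := h'.bdd.isCompact_closure
    have hne := h'.nonempty.closure
    obtain ⟨C, hC⟩ := h.exists_lipschitz
    obtain ⟨R, hR⟩ := h'.bdd.closure.exists_norm_le
    obtain ⟨F, hF⟩ := h.bdd.isCompact_closure.exists_bound_of_continuousOn (h.cont.sqrt).continuousOn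
    obtain ⟨G, hG⟩ := hKc.exists_bound_of_continuousOn (h'.cont.sqrt).continuousOn
    refine (integrable_indicator_iff h.isOpen.measurableSet).2 ?_
    refine Integrable.mono' (integrableOn_const (C := 2 * F * G + C * R) h.bdd.measure_lt_top.ne)
      ((h.continuousOn_coupSup h'.cont hKc hne).aestronglyMeasurable h.isOpen.measurableSet)
      ((ae_restrict_iff' h.isOpen.measurableSet).2 (Eventually.of_forall fun x hx => ?_))
    obtain ⟨y, hy, he⟩ := exists_coupSup_eq (u := u) h'.cont hKc hne x
    have h1 : |fderiv ℝ u x y| ≤ C * R := ((fderiv ℝ u x).le_opNorm y).trans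
      (mul_le_mul (Tor.norm_fderiv_le hC x) (hR y hy) (norm_nonneg _) C.2)
    have h2 := hF x (subset_closure hx)
    have h3 := hG y hy
    rw [Real.norm_of_nonneg (Real.sqrt_nonneg _)] at h2 h3
    have h4 : |2 * √(u x) * √(v y)| ≤ 2 * F * G := by
      rw [abs_of_nonneg (by positivity), mul_assoc, mul_assoc]
      have := mul_le_mul h2 h3 (Real.sqrt_nonneg _) ((Real.sqrt_nonneg _).trans h2)
      linarith
    rw [he, coup]
    exact (abs_sub _ _).trans (add_le_add h4 h1)
  zero x hx := indicator_of_notMem (fun hx' => (h.pos hx').ne' hx) _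
  le x y hx hy := by
    rw [indicator_of_mem ((h.pos_iff x).1 hx)]
    exact coup_le_coupSup (u := u) h'.cont h'.bdd.isCompact_closure x (subset_closure ((h'.pos_iff y).1 hy))

lemma integral_fst_mul {E : Type*} [NormedAddCommGroup E] [NormedSpace ℝ E] [FiniteDimensional ℝ E] [MeasureSpace E] [BorelSpace E]
    [(volume : Measure E).IsAddHaarMeasure] {a : ℝ × E → ℝ} (ha : IsDensity a) :
    ∫ z, z.1 * a z = ∫ s, s * marginal a s := by
  have hi : Integrable fun z : ℝ × E => z.1 * a z :=
    (continuous_fst.mul ha.continuous).integrable_of_hasCompactSupport ha.supp.mul_left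
  refine (integral_prod _ hi).trans (integral_congr_ae (Eventually.of_forall fun s => ?_))
  exact integral_const_mul _ _

/-- The sharp lower bound for the coupling function of two torsion functions, and the rigidity of
one-dimensional marginals in its equality case. -/
theorem Tor.coupSup_inequality {Ω Ω' : Set (Euc (m + 1))} {u v : Euc (m + 1) → ℝ} (h : Tor Ω u) (h' : Tor Ω' v)
    {e : Euc (m + 1)} (he : ‖e‖ = 1) {c : ℝ} (hc : 0 < c) (hab : c ^ (m + 3) * ∫ x, u x = ∫ x, v x) :
    (m + 3) * c * ∫ x, u x ≤ ∫ x in Ω, coupSup u v (closure Ω') x ∧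
      (c = 1 → (m + 3) * c * ∫ x, u x = ∫ x in Ω, coupSup u v (closure Ω') x →
        ∃ d, (∀ s, (∃ y ∈ Ω', ⟪y, e⟫ = s + d) ↔ ∃ x ∈ Ω, ⟪x, e⟫ = s) ∧
          ∫ y, ⟪y, e⟫ * v y = (∫ x, ⟪x, e⟫ * u x) + d * ∫ x, u x) := by
  obtain ⟨L, hL, hLe⟩ := exists_adapted_equiv he
  have hInt : ∀ f : Euc (m + 1) → ℝ, ∫ x, f (L x) = ∫ y, f y := fun f =>
    hL.integral_comp L.toHomeomorph.measurableEmbedding f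
  have ha := h.isDensity.comp_equiv L
  have hb := h'.isDensity.comp_equiv L
  obtain ⟨p, hp⟩ := h.nonempty
  have key := (couplingInequality_pi m).prod (by omega) ha hb ⟨L.symm p, by simpa using h.pos hp⟩
    ((h.dominatesCoupling h').comp_equiv h.isDensity L hL) hc (by rw [hInt, hInt]; exact hab)
  rw [hInt, hInt, integral_indicator h.isOpen.measurableSet] at key
  have hcast : ((m + 2 : ℕ) : ℝ) + 1 = m + 3 := by push_cast; ring
  rw [hcast] at key
  refine ⟨key.1, fun hc1 heq => ?_⟩
  obtain ⟨d, hd⟩ := key.2 hc1 heq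
  have hmem : ∀ {Ω : Set (Euc (m + 1))} {u : Euc (m + 1) → ℝ}, Tor Ω u → ∀ s,
      0 < marginal (fun z => u (L z)) s ↔ ∃ x ∈ Ω, ⟪x, e⟫ = s := by
    intro Ω u h s
    rw [(h.isDensity.comp_equiv L).marginal_pos_iff]
    constructor
    · rintro ⟨x, hx⟩
      exact ⟨_, (h.pos_iff _).1 hx, hLe _⟩
    · rintro ⟨x, hx, rfl⟩
      refine ⟨(L.symm x).2, ?_⟩
      have h1 : ⟪x, e⟫ = (L.symm x).1 := by rw [← hLe, L.apply_symm_apply]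
      rw [h1]
      simpa using h.pos hx
  have hmom : ∀ {Ω : Set (Euc (m + 1))} {u : Euc (m + 1) → ℝ}, Tor Ω u →
      ∫ x, ⟪x, e⟫ * u x = ∫ s, s * marginal (fun z => u (L z)) s := by
    intro Ω u h
    rw [← hInt, ← integral_fst_mul (h.isDensity.comp_equiv L)]
    simp only [hLe]
  refine ⟨d, fun s => ?_, ?_⟩
  · rw [← hmem h, ← hmem h', hd]
  · rw [hmom h, hmom h', ← integral_add_right_eq_self _ d]
    simp only [hd]
    have hmc : Continuous (marginal fun z => u (L z)) := by
      obtain ⟨K, hK⟩ := ha.marginal_lipschitz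
      exact hK.continuous
    have h1 : Integrable fun s => s * marginal (fun z => u (L z)) s :=
      (continuous_id.mul hmc).integrable_of_hasCompactSupport ha.marginal_supp.mul_left
    have h2 : Integrable (marginal fun z => u (L z)) := hmc.integrable_of_hasCompactSupport ha.marginal_supp
    rw [← hInt u, ← ha.integral_marginal, ← integral_const_mul, ← integral_add h1 (h2.const_mul d)]
    simp only [add_mul]

lemma Tor.integral_pos {n : ℕ} {Ω : Set (Euc n)} {u : Euc n → ℝ} (h : Tor Ω u) : 0 < ∫ x, u x := by
  obtain ⟨p, hp⟩ := h.nonempty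
  exact h.isDensity.integral_pos_iff.2 ⟨p, h.pos hp⟩

lemma integral_coupSup_le_of_common {Ω Ω' : Set (Euc n)} {u v : Euc n → ℝ} (h : Tor Ω u) (h' : Tor Ω' v)
    {μ : Measure (Euc n)} (hμ : ∀ η : Set (Euc n), MeasurableSet η → μ η = torsionMeasure Ω u η)
    (hμ' : ∀ η : Set (Euc n), MeasurableSet η → μ η = torsionMeasure Ω' v η) :
    ∫ x in Ω, coupSup u v (closure Ω') x ≤ (n + 2) * ∫ x, v x := by
  obtain ⟨σ, hσ⟩ := h.exists_torMeasure
  obtain ⟨σ', hσ'⟩ := h'.exists_torMeasure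
  have h1 := hσ.integral_coupSup_le h hμ h'
  have h2 := hσ'.integral_suppFn_le h' hμ'
  linarith

lemma integral_le_of_common {Ω Ω' : Set (Euc (m + 1))} {u v : Euc (m + 1) → ℝ} (h : Tor Ω u) (h' : Tor Ω' v)
    {μ : Measure (Euc (m + 1))} (hμ : ∀ η : Set (Euc (m + 1)), MeasurableSet η → μ η = torsionMeasure Ω u η)
    (hμ' : ∀ η : Set (Euc (m + 1)), MeasurableSet η → μ η = torsionMeasure Ω' v η) :
    ∫ x, u x ≤ ∫ x, v x := by
  have hu := h.integral_pos
  have hv := h'.integral_pos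
  by_contra! hlt
  set q := (∫ x, v x) / ∫ x, u x with hq
  have hq0 : 0 < q := div_pos hv hu
  have hq1 : q < 1 := (div_lt_one hu).2 hlt
  set c := q ^ (((m + 3 : ℕ) : ℝ)⁻¹) with hcdef
  have hc : 0 < c := Real.rpow_pos_of_pos hq0 _
  have hcq : c ^ (m + 3) = q := Real.rpow_inv_natCast_pow hq0.le (by omega)
  have hc1 : c < 1 := by
    by_contra! hge
    exact hq1.not_ge (hcq ▸ one_le_pow₀ hge)
  have he : ‖(stdv 0 : Euc (m + 1))‖ = 1 := by simp [stdv]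
  have h1 := (h.coupSup_inequality h' he hc (by rw [hcq, hq, div_mul_cancel₀ _ hu.ne'])).1
  have h2 := integral_coupSup_le_of_common h h' hμ hμ'
  have h3 : c * ∫ x, u x ≤ ∫ x, v x := by
    have : (0 : ℝ) < m + 3 := by positivity
    refine le_of_mul_le_mul_left ?_ this
    push_cast at h2
    nlinarith
  have h4 : c ≤ q := (le_div_iff₀ hu).2 h3
  have h5 : c ^ (m + 3) < c := by
    rw [pow_succ]
    nlinarith [pow_lt_one₀ hc.le hc1 (n := m + 2) (by omega)]
  linarith

theorem eq_add_singleton_of_common {Ω Ω' : Set (Euc (m + 1))} {u v : Euc (m + 1) → ℝ} (h : Tor Ω u) (h' : Tor Ω' v)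
    {μ : Measure (Euc (m + 1))} (hμ : ∀ η : Set (Euc (m + 1)), MeasurableSet η → μ η = torsionMeasure Ω u η)
    (hμ' : ∀ η : Set (Euc (m + 1)), MeasurableSet η → μ η = torsionMeasure Ω' v η) :
    ∃ w : Euc (m + 1), Ω' = Ω + {w} := by
  have hT : ∫ x, u x = ∫ x, v x :=
    le_antisymm (integral_le_of_common h h' hμ hμ') (integral_le_of_common h' h hμ' hμ)
  have hu := h.integral_pos
  have hvec : ∀ {Ω : Set (Euc (m + 1))} {u : Euc (m + 1) → ℝ}, Tor Ω u → ∀ e : Euc (m + 1),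
      ⟪∫ x, u x • x, e⟫ = ∫ x, ⟪x, e⟫ * u x := by
    intro Ω u h e
    have hi : Integrable fun x => u x • x :=
      (h.cont.smul continuous_id).integrable_of_hasCompactSupport h.compactSupport.smul_right
    rw [real_inner_comm, ← integral_inner hi]
    refine integral_congr_ae (Eventually.of_forall fun x => ?_)
    simp only [inner_smul_right, real_inner_comm e]
    ring
  set w : Euc (m + 1) := (∫ x, u x)⁻¹ • ((∫ x, v x • x) - ∫ x, u x • x) with hw
  have hproj : ∀ e : Euc (m + 1), ‖e‖ = 1 → ∀ s, (∃ y ∈ Ω', ⟪y, e⟫ = s + ⟪w, e⟫) ↔ ∃ x ∈ Ω, ⟪x, e⟫ = s := by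
    intro e he
    have hab : (1 : ℝ) ^ (m + 3) * ∫ x, u x = ∫ x, v x := by rw [one_pow, one_mul, hT]
    have key := h.coupSup_inequality h' he one_pos hab
    have h2 := integral_coupSup_le_of_common h h' hμ hμ'
    have heq : (m + 3) * (1 : ℝ) * ∫ x, u x = ∫ x in Ω, coupSup u v (closure Ω') x := by
      refine le_antisymm key.1 (h2.trans (le_of_eq ?_))
      rw [hT]; push_cast; ring
    obtain ⟨d, hd, hmom⟩ := key.2 rfl heq
    have hde : d = ⟪w, e⟫ := by
      rw [hw, real_inner_smul_left, inner_sub_left, hvec h, hvec h', hmom]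
      field_simp
      ring
    rw [← hde]
    exact hd
  refine ⟨w, Set.ext fun z => ?_⟩
  rw [add_singleton, mem_image]
  constructor
  · intro hz
    refine ⟨z - w, ?_, sub_add_cancel z w⟩
    by_contra hn
    obtain ⟨ν, hν, hlt⟩ := exists_unit_normal h.isOpen h.convex h.nonempty hn
    obtain ⟨x, hx, he⟩ := (hproj ν hν ⟪z - w, ν⟫).1 ⟨z, hz, by rw [inner_sub_left]; ring⟩
    exact (hlt x hx).ne he
  · rintro ⟨x, hx, rfl⟩
    by_contra hn
    obtain ⟨ν, hν, hlt⟩ := exists_unit_normal h'.isOpen h'.convex h'.nonempty hn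
    obtain ⟨y, hy, he⟩ := (hproj ν hν ⟪x, ν⟫).2 ⟨x, hx, rfl⟩
    rw [← inner_add_left] at he
    exact (hlt y hy).ne he

end Rigidity

lemma nonempty_of_torsionMeasure (hn : 2 ≤ n) {μ : Measure (Euc n)} (hgreat : ∀ v : Euc n, v ≠ 0 → μ {X | ⟪X, v⟫ ≠ 0} ≠ 0)
    {Ω : Set (Euc n)} {u : Euc n → ℝ} (hμ : ∀ η : Set (Euc n), MeasurableSet η → μ η = torsionMeasure Ω u η) :
    Ω.Nonempty := by
  by_contra hne
  rw [not_nonempty_iff_eq_empty] at hne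
  have : Nonempty (Fin n) := ⟨⟨0, by omega⟩⟩
  obtain ⟨v, hv⟩ := exists_ne (0 : Euc n)
  have huniv : μ univ = 0 := by
    rw [hμ univ MeasurableSet.univ, torsionMeasure, hne]
    simp
  exact hgreat v hv (measure_mono_null (subset_univ _) huniv)

end

/-- **The Minkowski problem for the torsional rigidity: uniqueness.**
Under the assumptions of the existence theorem, the solution `Ω` is unique up to
translations: if `μ_{τ,Ω} = μ = μ_{τ,Ω'}` then `Ω' = Ω + {v}` for some vector `v`. -/
theorem torsion_minkowski_uniqueness (hn : 2 ≤ n)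
    (μ : Measure (Euc n)) [IsFiniteMeasure μ]
    (hsphere : μ (sphere (0 : Euc n) 1)ᶜ = 0)
    (hbar : ∫ X, X ∂μ = 0)
    (hgreat : ∀ v : Euc n, v ≠ 0 → μ {X | ⟪X, v⟫ ≠ 0} ≠ 0)
    (Ω Ω' : Set (Euc n))
    (hΩo : IsOpen Ω) (hΩb : IsBounded Ω) (hΩc : Convex ℝ Ω)
    (hΩ'o : IsOpen Ω') (hΩ'b : IsBounded Ω') (hΩ'c : Convex ℝ Ω')
    (u u' : Euc n → ℝ) (hu : IsTorsionFunction Ω u) (hu' : IsTorsionFunction Ω' u')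
    (hμΩ : ∀ η : Set (Euc n), MeasurableSet η → μ η = torsionMeasure Ω u η)
    (hμΩ' : ∀ η : Set (Euc n), MeasurableSet η → μ η = torsionMeasure Ω' u' η) :
    ∃ v : Euc n, Ω' = Ω + {v} := by
  obtain ⟨m, rfl⟩ : ∃ m, n = m + 1 := ⟨n - 1, by omega⟩
  have h := hu.tor hn hΩo hΩb hΩc (nonempty_of_torsionMeasure hn hgreat hμΩ)
  have h' := hu'.tor hn hΩ'o hΩ'b hΩ'c (nonempty_of_torsionMeasure hn hgreat hμΩ')
  refine eq_add_singleton_of_common h h' (μ := μ) (fun η hη => ?_) fun η hη => ?_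
  · rw [torsionMeasure_indicator hΩo, hμΩ η hη]
  · rw [torsionMeasure_indicator hΩ'o, hμΩ' η hη]

end
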